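/- Let E be a field of characteristic different from 2. Then the following are equivalent: (i) every square-free polynomial in E[X] is square-reflexive; (ii) every regular quadratic form of dimension 5 over the rational function field E(X) is isotropic, AND every anisotropic regular quadratic form over E(X) remains anisotropic over the completion E(X)_v for at least one valuation v in Ω_{E(X)/E}. -/

import Mathlib

open Polynomial

/-- `f` is square-reflexive over `E`. -/
def IsSquareReflexive {E : Type*} [Field E] (f : Polynomial E) : Prop :=
  Squarefree f ∧
  ∀ α : (Polynomial E ⧸ Ideal.span {f})ˣ,
    (∃ u : Eˣ, Algebra.norm E (α : Polynomial E ⧸ Ideal.span {f}) = (u : E) ^ 2 ∨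
               Algebra.norm E (α : Polynomial E ⧸ Ideal.span {f}) = f.leadingCoeff * (u : E) ^ 2) →
    ∃ g : Polynomial E, IsCoprime f g ∧
      (∃ β : (Polynomial E ⧸ Ideal.span {f})ˣ,
        Ideal.Quotient.mk (Ideal.span {f}) g
          = (α : Polynomial E ⧸ Ideal.span {f}) * (β : Polynomial E ⧸ Ideal.span {f}) ^ 2) ∧
      IsSquare (Ideal.Quotient.mk (Ideal.span {g}) f)

/-- Isotropy of the diagonal quadratic form `⟨a 0, …, a (n-1)⟩`. -/
def IsotropicDiag {R : Type*} [CommRing R] {n : ℕ} (a : Fin n → R) : Prop :=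
  ∃ x : Fin n → R, x ≠ 0 ∧ ∑ i, a i * x i ^ 2 = 0

/-- `v` is a ℤ-valuation on `E(X)` (i.e. a valuation with value group exactly ℤ)
which is trivial on `E`. -/
def IsZValuationTrivialOnBase (E : Type*) [Field E]
    (v : Valuation (RatFunc E) (WithZero (Multiplicative ℤ))) : Prop :=
  Function.Surjective v ∧ ∀ a : Eˣ, v (algebraMap E (RatFunc E) a) = 1

/-- The diagonal form `⟨a 0, …, a (n-1)⟩` is isotropic over the completion of `F`
at the ℤ-valuation `v`. -/
noncomputable def IsotropicCompletion {F : Type*} [Field F]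
    (v : Valuation F (WithZero (Multiplicative ℤ))) {n : ℕ} (a : Fin n → F) : Prop :=
  letI : Valued F (WithZero (Multiplicative ℤ)) := Valued.mk' v
  IsotropicDiag (fun i => UniformSpace.Completion.coe' (α := F) (a i))

namespace SquareReflexive

open WithZero

section Valuation

variable {F : Type*} [Field F]

/-- Local isotropy at `v`, phrased without reference to the completion. -/
def LocIso (v : Valuation F ℤᵐ⁰) {ι : Type*} [Fintype ι] (a : ι → F) : Prop :=
  ∃ (x : ι → F) (j : ι), v (∑ i, a i * x i ^ 2) < v (a j * x j ^ 2)

open MonoidWithZeroHom Valued WithZeroTopology UniformSpace in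
theorem locIso_of_isotropicCompletion (v : Valuation F ℤᵐ⁰) {n : ℕ} {a : Fin n → F}
    (ha : ∀ i, a i ≠ 0) (h : IsotropicCompletion v a) : LocIso v a := by
  let _ : Valued F ℤᵐ⁰ := Valued.mk' v
  obtain ⟨x, hx, h0⟩ : IsotropicDiag (fun i => (a i : Completion F)) := h
  obtain ⟨j, hj⟩ := Function.ne_iff.mp hx
  have hcont : Continuous (fun y : Fin n → Completion F =>
      (Valued.extension (∑ i, (a i : Completion F) * y i ^ 2),
        Valued.extension ((a j : Completion F) * y j ^ 2))) := by
    refine (Valued.continuous_extension.comp ?_).prodMk (Valued.continuous_extension.comp ?_)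
    · fun_prop
    · fun_prop
  have hopen : IsOpen {y : Fin n → Completion F |
      Valued.extension (∑ i, (a i : Completion F) * y i ^ 2) <
        Valued.extension ((a j : Completion F) * y j ^ 2)} :=
    isOpen_lt (continuous_fst.comp hcont) (continuous_snd.comp hcont)
  have hmem : x ∈ {y : Fin n → Completion F |
      Valued.extension (∑ i, (a i : Completion F) * y i ^ 2) <
        Valued.extension ((a j : Completion F) * y j ^ 2)} := by
    have e0 : Valued.extension (0 : Completion F) = 0 := by
      rw [← Completion.coe_zero, Valued.extension_extends, map_zero]
    have h1 : (a j : Completion F) * x j ^ 2 ≠ 0 := by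
      refine mul_ne_zero ?_ (pow_ne_zero _ hj)
      have := ha j
      exact fun h => this (Completion.coe_injective F (by simpa using h))
    have h2 : (Valued.extensionValuation ((a j : Completion F) * x j ^ 2)) ≠ 0 :=
      (Valuation.ne_zero_iff _).mpr h1
    simp only [Set.mem_ofPred_eq, h0, e0]
    refine zero_lt_iff.mpr fun h => h2 ?_
    change ValueGroup₀.embedding (Valued.extension _) = 0
    rw [h, map_zero]
  obtain ⟨y, hy⟩ := (DenseRange.piMap (fun _ : Fin n => Completion.denseRange_coe (α := F))).exists_mem_open
    hopen ⟨x, hmem⟩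
  refine ⟨y, j, ?_⟩
  simp only [Set.mem_ofPred_eq, Pi.map_apply] at hy
  have : ((∑ i, a i * y i ^ 2 : F) : Completion F) = ∑ i, (a i : Completion F) * (y i : Completion F) ^ 2 := by
    have e1 : ∀ y : F, (y : Completion F) = Completion.coeRingHom y := fun _ => rfl
    simp only [e1, map_sum, map_mul, map_pow]
  rw [← this, pow_two, ← Completion.coe_mul, ← Completion.coe_mul, Valued.extension_extends, Valued.extension_extends,
    Valuation.restrict_lt_iff, ← pow_two] at hy
  exact hy

theorem exists_approx_sqrt (v : Valuation F ℤᵐ⁰) (h2 : v 2 = 1) {c : F} (hc : v (c - 1) < 1) :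
    ∃ s : ℕ → F, s 0 = 1 ∧ ∀ n, v (s n - 1) < 1 ∧ v (s n ^ 2 - c) ≤ v (c - 1) ^ (n + 1) ∧
      v (s (n+1) - s n) ≤ v (c - 1) ^ (n + 1) := by
  have h20 : (2 : F) ≠ 0 := fun h => by simp [h] at h2
  let s : ℕ → F := fun n => Nat.rec 1 (fun _ t => t - (t ^ 2 - c) / 2) n
  have hs : ∀ n, s (n+1) = s n - (s n ^ 2 - c) / 2 := fun n => rfl
  refine ⟨s, rfl, ?_⟩
  have key : ∀ n, v (s n - 1) < 1 ∧ v (s n - 1) ≤ v (c - 1) ∧ v (s n ^ 2 - c) ≤ v (c - 1) ^ (n + 1) := by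
    intro n
    induction n with
    | zero => simp [s, Valuation.map_sub_swap v 1 c]
    | succ n ih =>
      obtain ⟨i1, i2, i3⟩ := ih
      have hle : v (s n ^ 2 - c) ≤ v (c - 1) := i3.trans (by
        simpa using pow_le_pow_right_of_le_one' (hc.le) (show 1 ≤ n + 1 by omega))
      have e1 : v (s (n+1) - 1) ≤ v (c - 1) := by
        have : s (n+1) - 1 = (s n - 1) - (s n ^ 2 - c) / 2 := by rw [hs]; ring
        rw [this]
        refine (v.map_sub _ _).trans (max_le i2 ?_)
        rw [map_div₀, h2, div_one]; exact hle
      refine ⟨e1.trans_lt hc, e1, ?_⟩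
      have : s (n+1) ^ 2 - c = - ((s n - 1) * (s n ^ 2 - c)) + ((s n ^2 - c) / 2) ^ 2 := by
        rw [hs]; field_simp; ring
      rw [this]
      refine (v.map_add _ _).trans (max_le ?_ ?_)
      · rw [Valuation.map_neg, map_mul, pow_succ' _ (n+1)]
        gcongr
      · rw [map_pow, map_div₀, h2, div_one, pow_two, pow_succ' _ (n+1)]
        gcongr
  intro n
  refine ⟨(key n).1, (key n).2.2, ?_⟩
  have : s (n+1) - s n = - ((s n ^ 2 - c) / 2) := by rw [hs]; ring
  rw [this, Valuation.map_neg, map_div₀, h2, div_one]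
  exact (key n).2.2

open MonoidWithZeroHom Valued UniformSpace in
theorem isSquare_completion (v : Valuation F ℤᵐ⁰) (h2 : v 2 = 1) {c : F} (hc : v (c - 1) < 1) :
    letI : Valued F ℤᵐ⁰ := Valued.mk' v
    ∃ s : Completion F, s ^ 2 = (c : Completion F) ∧ s ≠ 0 := by
  let _ : Valued F ℤᵐ⁰ := Valued.mk' v
  obtain ⟨s, -, hs⟩ := exists_approx_sqrt v h2 hc
  have hpow : ∀ γ : (ValueGroup₀ (.ofClass v))ˣ, ∃ N : ℕ, ∀ n ≥ N, v (c - 1) ^ (n+1) < ValueGroup₀.embedding γ.1 := by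
    intro γ
    obtain ⟨N, hN⟩ := exists_pow_lt₀ hc (Units.map (ValueGroup₀.embedding (f := (.ofClass v))) γ)
    refine ⟨N, fun n hn => lt_of_le_of_lt ?_ hN⟩
    exact pow_le_pow_right_of_le_one' hc.le (by omega)
  have hdiff : ∀ m n, n ≤ m → v (s m - s n) ≤ v (c - 1) ^ (n + 1) := by
    intro m n hnm
    induction m, hnm using Nat.le_induction with
    | base => simp
    | succ m hm ih =>
      have : s (m+1) - s n = (s (m+1) - s m) + (s m - s n) := by ring
      rw [this]
      refine (v.map_add _ _).trans (max_le ((hs m).2.2.trans ?_) ih)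
      exact pow_le_pow_right_of_le_one' hc.le (by omega)
  have hcau : CauchySeq s := by
    rw [(Valued.hasBasis_uniformity F ℤᵐ⁰).cauchySeq_iff]
    intro γ _
    obtain ⟨N, hN⟩ := hpow γ
    refine ⟨N, fun m hm n hn => ?_⟩
    change v.restrict (s n - s m) < _
    rw [Valuation.restrict_lt_iff_lt_embedding]
    rcases le_total m n with h | h
    · exact (hdiff _ _ h).trans_lt (hN _ hm)
    · rw [Valuation.map_sub_swap]
      exact (hdiff _ _ h).trans_lt (hN _ hn)
  have hlim : Filter.Tendsto (fun n => s n ^ 2) Filter.atTop (nhds c) := by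
    refine ((Filter.atTop_basis).tendsto_iff ((nhds_basis_uniformity' (Valued.hasBasis_uniformity F ℤᵐ⁰)))).mpr ?_
    intro γ _
    obtain ⟨N, hN⟩ := hpow γ
    refine ⟨N, trivial, fun n hn => ?_⟩
    change v.restrict (s n ^ 2 - c) < _
    rw [Valuation.restrict_lt_iff_lt_embedding]
    exact (hs n).2.1.trans_lt (hN n hn)
  obtain ⟨σ, hσ⟩ := cauchySeq_tendsto_of_complete (u := fun n => (s n : Completion F))
    (hcau.map (Completion.uniformContinuous_coe F))
  have e : σ ^ 2 = (c : Completion F) := by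
    refine tendsto_nhds_unique (hσ.pow 2) ?_
    have := ((Completion.continuous_coe F).tendsto c).comp hlim
    convert this using 2 with n
    simp only [Function.comp]
    rw [pow_two, pow_two, Completion.coe_mul]
  refine ⟨σ, e, ?_⟩
  rintro rfl
  have : c = 0 := Completion.coe_injective F (by rw [← e, Completion.coe_zero, zero_pow two_ne_zero])
  rw [this] at hc
  simp at hc

open Valued UniformSpace in
theorem isotropicCompletion_of_locIso (v : Valuation F ℤᵐ⁰) (h2 : v 2 = 1) {n : ℕ} {a : Fin n → F}
    (h : LocIso v a) : IsotropicCompletion v a := by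
  let _ : Valued F ℤᵐ⁰ := Valued.mk' v
  obtain ⟨x, j, hx⟩ := h
  have hne : a j * x j ^ 2 ≠ 0 := fun h => by rw [h, map_zero] at hx; exact not_lt_zero hx
  set S := ∑ i, a i * x i ^ 2 with hS
  have hc : v ((1 - S / (a j * x j ^ 2)) - 1) < 1 := by
    rw [show (1 - S / (a j * x j ^ 2)) - 1 = - (S / (a j * x j ^ 2)) by ring, Valuation.map_neg, map_div₀]
    exact (div_lt_one₀ (zero_lt_iff.mpr ((Valuation.ne_zero_iff v).mpr hne))).mpr hx
  obtain ⟨s, hs, hs0⟩ := isSquare_completion v h2 hc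
  have hxj : x j ≠ 0 := by rintro h; simp [h] at hne
  refine ⟨fun i => (if i = j then s else 1) * (x i : Completion F), ?_, ?_⟩
  · refine Function.ne_iff.mpr ⟨j, ?_⟩
    simp only [if_true, Pi.zero_apply]
    exact mul_ne_zero hs0 (fun h => hxj (Completion.coe_injective F (by simpa using h)))
  · change ∑ i, (a i : Completion F) * _ = 0
    have e1 : ∀ y : F, (y : Completion F) = Completion.coeRingHom y := fun _ => rfl
    rw [← Finset.add_sum_erase _ _ (Finset.mem_univ j)]
    have e2 : ∑ i ∈ Finset.univ.erase j, (a i : Completion F) * ((if i = j then s else 1) * (x i : Completion F)) ^ 2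
        = (((∑ i ∈ Finset.univ.erase j, a i * x i ^ 2 : F)) : Completion F) := by
      rw [e1, map_sum]
      refine Finset.sum_congr rfl fun i hi => ?_
      rw [if_neg (Finset.ne_of_mem_erase hi), one_mul, map_mul, map_pow]; rfl
    rw [e2]
    simp only [if_true]
    rw [mul_pow, hs]
    have e3 : ∑ i ∈ Finset.univ.erase j, a i * x i ^ 2 = S - a j * x j ^ 2 := by
      rw [hS, ← Finset.add_sum_erase _ _ (Finset.mem_univ j)]; ring
    rw [e3]
    simp only [e1]
    rw [← map_pow, ← map_mul, ← map_mul, ← map_add]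
    have : a j * ((1 - S / (a j * x j ^ 2)) * x j ^ 2) + (S - a j * x j ^ 2) = 0 := by
      have : a j ≠ 0 := left_ne_zero_of_mul hne
      field_simp
      ring
    rw [this, map_zero]

end Valuation

end SquareReflexive

namespace SquareReflexive

open WithZero

section Valuation

variable {F : Type*} [Field F] {v : Valuation F ℤᵐ⁰}

/-- `a` becomes a square in the completion at `v`. -/
def LocSq (v : Valuation F ℤᵐ⁰) (a : F) : Prop := ∃ s, v (a - s ^ 2) < v a

/-- `a` has even valuation. -/
def Ev (v : Valuation F ℤᵐ⁰) (a : F) : Prop := Even (log (v a))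

theorem v_ne {a : F} (ha : a ≠ 0) : v a ≠ 0 := (Valuation.ne_zero_iff v).mpr ha

theorem v_pos {a : F} (ha : a ≠ 0) : 0 < v a := zero_lt_iff.mpr (v_ne ha)

theorem ev_mul {a b : F} (ha : a ≠ 0) (hb : b ≠ 0) : Ev v (a * b) ↔ (Ev v a ↔ Ev v b) := by
  rw [Ev, map_mul, log_mul (v_ne ha) (v_ne hb), Int.even_add]; rfl

theorem ev_sq (a : F) : Ev v (a ^ 2) := by
  rw [Ev, map_pow, log_pow]; exact ⟨log (v a), by simp [two_mul]⟩

theorem ev_neg {a : F} : Ev v (-a) ↔ Ev v a := by rw [Ev, Valuation.map_neg]; rfl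

theorem ev_one : Ev v 1 := by simpa using ev_sq (v := v) 1

theorem ev_congr {a b : F} (h : v a = v b) : Ev v a ↔ Ev v b := by rw [Ev, Ev, h]

theorem LocSq.ne_zero {a : F} (h : LocSq v a) : a ≠ 0 := by
  rintro rfl; obtain ⟨s, hs⟩ := h; simp at hs

theorem v_eq_of_sub_lt {a b : F} (h : v (a - b) < v a) : v b = v a := by
  have := Valuation.map_sub_eq_of_lt_right v h
  simpa using this

theorem LocSq.ev {a : F} (h : LocSq v a) : Ev v a := by
  obtain ⟨s, hs⟩ := h
  exact (ev_congr (v_eq_of_sub_lt hs)).mp (ev_sq s)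

theorem locSq_sq {s : F} (hs : s ≠ 0) : LocSq v (s ^ 2) :=
  ⟨s, by simpa [zero_lt_iff] using hs⟩

theorem LocSq.mul {a b : F} (ha : LocSq v a) (hb : LocSq v b) : LocSq v (a * b) := by
  have ha0 := ha.ne_zero
  have hb0 := hb.ne_zero
  obtain ⟨s, hs⟩ := ha
  obtain ⟨t, ht⟩ := hb
  refine ⟨s * t, ?_⟩
  have : a * b - (s * t) ^ 2 = a * (b - t ^ 2) + (a - s ^ 2) * t ^ 2 := by ring
  rw [this]
  refine (v.map_add _ _).trans_lt (max_lt ?_ ?_)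
  · rw [map_mul, map_mul]
    exact mul_lt_mul_of_pos_left ht (v_pos ha0)
  · rw [map_mul, map_mul, v_eq_of_sub_lt ht]
    exact mul_lt_mul_of_pos_right hs (v_pos hb0)

theorem LocSq.of_mul {a b : F} (ha : LocSq v a) (hab : LocSq v (a * b)) : LocSq v b := by
  have ha0 := ha.ne_zero
  have := (ha.mul hab).mul (locSq_sq (v := v) (inv_ne_zero ha0))
  convert this using 1
  field_simp

theorem LocSq.of_mul_sq {a s : F} (h : LocSq v (a * s ^ 2)) : LocSq v a := by
  have hs : s ≠ 0 := by rintro rfl; exact h.ne_zero (by ring)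
  exact LocSq.of_mul (locSq_sq hs) (by rwa [mul_comm])

theorem LocSq.mul_sq {a s : F} (h : LocSq v a) (hs : s ≠ 0) : LocSq v (a * s ^ 2) :=
  h.mul (locSq_sq hs)

theorem norm_val {c r s : F} (hc : ¬ LocSq v c) :
    v (r ^ 2 - c * s ^ 2) = max (v (r ^ 2)) (v (c * s ^ 2)) := by
  rcases lt_trichotomy (v (r ^ 2)) (v (c * s ^ 2)) with h | h | h
  · rw [max_eq_right h.le, Valuation.map_sub_eq_of_lt_right v h]
  · rw [h, max_self]
    refine le_antisymm ((v.map_sub _ _).trans (by rw [h, max_self])) ?_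
    by_contra hlt
    rw [not_le] at hlt
    refine hc ?_
    have hs : s ≠ 0 := by rintro rfl; simp at hlt
    refine ⟨r / s, ?_⟩
    have e : c - (r / s) ^ 2 = - (r ^ 2 - c * s ^ 2) / s ^ 2 := by field_simp; ring
    rw [e, map_div₀, Valuation.map_neg]
    rw [map_mul] at hlt
    exact (div_lt_iff₀ (v_pos (pow_ne_zero 2 hs))).mpr hlt
  · rw [max_eq_left h.le, Valuation.map_sub_eq_of_lt_left v h]

theorem norm_ev {c r s : F} (hc : ¬ LocSq v c) (hc0 : c ≠ 0) (hev : Ev v c) :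
    Ev v (r ^ 2 - c * s ^ 2) := by
  rw [Ev, norm_val hc]
  rcases le_total (v (r ^ 2)) (v (c * s ^ 2)) with h | h
  · rw [max_eq_right h]
    by_cases hs : s = 0
    · subst hs; simp
    · exact (ev_mul hc0 (pow_ne_zero 2 hs)).mpr (iff_of_true hev (ev_sq s))
  · rw [max_eq_left h]; exact ev_sq r

theorem norm_odd {c r s : F} (hc0 : c ≠ 0) (hc : ¬ Ev v c) (ht : r ^ 2 - c * s ^ 2 ≠ 0) :
    LocSq v (r ^ 2 - c * s ^ 2) ∨ LocSq v (-c * (r ^ 2 - c * s ^ 2)) := by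
  have hne : v (r ^ 2) ≠ v (c * s ^ 2) := by
    intro h
    by_cases hs : s = 0
    · subst hs
      simp only [ne_eq, OfNat.ofNat_ne_zero, not_false_eq_true, zero_pow, mul_zero, map_zero, sub_zero] at h ht
      exact ht ((Valuation.zero_iff v).mp h)
    · have := (ev_congr h).mp (ev_sq r)
      rw [ev_mul hc0 (pow_ne_zero 2 hs)] at this
      exact hc (this.mpr (ev_sq s))
  rcases lt_or_gt_of_ne hne with h | h
  · right
    refine ⟨c * s, ?_⟩
    have e : -c * (r ^ 2 - c * s ^ 2) - (c * s) ^ 2 = - (c * r ^ 2) := by ring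
    rw [e, Valuation.map_neg, map_mul, map_mul, Valuation.map_neg, Valuation.map_sub_eq_of_lt_right v h]
    exact mul_lt_mul_of_pos_left h (v_pos hc0)
  · left
    refine ⟨r, ?_⟩
    have e : r ^ 2 - c * s ^ 2 - r ^ 2 = - (c * s ^ 2) := by ring
    rw [e, Valuation.map_neg, Valuation.map_sub_eq_of_lt_left v h]
    exact h

theorem locIso_of_pair {ι : Type*} [Fintype ι] {a : ι → F} {i j : ι} (hij : i ≠ j)
    (h : LocSq v (-(a i * a j))) : LocIso v a := by
  classical
  have hne := h.ne_zero
  obtain ⟨s, hs⟩ := h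
  have hi : a i ≠ 0 := by rintro h0; simp [h0] at hne
  refine ⟨fun k => if k = i then s else if k = j then a i else 0, j, ?_⟩
  have e : ∑ k, a k * (if k = i then s else if k = j then a i else 0) ^ 2
      = - (a i) * (-(a i * a j) - s ^ 2) := by
    have : ∀ k, a k * (if k = i then s else if k = j then a i else 0) ^ 2
        = (if k = i then a k * s ^ 2 else 0) + (if k = j then a k * a i ^ 2 else 0) := by
      intro k
      by_cases h1 : k = i
      · subst h1; simp [hij]
      · by_cases h2 : k = j
        · subst h2; simp [hij.symm]
        · simp [h1, h2]
    simp only [this, Finset.sum_add_distrib, Finset.sum_ite_eq', Finset.mem_univ, if_true]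
    ring
  rw [e]
  simp only [if_neg hij.symm, if_true]
  rw [map_mul, Valuation.map_neg]
  have e2 : v (a j * a i ^ 2) = v (a i) * v (-(a i * a j)) := by
    rw [Valuation.map_neg, ← map_mul]; congr 1; ring
  rw [e2]
  exact mul_lt_mul_of_pos_left hs (v_pos hi)

theorem locSq_of_locIso_pair {a b : F} (h : LocIso v ![a, b]) : LocSq v (-(a * b)) := by
  have key : ∀ a b x y : F, v (a * x ^ 2 + b * y ^ 2) < v (a * x ^ 2) → LocSq v (-(a * b)) := by
    intro a b x y h
    have h1 : v (b * y ^ 2) = v (a * x ^ 2) := by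
      have := v_eq_of_sub_lt (a := a * x ^ 2) (b := -(b * y ^ 2)) (by rwa [sub_neg_eq_add])
      rwa [Valuation.map_neg] at this
    have h0 : a * x ^ 2 ≠ 0 := by intro h0; simp [h0] at h
    have hx : x ≠ 0 := by rintro rfl; simp at h0
    have hb0 : b ≠ 0 := by
      rintro rfl
      rw [zero_mul, map_zero] at h1
      exact v_ne h0 h1.symm
    refine LocSq.of_mul_sq (s := x) ⟨b * y, ?_⟩
    have e : -(a * b) * x ^ 2 - (b * y) ^ 2 = - (b * (a * x ^ 2 + b * y ^ 2)) := by ring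
    have e2 : -(a * b) * x ^ 2 = - (b * (a * x ^ 2)) := by ring
    rw [e, e2, Valuation.map_neg, Valuation.map_neg, map_mul, map_mul v b]
    exact mul_lt_mul_of_pos_left h (v_pos hb0)
  obtain ⟨x, j, hj⟩ := h
  simp only [Fin.sum_univ_two] at hj
  fin_cases j
  · exact key a b (x 0) (x 1) hj
  · rw [mul_comm]; exact key b a (x 1) (x 0) (by rw [add_comm]; exact hj)

theorem val_pair {a b x y : F} (ha : a ≠ 0) (h : ¬ LocSq v (-(a * b))) :
    v (a * x ^ 2 + b * y ^ 2) = max (v (a * x ^ 2)) (v (b * y ^ 2)) := by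
  have h1 : ¬ LocSq v (-b / a) := fun h1 => h (by
    have := h1.mul_sq ha
    convert this using 1; field_simp)
  have := norm_val (r := x) (s := y) h1
  have e : a * x ^ 2 + b * y ^ 2 = a * (x ^ 2 - -b / a * y ^ 2) := by field_simp; ring
  rw [e, map_mul, this, mul_max, ← map_mul, ← map_mul]
  congr 1
  rw [← Valuation.map_neg]; congr 1; field_simp

theorem locSq_of_locIso_two_pairs {a b c d : F} (ha : a ≠ 0) (hb : b ≠ 0) (hc : c ≠ 0) (hd : d ≠ 0)
    (hab : Ev v (a * b)) (hcd : Ev v (c * d)) (hac : ¬ Ev v (a * c)) (h : LocIso v ![a, b, c, d]) :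
    LocSq v (-(a * b)) ∨ LocSq v (-(c * d)) := by
  by_contra hcon
  push Not at hcon
  obtain ⟨h1, h2⟩ := hcon
  obtain ⟨x, j, hj⟩ := h
  have e : ∑ i, ![a, b, c, d] i * x i ^ 2 = (a * x 0 ^ 2 + b * x 1 ^ 2) + (c * x 2 ^ 2 + d * x 3 ^ 2) := by
    simp [Fin.sum_univ_four]; ring
  rw [e] at hj
  set A := a * x 0 ^ 2 + b * x 1 ^ 2 with hA
  set C := c * x 2 ^ 2 + d * x 3 ^ 2 with hC
  have hvA := val_pair (x := x 0) (y := x 1) ha h1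
  have hvC := val_pair (x := x 2) (y := x 3) hc h2
  rw [← hA] at hvA
  rw [← hC] at hvC
  have evA : A = 0 ∨ (Ev v A ↔ Ev v a) := by
    by_cases hA0 : A = 0
    · exact Or.inl hA0
    right
    rw [ev_mul ha hb] at hab
    rcases le_total (v (a * x 0 ^ 2)) (v (b * x 1 ^ 2)) with h | h
    · rw [max_eq_right h] at hvA
      have hx : x 1 ≠ 0 := by
        intro hx; rw [hx] at hvA; simp at hvA; exact hA0 hvA
      rw [ev_congr hvA, ev_mul hb (pow_ne_zero 2 hx), hab]
      simp [ev_sq]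
    · rw [max_eq_left h] at hvA
      have hx : x 0 ≠ 0 := by
        intro hx; rw [hx] at hvA; simp at hvA; exact hA0 hvA
      rw [ev_congr hvA, ev_mul ha (pow_ne_zero 2 hx)]
      simp [ev_sq]
  have evC : C = 0 ∨ (Ev v C ↔ Ev v c) := by
    by_cases hC0 : C = 0
    · exact Or.inl hC0
    right
    rw [ev_mul hc hd] at hcd
    rcases le_total (v (c * x 2 ^ 2)) (v (d * x 3 ^ 2)) with h | h
    · rw [max_eq_right h] at hvC
      have hx : x 3 ≠ 0 := by
        intro hx; rw [hx] at hvC; simp at hvC; exact hC0 hvC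
      rw [ev_congr hvC, ev_mul hd (pow_ne_zero 2 hx), hcd]
      simp [ev_sq]
    · rw [max_eq_left h] at hvC
      have hx : x 2 ≠ 0 := by
        intro hx; rw [hx] at hvC; simp at hvC; exact hC0 hvC
      rw [ev_congr hvC, ev_mul hc (pow_ne_zero 2 hx)]
      simp [ev_sq]
  have hsum : v (A + C) = max (v A) (v C) := by
    rcases lt_trichotomy (v A) (v C) with h | h | h
    · rw [max_eq_right h.le, Valuation.map_add_eq_of_lt_right v h]
    · rcases evA with h0 | h0
      · simp [h0]
      rcases evC with h0' | h0'
      · simp [h0']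
      exfalso
      apply hac
      rw [ev_mul ha hc, ← h0, ← h0', ev_congr h]
    · rw [max_eq_left h.le, Valuation.map_add_eq_of_lt_left v h]
  rw [hsum, hvA, hvC] at hj
  refine absurd hj (not_lt.mpr ?_)
  fin_cases j <;> simp

/-- Unit ternary forms are isotropic at `v`. -/
def TernaryLoc (v : Valuation F ℤᵐ⁰) : Prop :=
  ∀ a b c : F, a ≠ 0 → b ≠ 0 → c ≠ 0 → (Ev v a ↔ Ev v b) → (Ev v a ↔ Ev v c) → LocIso v ![a, b, c]

theorem locIso_of_embedding {ι κ : Type*} [Fintype ι] [Fintype κ] {a : ι → F} (e : κ ↪ ι)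
    (h : LocIso v (fun k => a (e k))) : LocIso v a := by
  classical
  obtain ⟨x, j, hj⟩ := h
  refine ⟨Function.extend e x 0, e j, ?_⟩
  rw [e.injective.extend_apply]
  convert hj using 2
  symm
  refine Finset.sum_of_injOn e e.injective.injOn (by simp) ?_ ?_
  · intro i _ hi
    rw [Function.extend_apply' _ _ _ (by simpa using hi)]; simp
  · intro k _
    rw [e.injective.extend_apply]

theorem locIso_of_three {ι : Type*} [Fintype ι] {a : ι → F} (hT : TernaryLoc v) {i j k : ι}
    (hij : i ≠ j) (hik : i ≠ k) (hjk : j ≠ k) (ha : ∀ i, a i ≠ 0)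
    (h1 : Ev v (a i) ↔ Ev v (a j)) (h2 : Ev v (a i) ↔ Ev v (a k)) : LocIso v a := by
  have hinj : Function.Injective ![i, j, k] := by
    intro x y hxy
    fin_cases x <;> fin_cases y <;> simp_all
  refine locIso_of_embedding ⟨![i, j, k], hinj⟩ ?_
  convert hT (a i) (a j) (a k) (ha i) (ha j) (ha k) h1 h2 using 1
  funext t; fin_cases t <;> rfl

theorem ternaryLoc_of_isotropic (hv : Function.Surjective v)
    (h5 : ∀ a : Fin 5 → F, (∀ i, a i ≠ 0) → IsotropicDiag a) : TernaryLoc v := by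
  intro a b c ha hb hc hab hac
  obtain ⟨π, hπ⟩ := hv (exp 1)
  have hπ0 : π ≠ 0 := by rintro rfl; rw [map_zero] at hπ; exact exp_ne_zero hπ.symm
  have hπo : ¬ Ev v π := by rw [Ev, hπ, log_exp]; decide
  obtain ⟨x, hx, h0⟩ := h5 ![a, b, c, π * a, π * b] (by
    intro i; fin_cases i <;> simp [ha, hb, hc, hπ0])
  by_contra hcon
  have hT : ∀ y : Fin 3 → F, ∀ j, v (![a, b, c] j * y j ^ 2) ≤ v (∑ i, ![a, b, c] i * y i ^ 2) := by
    intro y j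
    by_contra h
    exact hcon ⟨y, j, not_le.mp h⟩
  have hab' : ¬ LocSq v (-(a * b)) := fun h =>
    hcon (locIso_of_pair (i := 0) (j := 1) (by decide) (by simpa using h))
  set A := a * x 0 ^ 2 + b * x 1 ^ 2 + c * x 2 ^ 2 with hA
  set B := a * x 3 ^ 2 + b * x 4 ^ 2 with hB
  have hAB : A = - (π * B) := by
    simp [Fin.sum_univ_five] at h0
    rw [hA, hB]; linear_combination h0
  have hvB := val_pair (x := x 3) (y := x 4) ha hab'
  rw [← hB] at hvB
  have hTx := hT ![x 0, x 1, x 2]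
  have es : ∑ i, ![a, b, c] i * ![x 0, x 1, x 2] i ^ 2 = A := by simp [Fin.sum_univ_three, hA]
  rw [es] at hTx
  have t0 : v (a * x 0 ^ 2) ≤ v A := hTx 0
  have t1 : v (b * x 1 ^ 2) ≤ v A := hTx 1
  have t2 : v (c * x 2 ^ 2) ≤ v A := hTx 2
  have zero_of : ∀ {d y : F}, d ≠ 0 → v (d * y ^ 2) ≤ 0 → y = 0 := by
    intro d y hd h
    have := (Valuation.zero_iff v).mp (le_zero_iff.mp h)
    simpa [hd] using this
  by_cases hB0 : B = 0
  · rw [hB0, map_zero] at hvB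
    rw [hB0, mul_zero, neg_zero] at hAB
    rw [hAB, map_zero] at t0 t1 t2
    apply hx
    funext i
    fin_cases i
    · exact zero_of ha t0
    · exact zero_of hb t1
    · exact zero_of hc t2
    · exact zero_of ha (hvB ▸ le_max_left _ _)
    · exact zero_of hb (hvB ▸ le_max_right _ _)
  · have hA0 : A ≠ 0 := by rw [hAB]; simp [hπ0, hB0]
    have evB : Ev v B ↔ Ev v a := by
      rcases max_choice (v (a * x 3 ^ 2)) (v (b * x 4 ^ 2)) with h | h
      · rw [h] at hvB
        have : x 3 ≠ 0 := by
          intro hx; rw [hx] at hvB; simp at hvB; exact hB0 hvB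
        rw [ev_congr hvB, ev_mul ha (pow_ne_zero 2 this)]; simp [ev_sq]
      · rw [h] at hvB
        have : x 4 ≠ 0 := by
          intro hx; rw [hx] at hvB; simp at hvB; exact hB0 hvB
        rw [ev_congr hvB, ev_mul hb (pow_ne_zero 2 this), hab]; simp [ev_sq]
    have hle : v A ≤ max (max (v (a * x 0 ^ 2)) (v (b * x 1 ^ 2))) (v (c * x 2 ^ 2)) :=
      (v.map_add _ _).trans (max_le_max (v.map_add _ _) le_rfl)
    have hcase : v A = v (a * x 0 ^ 2) ∨ v A = v (b * x 1 ^ 2) ∨ v A = v (c * x 2 ^ 2) := by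
      rcases max_choice (max (v (a * x 0 ^ 2)) (v (b * x 1 ^ 2))) (v (c * x 2 ^ 2)) with h | h
      · rcases max_choice (v (a * x 0 ^ 2)) (v (b * x 1 ^ 2)) with h' | h'
        · exact Or.inl (le_antisymm (by rwa [h, h'] at hle) t0)
        · exact Or.inr (Or.inl (le_antisymm (by rwa [h, h'] at hle) t1))
      · exact Or.inr (Or.inr (le_antisymm (by rwa [h] at hle) t2))
    have gen : ∀ {d y : F}, d ≠ 0 → (Ev v a ↔ Ev v d) → v A = v (d * y ^ 2) → (Ev v A ↔ Ev v a) := by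
      intro d y hd hda h
      have : y ≠ 0 := by
        rintro rfl; simp at h; exact hA0 h
      rw [ev_congr h, ev_mul hd (pow_ne_zero 2 this), hda]; simp [ev_sq]
    have evA : Ev v A ↔ Ev v a := by
      rcases hcase with h | h | h
      · exact gen ha Iff.rfl h
      · exact gen hb hab h
      · exact gen hc hac h
    rw [hAB, ev_neg, ev_mul hπ0 hB0, evB] at evA
    tauto

end Valuation

end SquareReflexive

namespace SquareReflexive

open WithZero

section Places

variable {E : Type*} [Field E] {v : Valuation (RatFunc E) ℤᵐ⁰}

local notation "κ" => algebraMap (Polynomial E) (RatFunc E)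

theorem κ_ne_zero {f : E[X]} (hf : f ≠ 0) : (κ f : RatFunc E) ≠ 0 :=
  (map_ne_zero_iff _ (RatFunc.algebraMap_injective E)).mpr hf

/-- `v` is the place of `E(X)` attached to the prime polynomial `p`. -/
structure PlaceAt (v : Valuation (RatFunc E) ℤᵐ⁰) (p : E[X]) : Prop where
  prime : Prime p
  le_one : ∀ f : E[X], v (κ f) ≤ 1
  lt_one : ∀ f : E[X], v (κ f) < 1 ↔ p ∣ f
  surj : Function.Surjective v

/-- `v` is the degree place of `E(X)`. -/
structure InfPlace (v : Valuation (RatFunc E) ℤᵐ⁰) : Prop where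
  val : ∀ f : E[X], f ≠ 0 → v (κ f) = v (κ X) ^ f.natDegree
  one_lt : 1 < v (κ (X : E[X]))
  surj : Function.Surjective v

theorem place_cases (hv : IsZValuationTrivialOnBase E v) :
    (∃ p, PlaceAt v p) ∨ InfPlace v := by
  have hT : v.IsTrivialOn E := ⟨fun a ha => hv.2 (Units.mk0 a ha)⟩
  obtain ⟨π, hπ⟩ := hv.1 (exp 1)
  have hN : v.IsNontrivial := ⟨π, by rw [hπ]; simp, by rw [hπ]; decide⟩
  rcases lt_or_ge 1 (v RatFunc.X) with h | h
  · right
    refine ⟨fun f hf => ?_, by simpa using h, hv.1⟩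
    rw [RatFunc.valuation_eq_valuation_X_zpow_intDegree_of_one_lt_valuation_X h (κ_ne_zero hf),
      RatFunc.intDegree_polynomial, zpow_natCast, RatFunc.algebraMap_X]
  · left
    have hle : ∀ f : E[X], v (κ f) ≤ 1 := Polynomial.valuation_le_one_of_valuation_X_le_one _ h
    have hirr := RatFunc.irreducible_min_polynomial_valuation_lt_one_and_ne_zero
      (RatFunc.setOfPred_polynomial_valuation_lt_one_and_ne_zero_nonempty (v := v) h)
    have hlt := RatFunc.valuation_uniformizingPolynomial_lt_one (v := v) h
    refine ⟨RatFunc.uniformizingPolynomial (v := v) h, hirr.prime, hle, fun f => ⟨fun hf => ?_, ?_⟩, hv.1⟩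
    · by_contra hnd
      obtain ⟨a, b, hab⟩ := (hirr.coprime_iff_not_dvd).mpr hnd
      have : v (κ (1 : E[X])) < 1 := by
        rw [← hab, map_add]
        refine (v.map_add _ _).trans_lt (max_lt ?_ ?_)
        · rw [map_mul, map_mul]; exact Right.mul_lt_one_of_le_of_lt (hle a) hlt
        · rw [map_mul, map_mul]; exact Right.mul_lt_one_of_le_of_lt (hle b) hf
      simp at this
    · rintro ⟨g, rfl⟩
      rw [mul_comm, map_mul, map_mul]
      exact Right.mul_lt_one_of_le_of_lt (hle g) hlt

theorem exists_placeAt {p : E[X]} (hp : Prime p) :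
    ∃ v : Valuation (RatFunc E) ℤᵐ⁰, IsZValuationTrivialOnBase E v ∧ PlaceAt v p := by
  let P : IsDedekindDomain.HeightOneSpectrum E[X] :=
    ⟨Ideal.span {p}, (Ideal.span_singleton_prime hp.ne_zero).mpr hp, by simpa using hp.ne_zero⟩
  have hle : ∀ f : E[X], P.valuation (RatFunc E) (κ f) ≤ 1 := P.valuation_le_one
  have hlt : ∀ f : E[X], P.valuation (RatFunc E) (κ f) < 1 ↔ p ∣ f := fun f => by
    rw [P.valuation_lt_one_iff_mem]; exact Ideal.mem_span_singleton
  refine ⟨P.valuation (RatFunc E), ⟨P.valuation_surjective _, fun a => ?_⟩, hp, hle, hlt,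
    P.valuation_surjective _⟩
  refine le_antisymm ?_ (not_lt.mp ?_)
  · simpa using hle (C (a : E))
  · have := (hlt (C (a : E))).not.mpr (fun h => hp.not_isUnit (isUnit_of_dvd_unit h (by simp)))
    simpa using this

theorem exists_infPlace : ∃ v : Valuation (RatFunc E) ℤᵐ⁰, IsZValuationTrivialOnBase E v ∧ InfPlace v := by
  classical
  have hX : RatFunc.inftyValuation E (κ (X : E[X])) = exp 1 := by
    rw [RatFunc.algebraMap_X, RatFunc.inftyValuation.X]
  have hs : Function.Surjective (RatFunc.inftyValuation E) := by
    intro x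
    rcases eq_or_ne x 0 with rfl | hx
    · exact ⟨0, map_zero _⟩
    · exact ⟨RatFunc.X ^ log x, by rw [RatFunc.inftyValuation.X_zpow, exp_log hx]⟩
  refine ⟨RatFunc.inftyValuation E, ⟨hs, fun a => ?_⟩, fun f hf => ?_, by rw [hX]; decide, hs⟩
  · exact Valuation.IsTrivialOn.eq_one (v := RatFunc.inftyValuation E) (a : E) a.ne_zero
  · rw [hX]
    have := RatFunc.inftyValuation.polynomial (F := E) hf
    exact this.trans (by rw [← exp_nsmul]; simp)

theorem valuation_two (hE : (2 : E) ≠ 0) (hv : IsZValuationTrivialOnBase E v) : v 2 = 1 := by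
  have := hv.2 (Units.mk0 2 hE)
  rwa [Units.val_mk0, map_ofNat] at this

namespace PlaceAt

variable {p : E[X]}

theorem eq_one (h : PlaceAt v p) {f : E[X]} (hf : ¬ p ∣ f) : v (κ f) = 1 :=
  le_antisymm (h.le_one f) (not_lt.mp ((h.lt_one f).not.mpr hf))

theorem ev_of_not_dvd (h : PlaceAt v p) {f : E[X]} (hf : ¬ p ∣ f) : Ev v (κ f) := by
  rw [Ev, h.eq_one hf, log_one]; exact Even.zero

theorem exists_pow (h : PlaceAt v p) {f : E[X]} (hf : f ≠ 0) : ∃ n : ℕ, v (κ f) = v (κ p) ^ n := by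
  have hfin : FiniteMultiplicity p f := FiniteMultiplicity.of_prime_left h.prime hf
  obtain ⟨g, hg, hnd⟩ := hfin.exists_eq_pow_mul_and_not_dvd
  refine ⟨multiplicity p f, ?_⟩
  conv_lhs => rw [hg]
  rw [map_mul, map_mul, h.eq_one hnd, mul_one, map_pow, map_pow]

theorem not_ev_self (h : PlaceAt v p) : ¬ Ev v (κ p) := by
  intro hev
  obtain ⟨x, hx⟩ := h.surj (exp 1)
  have hx0 : x ≠ 0 := by rintro rfl; rw [map_zero] at hx; exact exp_ne_zero hx.symm
  have : Ev v x := by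
    induction x using RatFunc.induction_on with
    | f a b hb =>
      have ha : a ≠ 0 := by rintro rfl; simp at hx0
      obtain ⟨n, hn⟩ := h.exists_pow ha
      obtain ⟨m, hm⟩ := h.exists_pow hb
      have h1 : Ev v (κ a) := by rw [Ev, hn, log_pow]; exact hev.nsmul_right n
      have h2 : Ev v (κ b) := by rw [Ev, hm, log_pow]; exact hev.nsmul_right m
      rw [Ev, map_div₀, log_div (v_ne (κ_ne_zero ha)) (v_ne (κ_ne_zero hb))]
      exact Even.sub h1 h2
  rw [Ev, hx, log_exp] at this
  exact absurd this (by decide)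

theorem ev_iff (h : PlaceAt v p) {f : E[X]} (hf : Squarefree f) : Ev v (κ f) ↔ ¬ p ∣ f := by
  refine ⟨?_, h.ev_of_not_dvd⟩
  rintro hev ⟨g, rfl⟩
  have hpg : ¬ p ∣ g := by
    rintro ⟨k, rfl⟩
    exact h.prime.not_isUnit (hf p ⟨k, by ring⟩)
  have hg : g ≠ 0 := by rintro rfl; exact hpg (dvd_zero _)
  rw [map_mul, ev_mul (κ_ne_zero h.prime.ne_zero) (κ_ne_zero hg)] at hev
  exact h.not_ev_self (hev.mpr (h.ev_of_not_dvd hpg))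

theorem locSq (h : PlaceAt v p) {f k : E[X]} (hf : ¬ p ∣ f) (hk : p ∣ f - k ^ 2) : LocSq v (κ f) := by
  refine ⟨κ k, ?_⟩
  rw [← map_pow, ← map_sub, h.eq_one hf]
  exact (h.lt_one _).mpr hk

theorem exists_of_locSq (h : PlaceAt v p) {f : E[X]} (hf : ¬ p ∣ f) (hs : LocSq v (κ f)) :
    ∃ k, p ∣ f - k ^ 2 := by
  obtain ⟨s, hs⟩ := hs
  have hval := v_eq_of_sub_lt hs
  rw [h.eq_one hf, map_pow] at hval
  have hs1 : v s = 1 := by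
    rcases lt_trichotomy (v s) 1 with h1 | h1 | h1
    · exact absurd hval (pow_lt_one₀ zero_le h1 two_ne_zero).ne
    · exact h1
    · exact absurd hval (one_lt_pow₀ h1 two_ne_zero).ne'
  have hd := RatFunc.denom_ne_zero s
  have hsd := RatFunc.num_div_denom s
  have hnd : v (κ s.num) = v (κ s.denom) := by
    rw [← hsd, map_div₀] at hs1
    exact (div_eq_one_iff_eq (v_ne (κ_ne_zero hd))).mp hs1
  have hpd : ¬ p ∣ s.denom := by
    intro hpd
    have hpn : p ∣ s.num := (h.lt_one _).mp (hnd ▸ (h.lt_one _).mpr hpd)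
    exact h.prime.not_isUnit ((RatFunc.isCoprime_num_denom s).isUnit_of_dvd' hpn hpd)
  obtain ⟨a, b, hab⟩ := (h.prime.irreducible.coprime_iff_not_dvd).mpr hpd
  have hdv : p ∣ f * s.denom ^ 2 - s.num ^ 2 := by
    rw [← h.lt_one]
    have : (κ (f * s.denom ^ 2 - s.num ^ 2) : RatFunc E) = (κ f - s ^ 2) * (κ s.denom) ^ 2 := by
      have h1 : (κ s.num : RatFunc E) = s * κ s.denom := by
        conv_lhs => rw [← div_mul_cancel₀ (κ s.num : RatFunc E) (κ_ne_zero hd), hsd]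
      rw [map_sub, map_mul, map_pow, map_pow, h1]; ring
    rw [this, map_mul, map_pow, h.eq_one hpd, one_pow, mul_one]
    rwa [h.eq_one hf] at hs
  refine ⟨b * s.num, ?_⟩
  have e : f - (b * s.num) ^ 2 = b ^ 2 * (f * s.denom ^ 2 - s.num ^ 2) + p * (f * a * (1 + b * s.denom)) := by
    have h1 : p * a = 1 - b * s.denom := by linear_combination hab
    linear_combination (- f * (1 + b * s.denom)) * h1
  rw [e]
  exact dvd_add (hdv.mul_left _) (dvd_mul_right _ _)

end PlaceAt

namespace InfPlace

theorem v_X_ne (h : InfPlace v) : v (κ (X : E[X])) ≠ 0 := (zero_lt_one.trans h.one_lt).ne'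

theorem lt_of_degree_lt (h : InfPlace v) {f g : E[X]} (hfg : f.degree < g.degree) : v (κ f) < v (κ g) := by
  have hg : g ≠ 0 := by rintro rfl; simp at hfg
  rcases eq_or_ne f 0 with rfl | hf
  · rw [map_zero, map_zero]; exact v_pos (κ_ne_zero hg)
  · rw [h.val f hf, h.val g hg]
    exact pow_lt_pow_right₀ h.one_lt (natDegree_lt_natDegree hf hfg)

theorem degree_lt_of_lt (h : InfPlace v) {f g : E[X]} (hfg : v (κ f) < v (κ g)) : f.degree < g.degree := by
  by_contra hcon
  rcases lt_or_eq_of_le (not_lt.mp hcon) with h1 | h1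
  · exact absurd hfg (h.lt_of_degree_lt h1).not_gt
  · rcases eq_or_ne f 0 with rfl | hf
    · rw [degree_zero, degree_eq_bot] at h1
      rw [h1] at hfg; exact lt_irrefl _ hfg
    · have hg : g ≠ 0 := by rintro rfl; rw [degree_zero, eq_comm, degree_eq_bot] at h1; exact hf h1
      rw [h.val f hf, h.val g hg, natDegree_eq_of_degree_eq h1] at hfg
      exact lt_irrefl _ hfg

theorem ev_iff (h : InfPlace v) {f : E[X]} (hf : f ≠ 0) : Ev v (κ f) ↔ Even f.natDegree := by
  have hX : ¬ Even (log (v (κ (X : E[X])))) := by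
    intro hev
    obtain ⟨x, hx⟩ := h.surj (exp 1)
    have hx0 : x ≠ 0 := by rintro rfl; rw [map_zero] at hx; exact exp_ne_zero hx.symm
    have : Ev v x := by
      induction x using RatFunc.induction_on with
      | f a b hb =>
        have ha : a ≠ 0 := by rintro rfl; simp at hx0
        have h1 : Ev v (κ a) := by rw [Ev, h.val a ha, log_pow]; exact hev.nsmul_right _
        have h2 : Ev v (κ b) := by rw [Ev, h.val b hb, log_pow]; exact hev.nsmul_right _
        rw [Ev, map_div₀, log_div (v_ne (κ_ne_zero ha)) (v_ne (κ_ne_zero hb))]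
        exact Even.sub h1 h2
    rw [Ev, hx, log_exp] at this
    exact absurd this (by decide)
  rw [Ev, h.val f hf, log_pow, nsmul_eq_mul, Int.even_mul, Int.even_coe_nat]
  tauto

theorem locSq (h : InfPlace v) {f : E[X]} (hf : f ≠ 0) (hd : Even f.natDegree)
    (hc : IsSquare f.leadingCoeff) : LocSq v (κ f) := by
  obtain ⟨k, hk⟩ := hd
  obtain ⟨s, hs⟩ := hc
  have hs0 : s ≠ 0 := by rintro rfl; simp at hs; exact hf hs
  refine ⟨κ (C s * X ^ k), ?_⟩
  rw [← map_pow, ← map_sub]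
  apply h.lt_of_degree_lt
  have e : (C s * X ^ k) ^ 2 = C f.leadingCoeff * X ^ f.natDegree := by
    rw [hs, hk, C_mul]; ring
  rw [e]
  refine degree_sub_lt_left ?_ hf ?_
  · rw [degree_C_mul_X_pow _ (leadingCoeff_ne_zero.mpr hf), degree_eq_natDegree hf]
  · simp

theorem of_locSq (h : InfPlace v) {f : E[X]} (hs : LocSq v (κ f)) :
    Even f.natDegree ∧ IsSquare f.leadingCoeff := by
  have hf : f ≠ 0 := by rintro rfl; exact hs.ne_zero (map_zero _)
  refine ⟨(h.ev_iff hf).mp hs.ev, ?_⟩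
  obtain ⟨s, hs⟩ := hs
  have hd := RatFunc.denom_ne_zero s
  have hsd := RatFunc.num_div_denom s
  have hdv : v (κ (f * s.denom ^ 2 - s.num ^ 2)) < v (κ (f * s.denom ^ 2)) := by
    have : (κ (f * s.denom ^ 2 - s.num ^ 2) : RatFunc E) = (κ f - s ^ 2) * (κ s.denom) ^ 2 := by
      have h1 : (κ s.num : RatFunc E) = s * κ s.denom := by
        conv_lhs => rw [← div_mul_cancel₀ (κ s.num : RatFunc E) (κ_ne_zero hd), hsd]
      rw [map_sub, map_mul, map_pow, map_pow, h1]; ring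
    rw [this, map_mul, map_mul κ f, map_mul v, map_pow κ]
    exact mul_lt_mul_of_pos_right hs (v_pos (pow_ne_zero 2 (κ_ne_zero hd)))
  have hlt := h.degree_lt_of_lt hdv
  have hl := leadingCoeff_sub_of_degree_lt hlt
  have hl2 : (f * s.denom ^ 2).leadingCoeff = (s.num ^ 2).leadingCoeff := by
    have : (s.num ^ 2) = f * s.denom ^ 2 - (f * s.denom ^ 2 - s.num ^ 2) := by ring
    rw [this, leadingCoeff_sub_of_degree_lt hlt]
  rw [leadingCoeff_mul, leadingCoeff_pow, leadingCoeff_pow] at hl2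
  refine ⟨s.num.leadingCoeff / s.denom.leadingCoeff, ?_⟩
  have := leadingCoeff_ne_zero.mpr hd
  field_simp
  exact hl2

end InfPlace

end Places

end SquareReflexive

namespace SquareReflexive

section Squarefree

variable {E : Type*} [Field E]

theorem exists_squarefree_mul_sq {a : E[X]} (ha : a ≠ 0) :
    ∃ b s, Squarefree b ∧ s ≠ 0 ∧ a = b * s ^ 2 := by
  induction hn : a.natDegree using Nat.strong_induction_on generalizing a with
  | _ n ih =>
    by_cases h : Squarefree a
    · exact ⟨a, 1, h, one_ne_zero, by ring⟩
    · simp only [Squarefree, not_forall] at h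
      obtain ⟨x, ⟨y, hy⟩, hx⟩ := h
      have hx0 : x ≠ 0 := by rintro rfl; simp at hy; exact ha hy
      have hy0 : y ≠ 0 := by rintro rfl; simp at hy; exact ha hy
      have hd : 0 < x.natDegree := by
        rw [Nat.pos_iff_ne_zero]
        intro h0
        exact hx (Polynomial.isUnit_iff_degree_eq_zero.mpr (by rw [degree_eq_natDegree hx0, h0]; rfl))
      have : a.natDegree = x.natDegree + x.natDegree + y.natDegree := by
        rw [hy, natDegree_mul (mul_ne_zero hx0 hx0) hy0, natDegree_mul hx0 hx0]
      obtain ⟨b, s, hb, hs, e⟩ := ih y.natDegree (by omega) hy0 rfl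
      exact ⟨b, s * x, hb, mul_ne_zero hs hx0, by rw [hy, e]; ring⟩

theorem natDegree_le_of_eq_mul_sq {a b s : E[X]} (ha : a ≠ 0) (h : a = b * s ^ 2) :
    b.natDegree ≤ a.natDegree :=
  natDegree_le_of_dvd ⟨_, h⟩ ha

theorem exists_squarefree_ratFunc {x : RatFunc E} (hx : x ≠ 0) :
    ∃ (b : E[X]) (s : RatFunc E), Squarefree b ∧ s ≠ 0 ∧ x = algebraMap E[X] (RatFunc E) b * s ^ 2 := by
  have hd := κ_ne_zero (RatFunc.denom_ne_zero x)
  have hn : x.num ≠ 0 := RatFunc.num_ne_zero hx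
  obtain ⟨b, s, hb, hs, e⟩ := exists_squarefree_mul_sq (mul_ne_zero hn (RatFunc.denom_ne_zero x))
  refine ⟨b, algebraMap _ _ s / algebraMap _ _ x.denom, hb, div_ne_zero (κ_ne_zero hs) hd, ?_⟩
  have e2 := congrArg (algebraMap E[X] (RatFunc E)) e
  rw [map_mul, map_mul, map_pow] at e2
  conv_lhs => rw [← RatFunc.num_div_denom x]
  field_simp
  rw [e2]

theorem squarefree_induction {P : (f : E[X]) → Squarefree f → Prop}
    (hu : ∀ u (hu : IsUnit u), P u hu.squarefree)
    (hm : ∀ p f (_ : Prime p) (h : Squarefree (p * f)), ¬ p ∣ f → P f h.of_mul_right → P (p * f) h)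
    (f : E[X]) (hf : Squarefree f) : P f hf := by
  induction f using UniqueFactorizationMonoid.induction_on_prime with
  | h₁ => exact absurd hf not_squarefree_zero
  | h₂ x hx => exact hu x hx
  | h₃ a p ha hp ih =>
    refine hm p a hp hf ?_ (ih hf.of_mul_right)
    rintro ⟨k, rfl⟩
    exact hp.not_isUnit (hf p ⟨k, by ring⟩)

theorem dvd_of_forall_prime_dvd {f x : E[X]} (hf : Squarefree f)
    (h : ∀ p, Prime p → p ∣ f → p ∣ x) : f ∣ x := by
  induction f, hf using squarefree_induction with
  | hu u hu => exact hu.dvd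
  | hm p f hp hf hpf ih =>
    exact ((hp.irreducible.coprime_iff_not_dvd).mpr hpf).mul_dvd (h p hp (dvd_mul_right _ _))
      (ih fun q hq hqf => h q hq (hqf.mul_left _))

/-- Chinese remainder theorem for a squarefree modulus. -/
theorem exists_forall_prime {f : E[X]} (hf : Squarefree f) (P : E[X] → E[X] → Prop)
    (hP : ∀ p q k l, Associated p q → p ∣ k - l → P p k → P q l)
    (h : ∀ p, Prime p → p ∣ f → ∃ k, P p k) : ∃ k, ∀ p, Prime p → p ∣ f → P p k := by
  induction f, hf using squarefree_induction with
  | hu u hu => exact ⟨0, fun p hp hpu => absurd (isUnit_of_dvd_unit hpu hu) hp.not_isUnit⟩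
  | hm p f hp hf hpf ih =>
    obtain ⟨k, hk⟩ := ih fun q hq hqf => h q hq (hqf.mul_left _)
    obtain ⟨l, hl⟩ := h p hp (dvd_mul_right _ _)
    obtain ⟨a, b, hab⟩ := (hp.irreducible.coprime_iff_not_dvd).mpr hpf
    refine ⟨a * p * k + b * f * l, fun q hq hqpf => ?_⟩
    rcases hq.dvd_or_dvd hqpf with hqp | hqf
    · refine hP p q l _ (hq.associated_of_dvd hp hqp).symm ⟨a * (l - k), ?_⟩ hl
      linear_combination (-l) * hab
    · refine hP q q k _ (Associated.refl q) (hqf.trans ⟨b * (k - l), ?_⟩) (hk q hq hqf)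
      linear_combination (-k) * hab

theorem exists_dvd_sub_sq {f a : E[X]} (hf : Squarefree f)
    (h : ∀ p, Prime p → p ∣ f → ∃ k, p ∣ a - k ^ 2) : ∃ k, f ∣ a - k ^ 2 := by
  obtain ⟨k, hk⟩ := exists_forall_prime hf (fun p k => p ∣ a - k ^ 2) (fun p q k l hpq hkl hk => by
    rw [← hpq.dvd_iff_dvd_left]
    have : a - l ^ 2 = (a - k ^ 2) + (k - l) * (k + l) := by ring
    rw [this]; exact dvd_add hk (hkl.mul_right _)) h
  exact ⟨k, dvd_of_forall_prime_dvd hf hk⟩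

theorem isCoprime_of_forall_prime {f g : E[X]} (hf : f ≠ 0) (h : ∀ p, Prime p → p ∣ f → ¬ p ∣ g) :
    IsCoprime f g := by
  refine isCoprime_of_prime_dvd (fun h0 => hf h0.1) h

theorem not_dvd_of_isCoprime {f g p : E[X]} (hp : Prime p) (h : IsCoprime f g) (hf : p ∣ f) : ¬ p ∣ g :=
  fun hg => hp.not_isUnit (h.isUnit_of_dvd' hf hg)

theorem not_dvd_of_squarefree_mul {f g p : E[X]} (hp : Prime p) (h : Squarefree (f * g)) (hf : p ∣ f) :
    ¬ p ∣ g :=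
  fun hg => hp.not_isUnit (h p (mul_dvd_mul hf hg))

theorem squarefree_mul_of_isCoprime {f g : E[X]} (h : IsCoprime f g) (hf : Squarefree f)
    (hg : Squarefree g) : Squarefree (f * g) :=
  squarefree_mul_iff.mpr ⟨h.isRelPrime, hf, hg⟩

theorem squarefree_C_mul {c : E} (hc : c ≠ 0) {f : E[X]} (hf : Squarefree f) : Squarefree (C c * f) :=
  ((associated_unit_mul_left f (C c) (isUnit_C.mpr hc.isUnit)).squarefree_iff).mpr hf

theorem not_prime_dvd_C {c : E} (hc : c ≠ 0) {p : E[X]} (hp : Prime p) : ¬ p ∣ C c :=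
  fun h => hp.not_isUnit (isUnit_of_dvd_unit h (isUnit_C.mpr hc.isUnit))

theorem natDegree_pos_of_not_isUnit {p : E[X]} (h0 : p ≠ 0) (hp : ¬ IsUnit p) : 0 < p.natDegree := by
  rw [Nat.pos_iff_ne_zero]
  intro h
  rw [eq_C_of_natDegree_eq_zero h] at hp h0
  exact hp (isUnit_C.mpr (isUnit_iff_ne_zero.mpr fun h => h0 (by rw [h, C_0])))

theorem exists_prime_dvd {f : E[X]} (hf : 0 < f.natDegree) : ∃ p, Prime p ∧ p ∣ f := by
  obtain ⟨p, hp, hpf⟩ := WfDvdMonoid.exists_irreducible_factor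
    (fun h => hf.ne' (natDegree_eq_zero_of_isUnit h)) (by rintro rfl; simp at hf : f ≠ 0)
  exact ⟨p, hp.prime, hpf⟩

end Squarefree

end SquareReflexive

namespace SquareReflexive

section Norm

theorem det_aeval_eq_prod {K ι : Type*} [Field K] [Fintype ι] [DecidableEq ι] (M : Matrix ι ι K)
    {g : K[X]} (hg : g.Splits) (hM : M.charpoly.Splits) :
    (aeval M g).det = (M.charpoly.roots.map fun ρ => g.eval ρ).prod := by
  have hcard : M.charpoly.roots.card = Fintype.card ι := by
    rw [← hM.natDegree_eq_card_roots, Matrix.charpoly_natDegree_eq_dim]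
  have key : ∀ σ : K, (aeval M (X - C σ)).det = (M.charpoly.roots.map fun ρ => ρ - σ).prod := by
    intro σ
    have h1 : (aeval M (X - C σ) : Matrix ι ι K) = -(Matrix.scalar ι σ - M) := by
      simp [Matrix.algebraMap_eq_diagonal]
    rw [h1, Matrix.det_neg, ← Matrix.eval_charpoly, hM.eval_eq_prod_roots,
      (Matrix.charpoly_monic M).leadingCoeff, one_mul, ← hcard,
      ← Multiset.card_map (fun ρ => σ - ρ), ← Multiset.prod_map_neg, Multiset.map_map]
    simp
  let ψ : K[X] →* K := Matrix.detMonoidHom.comp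
    ((aeval M : K[X] →ₐ[K] Matrix ι ι K) : K[X] →* Matrix ι ι K)
  have hC : ψ (C g.leadingCoeff) = g.leadingCoeff ^ Fintype.card ι := by
    change (aeval M (C g.leadingCoeff)).det = _
    rw [aeval_C, Matrix.algebraMap_eq_diagonal, Matrix.det_diagonal]
    simp
  change ψ g = _
  conv_lhs => rw [hg.eq_prod_roots]
  rw [map_mul, map_multiset_prod, hC, Multiset.map_map]
  have h2 : (g.roots.map (ψ ∘ fun a => X - C a)) =
      g.roots.map fun σ => (M.charpoly.roots.map fun ρ => ρ - σ).prod :=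
    Multiset.map_congr rfl fun σ _ => key σ
  rw [h2, Multiset.prod_map_prod_map]
  have h3 : (M.charpoly.roots.map fun ρ => g.eval ρ) =
      M.charpoly.roots.map fun ρ => g.leadingCoeff * (g.roots.map fun σ => ρ - σ).prod :=
    Multiset.map_congr rfl fun ρ _ => hg.eval_eq_prod_roots ρ
  rw [h3, Multiset.prod_map_mul, Multiset.map_const', Multiset.prod_replicate, hcard]

variable {E : Type*} [Field E]

/-- The norm of the class of `g` in `E[X]/(f)`. -/
noncomputable def nm (f g : E[X]) : E := Algebra.norm E (Ideal.Quotient.mk (Ideal.span {f}) g)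

theorem nm_eq_prod {f : E[X]} (hf : f ≠ 0) (g : E[X]) :
    algebraMap E (AlgebraicClosure E) (nm f g) =
      ((f.map (algebraMap E (AlgebraicClosure E))).roots.map fun ρ => aeval ρ g).prod := by
  set φ := algebraMap E (AlgebraicClosure E) with hφ
  let pb := AdjoinRoot.powerBasis hf
  have h1 : nm f g = (aeval (Algebra.leftMulMatrix pb.basis pb.gen) g).det := by
    change Algebra.norm E (AdjoinRoot.mk f g) = _
    rw [Algebra.norm_eq_matrix_det pb.basis, ← AdjoinRoot.aeval_eq, AdjoinRoot.powerBasis_gen,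
      aeval_algHom_apply]
  have hc : (Algebra.leftMulMatrix pb.basis pb.gen).charpoly = f * C f.leadingCoeff⁻¹ := by
    rw [charpoly_leftMulMatrix, AdjoinRoot.powerBasis_gen, AdjoinRoot.minpoly_root hf]
  have h2 : φ.mapMatrix (aeval (Algebra.leftMulMatrix pb.basis pb.gen) g) =
      aeval (φ.mapMatrix (Algebra.leftMulMatrix pb.basis pb.gen)) (g.map φ) :=
    map_aeval_eq_aeval_map (by
      ext a i j
      simp only [RingHom.comp_apply, Matrix.algebraMap_matrix_apply, RingHom.mapMatrix_apply,
        Matrix.map_apply]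
      split_ifs <;> simp) g _
  rw [h1, RingHom.map_det, h2,
    det_aeval_eq_prod _ (IsAlgClosed.splits _) (IsAlgClosed.splits _)]
  rw [RingHom.mapMatrix_apply, Matrix.charpoly_map, hc, Polynomial.map_mul, map_C, mul_comm,
    roots_C_mul _ (by simpa using hf)]
  refine congrArg _ (Multiset.map_congr rfl fun ρ _ => ?_)
  rw [eval_map_algebraMap]

theorem nm_injective {a b : E} (h : algebraMap E (AlgebraicClosure E) a = algebraMap E (AlgebraicClosure E) b) :
    a = b := (algebraMap E (AlgebraicClosure E)).injective h

theorem nm_mul (f g h : E[X]) : nm f (g * h) = nm f g * nm f h := by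
  rw [nm, map_mul, map_mul]; rfl

theorem nm_pow (f g : E[X]) (n : ℕ) : nm f (g ^ n) = nm f g ^ n := by
  rw [nm, map_pow, map_pow]; rfl

theorem nm_congr {f g h : E[X]} (hd : f ∣ g - h) : nm f g = nm f h := by
  rw [nm, nm, Ideal.Quotient.mk_eq_mk_iff_sub_mem _ _ |>.mpr (Ideal.mem_span_singleton.mpr hd)]

theorem nm_mul_left {f₁ f₂ : E[X]} (h₁ : f₁ ≠ 0) (h₂ : f₂ ≠ 0) (g : E[X]) :
    nm (f₁ * f₂) g = nm f₁ g * nm f₂ g := by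
  apply nm_injective
  rw [map_mul, nm_eq_prod h₁, nm_eq_prod h₂, nm_eq_prod (mul_ne_zero h₁ h₂), Polynomial.map_mul,
    roots_mul (mul_ne_zero (by simpa using h₁) (by simpa using h₂)), Multiset.map_add, Multiset.prod_add]

theorem card_roots_map (f : E[X]) :
    (f.map (algebraMap E (AlgebraicClosure E))).roots.card = f.natDegree := by
  rw [← (IsAlgClosed.splits _).natDegree_eq_card_roots, natDegree_map]

theorem nm_C {f : E[X]} (hf : f ≠ 0) (c : E) : nm f (C c) = c ^ f.natDegree := by
  apply nm_injective
  rw [nm_eq_prod hf]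
  simp [card_roots_map]

theorem nm_one {f : E[X]} (hf : f ≠ 0) : nm f 1 = 1 := by
  have := nm_C hf (1 : E)
  simpa using this

theorem nm_C_left {c : E} (hc : c ≠ 0) (g : E[X]) : nm (C c) g = 1 := by
  apply nm_injective
  rw [nm_eq_prod (C_ne_zero.mpr hc)]
  simp

theorem nm_ne_zero {f g : E[X]} (hf : f ≠ 0) (h : IsCoprime f g) : nm f g ≠ 0 := by
  obtain ⟨a, b, hab⟩ := h
  have : nm f (b * g) = 1 := by
    rw [← nm_one hf]; exact nm_congr ⟨-a, by linear_combination hab⟩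
  rw [nm_mul] at this
  exact right_ne_zero_of_mul_eq_one this

/-- Reciprocity for norms. -/
theorem nm_reciprocity {f g : E[X]} (hf : f ≠ 0) (hg : g ≠ 0) :
    f.leadingCoeff ^ g.natDegree * nm f g =
      (-1) ^ (f.natDegree * g.natDegree) * g.leadingCoeff ^ f.natDegree * nm g f := by
  apply nm_injective
  have key : ∀ f g : E[X], ((f.map (algebraMap E (AlgebraicClosure E))).roots.map fun ρ => aeval ρ g).prod =
      algebraMap E (AlgebraicClosure E) g.leadingCoeff ^ f.natDegree *
        ((f.map (algebraMap E (AlgebraicClosure E))).roots.map fun ρ =>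
          ((g.map (algebraMap E (AlgebraicClosure E))).roots.map fun σ => ρ - σ).prod).prod := by
    intro f g
    have : ((f.map (algebraMap E (AlgebraicClosure E))).roots.map fun ρ => aeval ρ g) =
      (f.map (algebraMap E (AlgebraicClosure E))).roots.map fun ρ =>
        algebraMap E (AlgebraicClosure E) g.leadingCoeff *
          ((g.map (algebraMap E (AlgebraicClosure E))).roots.map fun σ => ρ - σ).prod :=
      Multiset.map_congr rfl fun ρ _ => by
        rw [← eval_map_algebraMap, (IsAlgClosed.splits _).eval_eq_prod_roots, leadingCoeff_map]
    rw [this, Multiset.prod_map_mul, Multiset.map_const', Multiset.prod_replicate, card_roots_map]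
  simp only [map_mul, map_pow, map_neg, map_one]
  rw [nm_eq_prod hf, nm_eq_prod hg, key, key, Multiset.prod_map_prod_map]
  have h2 : ((g.map (algebraMap E (AlgebraicClosure E))).roots.map fun σ =>
      ((f.map (algebraMap E (AlgebraicClosure E))).roots.map fun ρ => ρ - σ).prod) =
      (g.map (algebraMap E (AlgebraicClosure E))).roots.map fun σ => (-1) ^ f.natDegree *
      ((f.map (algebraMap E (AlgebraicClosure E))).roots.map fun ρ => σ - ρ).prod :=
    Multiset.map_congr rfl fun σ _ => by
      rw [← card_roots_map f, ← Multiset.card_map (fun ρ => σ - ρ), ← Multiset.prod_map_neg,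
        Multiset.map_map]
      simp
  rw [h2, Multiset.prod_map_mul, Multiset.map_const', Multiset.prod_replicate, card_roots_map]
  ring

end Norm

end SquareReflexive

namespace SquareReflexive

open WithZero

section Tame

variable {F : Type*} [Field F] {v : Valuation F ℤᵐ⁰}

open Classical in
/-- The tame symbol, up to local squares. -/
noncomputable def tame (v : Valuation F ℤᵐ⁰) (a b : F) : F :=
  if Ev v a then (if Ev v b then 1 else a) else (if Ev v b then b else -(a * b))

/-- Equality up to local squares. -/
def Eqv (v : Valuation F ℤᵐ⁰) (a b : F) : Prop := LocSq v (a * b)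

theorem Eqv.symm {a b : F} (h : Eqv v a b) : Eqv v b a := by rw [Eqv, mul_comm]; exact h

theorem Eqv.trans {a b c : F} (h : Eqv v a b) (h' : Eqv v b c) : Eqv v a c := by
  have := LocSq.mul h h'
  exact LocSq.of_mul_sq (s := b) (by convert this using 1; ring)

theorem Eqv.locSq {a b : F} (h : Eqv v a b) (hb : LocSq v b) : LocSq v a :=
  LocSq.of_mul hb (by rw [mul_comm]; exact h)

theorem tame_ne_zero {a b : F} (ha : a ≠ 0) (hb : b ≠ 0) : tame v a b ≠ 0 := by
  unfold tame; split_ifs <;> simp [ha, hb]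

theorem tame_comm (a b : F) : tame v a b = tame v b a := by
  unfold tame; split_ifs <;> ring

theorem tame_mul {a b c : F} (ha : a ≠ 0) (hb : b ≠ 0) (hc : c ≠ 0) :
    Eqv v (tame v (a * b) c) (tame v a c * tame v b c) := by
  have hab := ev_mul (v := v) ha hb
  rw [Eqv]
  by_cases h1 : Ev v a <;> by_cases h2 : Ev v b <;> by_cases h3 : Ev v c <;>
    simp only [h1, h2, iff_true, iff_false, not_true_eq_false, not_false_eq_true] at hab <;>
    simp only [tame, h1, h2, h3, hab, if_true, if_false]
  · simpa using locSq_sq (v := v) (one_ne_zero (α := F))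
  · convert locSq_sq (v := v) (mul_ne_zero ha hb) using 1; ring
  · convert locSq_sq (v := v) hc using 1; ring
  · convert locSq_sq (v := v) (mul_ne_zero (mul_ne_zero ha hb) hc) using 1; ring
  · convert locSq_sq (v := v) hc using 1; ring
  · convert locSq_sq (v := v) (mul_ne_zero (mul_ne_zero ha hb) hc) using 1; ring
  · convert locSq_sq (v := v) hc using 1; ring
  · convert locSq_sq (v := v) (mul_ne_zero (mul_ne_zero ha hb) hc) using 1; ring

theorem tame_norm {r s c : F} (hc : c ≠ 0) (ht : r ^ 2 - c * s ^ 2 ≠ 0) :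
    LocSq v (tame v (r ^ 2 - c * s ^ 2) c) := by
  unfold tame
  by_cases hev : Ev v c
  · simp only [hev, if_true]
    by_cases hsq : LocSq v c
    · split_ifs
      · simpa using locSq_sq (v := v) (one_ne_zero (α := F))
      · exact hsq
    · rw [if_pos (norm_ev hsq hc hev)]
      simpa using locSq_sq (v := v) (one_ne_zero (α := F))
  · simp only [hev, if_false]
    rcases norm_odd hc hev ht with h | h
    · rw [if_pos h.ev]; exact h
    · rw [if_neg]
      · convert h using 1; ring
      · intro h'
        exact hev ((ev_neg (v := v)).mp (((ev_mul (neg_ne_zero.mpr hc) ht).mp h.ev).mpr h'))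

theorem tame_sq {s c : F} (hs : s ≠ 0) : LocSq v (tame v (s ^ 2) c) := by
  unfold tame
  rw [if_pos (ev_sq s)]
  split_ifs
  · simpa using locSq_sq (v := v) (one_ne_zero (α := F))
  · exact locSq_sq hs

theorem tame_mul_of_locSq {a b c : F} (ha : a ≠ 0) (hb : b ≠ 0) (hc : c ≠ 0)
    (h : LocSq v (tame v b c)) : Eqv v (tame v (a * b) c) (tame v a c) := by
  refine (tame_mul ha hb hc).trans ?_
  rw [Eqv]
  convert h.mul_sq (tame_ne_zero (v := v) ha hc) using 1; ring

theorem Eqv.of_tame_mul_locSq {a b c : F} (ha : a ≠ 0) (hb : b ≠ 0) (hc : c ≠ 0)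
    (h : LocSq v (tame v (a * b) c)) : Eqv v (tame v a c) (tame v b c) :=
  (tame_mul ha hb hc).symm.locSq h

end Tame

section Slot

variable {E : Type*} [Field E]

local notation "κ" => algebraMap (Polynomial E) (RatFunc E)

/-- Extraction of a polynomial with prescribed tame symbols from a common value of two binary
forms. -/
theorem exists_slot {f A β : E[X]} (hf : Squarefree f) (hfd : 0 < f.natDegree) (hA : A ≠ 0)
    (hβ : β ≠ 0) {k : E} (hk : k ≠ 0) {t : E[X]} (ht : t ≠ 0) {y z r s : RatFunc E}
    (h₁ : κ t = κ β * (y ^ 2 - κ A * z ^ 2)) (h₂ : κ t = r ^ 2 - κ (C k * A * f) * s ^ 2) :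
    ∃ G : E[X], Squarefree G ∧ IsCoprime f G ∧ ∀ v : Valuation (RatFunc E) ℤᵐ⁰,
      Eqv v (tame v (κ G) (κ (C k * f))) (tame v (κ β) (κ A)) := by
  classical
  have hf0 := hf.ne_zero
  obtain ⟨t₁, w, ht₁, hw, e⟩ := exists_squarefree_mul_sq ht
  obtain ⟨f₂, hf₂⟩ := EuclideanDomain.gcd_dvd_left f t₁
  obtain ⟨t₂, ht₂⟩ := EuclideanDomain.gcd_dvd_right f t₁
  set f₁ := EuclideanDomain.gcd f t₁ with hf₁
  have hf₁0 : f₁ ≠ 0 := by rintro h; rw [h, zero_mul] at hf₂; exact hf0 hf₂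
  have ht₂0 : t₂ ≠ 0 := by rintro rfl; rw [mul_zero] at ht₂; exact ht₁.ne_zero ht₂
  have hcop : ∀ p, Prime p → p ∣ f → ¬ p ∣ t₂ * (f₁ - C k * f₂) := by
    intro p hp hpf hpG
    have h12 : ¬ (p ∣ f₁ ∧ p ∣ f₂) := fun h =>
      not_dvd_of_squarefree_mul hp (hf₂ ▸ hf) h.1 h.2
    have h13 : ¬ (p ∣ f₁ ∧ p ∣ t₂) := fun h =>
      not_dvd_of_squarefree_mul hp (ht₂ ▸ ht₁) h.1 h.2
    have h1 : p ∣ t₂ → p ∣ f₁ := fun h =>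
      EuclideanDomain.dvd_gcd hpf (ht₂ ▸ h.mul_left _)
    rcases hp.dvd_or_dvd hpG with h | h
    · exact h13 ⟨h1 h, h⟩
    · rw [hf₂] at hpf
      rcases hp.dvd_or_dvd hpf with h' | h'
      · have : p ∣ C k * f₂ := by simpa using dvd_sub h' h
        exact h12 ⟨h', (hp.dvd_or_dvd this).resolve_left (not_prime_dvd_C hk hp)⟩
      · have : p ∣ f₁ := by simpa using dvd_add h (h'.mul_left (C k))
        exact h12 ⟨this, h'⟩
  set G := t₂ * (f₁ - C k * f₂) with hG
  have hG0 : G ≠ 0 := by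
    intro h
    obtain ⟨p, hp, hpf⟩ := exists_prime_dvd hfd
    exact hcop p hp hpf (h ▸ dvd_zero p)
  obtain ⟨G', u, hG', hu, e'⟩ := exists_squarefree_mul_sq hG0
  refine ⟨G', hG', isCoprime_of_forall_prime hf0 fun p hp hpf hpG =>
    hcop p hp hpf (e' ▸ hpG.mul_right _), fun v => ?_⟩
  have hkf : C k * f ≠ 0 := mul_ne_zero (C_ne_zero.mpr hk) hf0
  have hKf := κ_ne_zero hkf
  have hKA := κ_ne_zero hA
  have hKG' := κ_ne_zero hG'.ne_zero
  have hKt := κ_ne_zero ht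
  have hKβ := κ_ne_zero hβ
  have hKu := κ_ne_zero hu
  -- `t G'` is a norm from the quadratic extension given by `k f`
  have s1 : Eqv v (tame v (κ G') (κ (C k * f))) (tame v (κ t) (κ (C k * f))) := by
    have e2 : t * G = (t₂ * w) ^ 2 * (f₁ ^ 2 - C k * f) := by
      rw [e, ht₂, hG, hf₂]; ring
    have hN : f₁ ^ 2 - C k * f ≠ 0 := by
      intro h; rw [h, mul_zero] at e2; exact mul_ne_zero ht hG0 e2
    have e3 : κ G' * κ t * (κ u) ^ 2 = (κ (f₁ ^ 2 - C k * f)) * (κ (t₂ * w)) ^ 2 := by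
      rw [← map_mul, ← map_pow, ← map_mul, ← map_pow, ← map_mul]; congr 1
      linear_combination e2 - t * e'
    refine Eqv.of_tame_mul_locSq hKG' hKt hKf ?_
    have h5 : Eqv v (tame v (κ G' * κ t) (κ (C k * f))) (tame v (κ G' * κ t * (κ u) ^ 2) (κ (C k * f))) :=
      (tame_mul_of_locSq (mul_ne_zero hKG' hKt) (pow_ne_zero 2 hKu) hKf (tame_sq hKu)).symm
    refine h5.locSq ?_
    rw [e3]
    refine (tame_mul_of_locSq (κ_ne_zero hN) (pow_ne_zero 2 (κ_ne_zero (mul_ne_zero ht₂0 hw))) hKf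
      (tame_sq (κ_ne_zero (mul_ne_zero ht₂0 hw)))).locSq ?_
    have h6 := κ_ne_zero hN
    have e6 : (κ (f₁ ^ 2 - C k * f) : RatFunc E) = (κ f₁) ^ 2 - κ (C k * f) * 1 ^ 2 := by
      rw [map_sub, map_pow]; ring
    rw [e6] at h6 ⊢
    exact tame_norm hKf h6
  have s2 : Eqv v (tame v (κ t) (κ (C k * f))) (tame v (κ t) (κ A)) := by
    rw [tame_comm (κ t), tame_comm (κ t)]
    refine Eqv.of_tame_mul_locSq hKf hKA hKt ?_
    rw [tame_comm]
    have e7 : (κ (C k * f) * κ A : RatFunc E) = κ (C k * A * f) := by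
      rw [← map_mul]; congr 1; ring
    rw [e7]
    have h8 := hKt
    rw [h₂] at h8 ⊢
    exact tame_norm (κ_ne_zero (mul_ne_zero (mul_ne_zero (C_ne_zero.mpr hk) hA) hf0)) h8
  have s3 : Eqv v (tame v (κ t) (κ A)) (tame v (κ β) (κ A)) := by
    have h9 : y ^ 2 - κ A * z ^ 2 ≠ 0 := by
      intro h; rw [h, mul_zero] at h₁; exact hKt h₁
    rw [h₁]
    exact tame_mul_of_locSq hKβ h9 hKA (tame_norm hKA h9)
  exact s1.trans (s2.trans s3)

end Slot

end SquareReflexive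

namespace SquareReflexive

open WithZero

section LocalGlobalToReflexive

variable {E : Type*} [Field E]

local notation "κ" => algebraMap (Polynomial E) (RatFunc E)

theorem PlaceAt.ev_C {v : Valuation (RatFunc E) ℤᵐ⁰} {p : E[X]} (h : PlaceAt v p) {c : E} (hc : c ≠ 0) :
    Ev v (κ (C c)) := h.ev_of_not_dvd (not_prime_dvd_C hc h.prime)

theorem InfPlace.ev_C {v : Valuation (RatFunc E) ℤᵐ⁰} (h : InfPlace v) {c : E} (hc : c ≠ 0) :
    Ev v (κ (C c)) := (h.ev_iff (C_ne_zero.mpr hc)).mpr (by simp)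

theorem isSquare_of_κ_C {c : E} (h : IsSquare (κ (C c) : RatFunc E)) : IsSquare c := by
  rcases eq_or_ne c 0 with rfl | hc
  · exact ⟨0, by simp⟩
  obtain ⟨v, -, hv⟩ := exists_infPlace (E := E)
  have : LocSq v (κ (C c)) := by
    obtain ⟨s, hs⟩ := h
    rw [hs, ← sq]
    refine locSq_sq ?_
    rintro rfl
    exact κ_ne_zero (C_ne_zero.mpr hc) (by rw [hs, zero_mul])
  simpa using (hv.of_locSq this).2

theorem not_isSquare_κ {f : E[X]} (hf : Squarefree f) (hd : 0 < f.natDegree) :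
    ¬ IsSquare (κ f : RatFunc E) := by
  intro h
  obtain ⟨p, hp, hpf⟩ := exists_prime_dvd hd
  obtain ⟨v, -, hv⟩ := exists_placeAt hp
  obtain ⟨s, hs⟩ := h
  have := ev_sq (v := v) s
  rw [sq, ← hs] at this
  exact (hv.ev_iff hf).mp this hpf

theorem exists_forall_infPlace_locIso {x y z w : E[X]} (hx : x ≠ 0) (hy : y ≠ 0) (hz : z ≠ 0) (hw : w ≠ 0) :
    ∃ k : E, k ≠ 0 ∧ ∀ v : Valuation (RatFunc E) ℤᵐ⁰, InfPlace v → TernaryLoc v →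
      LocIso v ![κ x, κ y, κ z, κ (C k * w)] := by
  have key : ∀ x : E[X], x ≠ 0 → (Even x.natDegree ↔ Even w.natDegree) → ∃ k : E, k ≠ 0 ∧
      ∀ v : Valuation (RatFunc E) ℤᵐ⁰, InfPlace v → LocSq v (-(κ x * κ (C k * w))) := by
    intro x hx h
    have hk : -(x.leadingCoeff * w.leadingCoeff) ≠ 0 :=
      neg_ne_zero.mpr (mul_ne_zero (leadingCoeff_ne_zero.mpr hx) (leadingCoeff_ne_zero.mpr hw))
    refine ⟨_, hk, fun v hv => ?_⟩
    have hCw : C (-(x.leadingCoeff * w.leadingCoeff)) * w ≠ 0 := mul_ne_zero (C_ne_zero.mpr hk) hw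
    rw [← map_mul, ← map_neg]
    refine hv.locSq (neg_ne_zero.mpr (mul_ne_zero hx hCw)) ?_ ?_
    · rw [natDegree_neg, natDegree_mul hx hCw, natDegree_C_mul hk, Nat.even_add]; exact h
    · refine ⟨x.leadingCoeff * w.leadingCoeff, ?_⟩
      rw [leadingCoeff_neg, leadingCoeff_mul, leadingCoeff_mul, leadingCoeff_C]; ring
  by_cases h0 : Even x.natDegree ↔ Even w.natDegree
  · obtain ⟨k, hk, h⟩ := key x hx h0
    exact ⟨k, hk, fun v hv _ => locIso_of_pair (i := 0) (j := 3) (by decide) (h v hv)⟩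
  by_cases h1 : Even y.natDegree ↔ Even w.natDegree
  · obtain ⟨k, hk, h⟩ := key y hy h1
    exact ⟨k, hk, fun v hv _ => locIso_of_pair (i := 1) (j := 3) (by decide) (h v hv)⟩
  by_cases h2 : Even z.natDegree ↔ Even w.natDegree
  · obtain ⟨k, hk, h⟩ := key z hz h2
    exact ⟨k, hk, fun v hv _ => locIso_of_pair (i := 2) (j := 3) (by decide) (h v hv)⟩
  refine ⟨1, one_ne_zero, fun v hv hT => ?_⟩
  refine locIso_of_three hT (i := 0) (j := 1) (k := 2) (by decide) (by decide) (by decide) ?_ ?_ ?_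
  · intro i
    fin_cases i <;> simp [hx, hy, hz, hw]
  · change Ev v (κ x) ↔ Ev v (κ y)
    rw [hv.ev_iff hx, hv.ev_iff hy]; tauto
  · change Ev v (κ x) ↔ Ev v (κ z)
    rw [hv.ev_iff hx, hv.ev_iff hz]; tauto

variable (E) in
/-- Local isotropy everywhere implies isotropy, and three-dimensional forms with entries of equal
parity are everywhere locally isotropic. -/
structure LocalGlobal : Prop where
  isotropic : ∀ (n : ℕ) (a : Fin n → RatFunc E), (∀ i, a i ≠ 0) →
    (∀ v : Valuation (RatFunc E) ℤᵐ⁰, (∃ p, PlaceAt v p) ∨ InfPlace v → LocIso v a) → IsotropicDiag a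
  place : ∀ (v : Valuation (RatFunc E) ℤᵐ⁰) p, PlaceAt v p → TernaryLoc v
  inf : ∀ (v : Valuation (RatFunc E) ℤᵐ⁰), InfPlace v → TernaryLoc v

theorem LocalGlobal.exists_common_value (H : LocalGlobal E) {β A D : E[X]} (hβ : β ≠ 0) (hA : A ≠ 0)
    (hD : D ≠ 0) (hA' : ¬ IsSquare (κ A : RatFunc E)) (hD' : ¬ IsSquare (κ D : RatFunc E))
    (hp : ∀ v p, PlaceAt v p → LocIso v ![κ β, κ (-(β * A)), κ (-1), κ D])
    (hi : ∀ v, InfPlace v → LocIso v ![κ β, κ (-(β * A)), κ (-1), κ D]) :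
    ∃ (t : E[X]) (y z r s : RatFunc E), t ≠ 0 ∧ κ t = κ β * (y ^ 2 - κ A * z ^ 2) ∧
      κ t = r ^ 2 - κ D * s ^ 2 := by
  obtain ⟨x, hx, h0⟩ := H.isotropic 4 ![κ β, κ (-(β * A)), κ (-1), κ D]
    (by intro i; fin_cases i <;> simp [hβ, hA, hD]) (by
      rintro v (⟨p, h⟩ | h)
      · exact hp v p h
      · exact hi v h)
  simp only [Fin.sum_univ_four, Matrix.cons_val_zero, Matrix.cons_val_one, Matrix.cons_val, map_neg,
    map_mul, map_one] at h0
  have hns : ∀ B : E[X], ¬ IsSquare (κ B : RatFunc E) → ∀ a b : RatFunc E, a ^ 2 - κ B * b ^ 2 = 0 →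
      a = 0 ∧ b = 0 := by
    intro B hB a b hab
    rcases eq_or_ne b 0 with rfl | hb
    · simpa using hab
    · refine absurd ⟨a / b, ?_⟩ hB
      field_simp
      linear_combination -hab
  have ht : κ β * (x 0 ^ 2 - κ A * x 1 ^ 2) ≠ 0 := by
    intro h
    have h1 := hns A hA' (x 0) (x 1) ((mul_eq_zero.mp h).resolve_left (κ_ne_zero hβ))
    have h2 := hns D hD' (x 2) (x 3) (by linear_combination h - h0)
    apply hx
    ext i
    fin_cases i
    exacts [h1.1, h1.2, h2.1, h2.2]
  obtain ⟨t, w, ht', hw, e⟩ := exists_squarefree_ratFunc ht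
  refine ⟨t, x 0 / w, x 1 / w, x 2 / w, x 3 / w, ht'.ne_zero, ?_, ?_⟩
  · field_simp
    linear_combination -e
  · field_simp
    linear_combination h0 - e

set_option linter.unusedSimpArgs false in
set_option maxHeartbeats 2000000 in
theorem LocalGlobal.exists_slot_step (H : LocalGlobal E) {f A b s h : E[X]} (hf : Squarefree f)
    (hA : Squarefree A) (hb : Squarefree b) (hfd : 0 < f.natDegree) (hAd : 0 < A.natDegree)
    (hfA : ∀ p, Prime p → p ∣ f → ¬ p ∣ A) (hab : IsCoprime A b) (hs : A ∣ f * b - s ^ 2)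
    (hh : b ∣ A - h ^ 2) : ∃ (k' : E) (G : E[X]), k' ≠ 0 ∧ Squarefree G ∧ IsCoprime f G ∧
      (∀ p, Prime p → p ∣ f → ∃ l, p ∣ A * G - l ^ 2) ∧
      (∀ p, Prime p → p ∣ G → ∃ l, p ∣ C k' * f - l ^ 2) := by
  have hf0 := hf.ne_zero
  have hb0 := hb.ne_zero
  have hAf : Squarefree (A * f) := squarefree_mul_of_isCoprime
    (isCoprime_of_forall_prime hA.ne_zero fun p hp hpA' hpf => hfA p hp hpf hpA') hA hf
  set β := f * b with hβdef
  have hβ : β ≠ 0 := mul_ne_zero hf0 hb0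
  have hβA : -(β * A) ≠ 0 := neg_ne_zero.mpr (mul_ne_zero hβ hA.ne_zero)
  obtain ⟨k', hk', hinf⟩ := exists_forall_infPlace_locIso hβ hβA (neg_ne_zero.mpr one_ne_zero : (-1 : E[X]) ≠ 0)
    hAf.ne_zero
  have hD : Squarefree (C k' * (A * f)) := squarefree_C_mul hk' hAf
  have hDd : 0 < (C k' * (A * f)).natDegree := by
    rw [natDegree_C_mul hk', natDegree_mul hA.ne_zero hf0]; omega
  have hKβ := κ_ne_zero hβ
  have hKA := κ_ne_zero hA.ne_zero
  have hKf := κ_ne_zero hf0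
  have hKb := κ_ne_zero hb0
  -- local data at a place
  have hloc : ∀ v p, PlaceAt v p →
      ((Ev v (κ β) ↔ (Ev v (κ f) ↔ Ev v (κ b)))) ∧ (Ev v (κ f) ↔ ¬ p ∣ f) ∧ (Ev v (κ b) ↔ ¬ p ∣ b) ∧
      (Ev v (κ A) ↔ ¬ p ∣ A) ∧ (p ∣ b → LocSq v (κ A)) ∧ (p ∣ A → ¬ p ∣ b → LocSq v (κ β)) ∧
      (p ∣ f → ¬ p ∣ A) ∧ (p ∣ b → ¬ p ∣ A) := by
    intro v p hv
    have c1 : p ∣ f → ¬ p ∣ A := fun h1 h2 => hfA p hv.prime h1 h2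
    have c2 : p ∣ b → ¬ p ∣ A := fun h1 h2 => not_dvd_of_isCoprime hv.prime hab h2 h1
    refine ⟨by rw [hβdef, map_mul, ev_mul hKf hKb], hv.ev_iff hf, hv.ev_iff hb, hv.ev_iff hA, ?_, ?_, c1, c2⟩
    · exact fun hpb => hv.locSq (c2 hpb) (hpb.trans hh)
    · intro h1 h2
      refine hv.locSq (fun h3 => ?_) (h1.trans hs)
      rcases hv.prime.dvd_or_dvd h3 with h3 | h3
      · exact c1 h3 h1
      · exact h2 h3
  obtain ⟨t, y, z, r, s', ht, e₁, e₂⟩ := H.exists_common_value hβ hA.ne_zero hD.ne_zero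
    (not_isSquare_κ hA hAd) (not_isSquare_κ hD hDd) (by
      intro v p hv
      obtain ⟨l0, l1, l2, l3, l4, l5, l6, l7⟩ := hloc v p hv
      have hne : ∀ i, (![κ β, κ (-(β * A)), κ (-1), κ (C k' * (A * f))] : Fin 4 → RatFunc E) i ≠ 0 := by
        intro i; fin_cases i
        exacts [hKβ, κ_ne_zero hβA, κ_ne_zero (neg_ne_zero.mpr one_ne_zero), κ_ne_zero hD.ne_zero]
      have x1 : Ev v (κ (-(β * A))) ↔ (Ev v (κ β) ↔ Ev v (κ A)) := by
        rw [map_neg, ev_neg, map_mul, ev_mul hKβ hKA]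
      have x2 : Ev v (κ (-1 : E[X])) := by rw [map_neg, ev_neg, map_one]; exact ev_one
      have x3 : Ev v (κ (C k' * (A * f))) ↔ (Ev v (κ A) ↔ Ev v (κ f)) := by
        rw [map_mul, ev_mul (κ_ne_zero (C_ne_zero.mpr hk')) (κ_ne_zero hAf.ne_zero), map_mul,
          ev_mul hKA hKf]
        simp only [hv.ev_C hk', true_iff]
      have hT := H.place v p hv
      have p012 : (Ev v (κ β) ↔ Ev v (κ (-(β * A)))) → (Ev v (κ β) ↔ Ev v (κ (-1 : E[X]))) →
          LocIso v ![κ β, κ (-(β * A)), κ (-1), κ (C k' * (A * f))] := fun q1 q2 =>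
        locIso_of_three hT (i := 0) (j := 1) (k := 2) (by decide) (by decide) (by decide) hne q1 q2
      have p013 : (Ev v (κ β) ↔ Ev v (κ (-(β * A)))) → (Ev v (κ β) ↔ Ev v (κ (C k' * (A * f)))) →
          LocIso v ![κ β, κ (-(β * A)), κ (-1), κ (C k' * (A * f))] := fun q1 q2 =>
        locIso_of_three hT (i := 0) (j := 1) (k := 3) (by decide) (by decide) (by decide) hne q1 q2
      by_cases c1 : p ∣ A
      · have : LocSq v (κ β) := l5 c1 (fun h => l7 h c1)
        refine locIso_of_pair (i := 0) (j := 2) (by decide) ?_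
        change LocSq v (-(κ β * κ (-1)))
        simpa using this
      · by_cases c2 : p ∣ f
        · by_cases c3 : p ∣ b
          · exact p012 (by rw [x1, l0, l1, l2, l3]; simp [c1, c2, c3]) (by rw [iff_true_right x2, l0, l1, l2]; simp [c2, c3])
          · exact p013 (by rw [x1, l0, l1, l2, l3]; simp [c1, c2, c3]) (by rw [x3, l0, l1, l2, l3]; simp [c1, c2, c3])
        · by_cases c3 : p ∣ b
          · refine locIso_of_pair (i := 0) (j := 1) (by decide) ?_
            change LocSq v (-(κ β * κ (-(β * A))))
            have e : -(κ β * κ (-(β * A))) = κ A * κ β ^ 2 := by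
              simp only [← map_mul, ← map_neg, ← map_pow]; congr 1; ring
            rw [e]; exact (l4 c3).mul_sq hKβ
          · exact p012 (by rw [x1, l0, l1, l2, l3]; simp [c1, c2, c3]) (by rw [iff_true_right x2, l0, l1, l2]; simp [c2, c3]))
    (fun v hv => hinf v hv (H.inf v hv))
  rw [← mul_assoc] at e₂
  obtain ⟨G, hG, hfG, htame⟩ := exists_slot hf hfd hA.ne_zero hβ hk' ht e₁ e₂
  have hKkf : ∀ v p, PlaceAt v p → (Ev v (κ (C k' * f)) ↔ Ev v (κ f)) := by
    intro v p hv
    rw [map_mul, ev_mul (κ_ne_zero (C_ne_zero.mpr hk')) hKf]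
    simp only [hv.ev_C hk', true_iff]
  refine ⟨k', G, hk', hG, hfG, fun p hp hpf => ?_, fun p hp hpg => ?_⟩
  · obtain ⟨v, -, hv⟩ := exists_placeAt hp
    obtain ⟨l0, l1, l2, l3, l4, l5, l6, l7⟩ := hloc v p hv
    have hpG' := not_dvd_of_isCoprime hp hfG hpf
    have hpaG : ¬ p ∣ A * G := fun h1 => by
      rcases hp.dvd_or_dvd h1 with h1 | h1
      · exact hfA p hp hpf h1
      · exact hpG' h1
    refine hv.exists_of_locSq hpaG ?_
    rw [map_mul]
    have htv := htame v
    have h1 : ¬ Ev v (κ f) := fun h => (l1.mp h) hpf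
    have h2 : Ev v (κ A) := l3.mpr (l6 hpf)
    have h3 : Ev v (κ G) := hv.ev_of_not_dvd hpG'
    have h4 : tame v (κ G) (κ (C k' * f)) = κ G := by
      rw [tame, if_pos h3, if_neg (by rwa [hKkf v p hv])]
    rw [h4] at htv
    by_cases hpb : p ∣ b
    · have h5 : tame v (κ β) (κ A) = 1 := by
        rw [tame, if_pos (by simp [l0, l1, l2, hpf, hpb]), if_pos h2]
      rw [h5] at htv
      have := htv.locSq (by simpa using locSq_sq (v := v) (one_ne_zero (α := RatFunc E)))
      exact (l4 hpb).mul this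
    · have h5 : tame v (κ β) (κ A) = κ A := by
        rw [tame, if_neg (by simp [l0, l1, l2, hpf, hpb]), if_pos h2]
      rw [h5] at htv
      exact htv.symm
  · obtain ⟨v, -, hv⟩ := exists_placeAt hp
    obtain ⟨l0, l1, l2, l3, l4, l5, l6, l7⟩ := hloc v p hv
    have hpf : ¬ p ∣ f := not_dvd_of_isCoprime hp hfG.symm hpg
    have hpkf : ¬ p ∣ C k' * f := fun h => hpf ((hp.dvd_or_dvd h).resolve_left (not_prime_dvd_C hk' hp))
    refine hv.exists_of_locSq hpkf ?_
    have h1 : Ev v (κ f) := l1.mpr hpf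
    have h3 : ¬ Ev v (κ G) := by rw [hv.ev_iff hG]; simpa using hpg
    have htv := htame v
    have h4 : tame v (κ G) (κ (C k' * f)) = κ (C k' * f) := by
      rw [tame, if_neg h3, if_pos (by rwa [hKkf v p hv])]
    rw [h4] at htv
    refine htv.locSq ?_
    by_cases c1 : p ∣ A
    · have : LocSq v (κ β) := l5 c1 (fun h => l7 h c1)
      rw [tame, if_pos this.ev, if_neg (fun h => l3.mp h c1)]
      exact this
    · by_cases c3 : p ∣ b
      · rw [tame, if_neg (by simp [l0, l1, l2, hpf, c3]), if_pos (l3.mpr c1)]; exact l4 c3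
      · rw [tame, if_pos (by simp [l0, l1, l2, hpf, c3]), if_pos (l3.mpr c1)]
        simpa using locSq_sq (v := v) (one_ne_zero (α := RatFunc E))

theorem LocalGlobal.exists_slot_mod (H : LocalGlobal E) (n : ℕ) : ∀ {f α : E[X]}, f.natDegree = n → Squarefree f →
    IsCoprime f α → ∃ (k : E) (g : E[X]), k ≠ 0 ∧ Squarefree g ∧ IsCoprime f g ∧
      (∃ s, f ∣ α * g - s ^ 2) ∧ ∃ h, g ∣ C k * f - h ^ 2 := by
  induction n using Nat.strong_induction_on with
  | _ n ih =>
  intro f α hn hf hα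
  have hf0 := hf.ne_zero
  rcases Nat.eq_zero_or_pos n with rfl | hpos
  · have hu : IsUnit f := by
      rw [eq_C_of_natDegree_eq_zero hn] at hf0 ⊢
      exact isUnit_C.mpr (isUnit_iff_ne_zero.mpr fun h => hf0 (by rw [h, C_0]))
    exact ⟨1, 1, one_ne_zero, squarefree_one, isCoprime_one_right, ⟨0, hu.dvd⟩, 0, one_dvd _⟩
  have hfd : 0 < f.natDegree := hn ▸ hpos
  have hmod := EuclideanDomain.div_add_mod α f
  have ha0 : α % f ≠ 0 := by
    intro h
    obtain ⟨p, hp, hpf⟩ := exists_prime_dvd hfd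
    exact not_dvd_of_isCoprime hp hα hpf (hpf.trans ((EuclideanDomain.mod_eq_zero.mp h)))
  obtain ⟨a, s₀, ha, hs₀, e⟩ := exists_squarefree_mul_sq ha0
  have hdeg : a.natDegree < n := by
    refine (natDegree_le_of_eq_mul_sq ha0 e).trans_lt ?_
    rw [← hn]
    exact natDegree_mod_lt α hfd.ne'
  have hαa : f ∣ α - a * s₀ ^ 2 := ⟨α / f, by rw [← e]; linear_combination -hmod⟩
  rcases Nat.eq_zero_or_pos a.natDegree with had | had
  · obtain ⟨c, rfl⟩ := natDegree_eq_zero.mp had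
    have hc : c ≠ 0 := by rintro rfl; exact ha.ne_zero C_0
    refine ⟨1, C c, one_ne_zero, ha, (isCoprime_of_forall_prime hf0 fun p hp _ => not_prime_dvd_C hc hp),
      ⟨C c * s₀, ?_⟩, 0, (isUnit_C.mpr hc.isUnit).dvd⟩
    have : α * C c - (C c * s₀) ^ 2 = (α - C c * s₀ ^ 2) * C c := by ring
    rw [this]; exact hαa.mul_right _
  have hfa : ∀ p, Prime p → p ∣ f → ¬ p ∣ a := by
    intro p hp hpf hpa
    refine not_dvd_of_isCoprime hp hα hpf ?_
    have := dvd_add (hpf.trans hαa) (hpa.mul_right (s₀ ^ 2))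
    simpa using this
  obtain ⟨k, b, hk, hb, hab, ⟨s, hs⟩, h, hh⟩ := ih _ hdeg (α := f) rfl ha
    (isCoprime_of_forall_prime ha.ne_zero fun p hp hpa hpf => hfa p hp hpf hpa)
  have hpA : ∀ p, Prime p → (p ∣ C k * a ↔ p ∣ a) := fun p hp =>
    ⟨fun h => (hp.dvd_or_dvd h).resolve_left (not_prime_dvd_C hk hp), fun h => h.mul_left _⟩
  obtain ⟨k', G, hk', hG, hfG, h₁, h₂⟩ := H.exists_slot_step (A := C k * a) hf (squarefree_C_mul hk ha) hb
    hfd (by rw [natDegree_C_mul hk]; exact had) (fun p hp hpf hpA' => hfa p hp hpf ((hpA p hp).mp hpA'))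
    (isCoprime_of_forall_prime (squarefree_C_mul hk ha).ne_zero fun p hp hp' hpb =>
      not_dvd_of_isCoprime hp hab ((hpA p hp).mp hp') hpb)
    (((associated_unit_mul_left a (C k) (isUnit_C.mpr hk.isUnit)).dvd_iff_dvd_left).mpr hs) hh
  have hpG : ∀ p, Prime p → (p ∣ C k * G ↔ p ∣ G) := fun p hp =>
    ⟨fun h => (hp.dvd_or_dvd h).resolve_left (not_prime_dvd_C hk hp), fun h => h.mul_left _⟩
  have hkG : Squarefree (C k * G) := squarefree_C_mul hk hG
  refine ⟨k', C k * G, hk', hkG, isCoprime_of_forall_prime hf0 fun p hp hpf hpg =>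
    not_dvd_of_isCoprime hp hfG hpf ((hpG p hp).mp hpg), ?_,
    exists_dvd_sub_sq hkG fun p hp hpg => h₂ p hp ((hpG p hp).mp hpg)⟩
  obtain ⟨s, hs⟩ := exists_dvd_sub_sq hf h₁
  refine ⟨s * s₀, ?_⟩
  have : α * (C k * G) - (s * s₀) ^ 2 = (α - a * s₀ ^ 2) * (C k * G) +
    (C k * a * G - s ^ 2) * s₀ ^ 2 := by ring
  rw [this]
  exact dvd_add (hαa.mul_right _) (hs.mul_right _)

end LocalGlobalToReflexive

end SquareReflexive

namespace SquareReflexive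

open WithZero

section LocalGlobalToReflexive

variable {E : Type*} [Field E]

local notation "κ" => algebraMap (Polynomial E) (RatFunc E)

theorem isSquare_of_mul_left {F : Type*} [Field F] {a b : F} (ha : IsSquare a) (ha0 : a ≠ 0)
    (hab : IsSquare (a * b)) : IsSquare b := by
  have := hab.mul (IsSquare.inv ha)
  rwa [mul_comm a b, mul_assoc, mul_inv_cancel₀ ha0, mul_one] at this

theorem isSquare_mul_of_norm {f α g s h : E[X]} {k : E} (hf : f ≠ 0) (hg : g ≠ 0) (hk : k ≠ 0)
    (hfα : IsCoprime f α) (hfg : IsCoprime f g) (hs : f ∣ α * g - s ^ 2) (hh : g ∣ C k * f - h ^ 2)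
    (hd : Even f.natDegree) (hm : Odd g.natDegree) (hns : ¬ IsSquare k)
    (hu : ∃ u : E, u ≠ 0 ∧ (nm f α = u ^ 2 ∨ nm f α = f.leadingCoeff * u ^ 2)) :
    IsSquare (k * f.leadingCoeff) := by
  have hc : f.leadingCoeff ≠ 0 := leadingCoeff_ne_zero.mpr hf
  have e1 : nm f α * nm f g = nm f s ^ 2 := by rw [← nm_mul, nm_congr hs, nm_pow]
  have e2 : k ^ g.natDegree * nm g f = nm g h ^ 2 := by
    rw [← nm_C hg, ← nm_mul, nm_congr hh, nm_pow]
  have e3 := nm_reciprocity hf hg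
  obtain ⟨m, hm⟩ := hm
  obtain ⟨d, hd⟩ := hd
  have hodd : (-1 : E) ^ (f.natDegree * g.natDegree) = 1 := Even.neg_one_pow (Even.mul_right ⟨d, hd⟩ _)
  rw [hodd, hm, hd] at e3
  rw [hm] at e2
  have hn1 : nm f α ≠ 0 := nm_ne_zero hf hfα
  have hn2 : nm f g ≠ 0 := nm_ne_zero hf hfg
  have hl : g.leadingCoeff ≠ 0 := leadingCoeff_ne_zero.mpr hg
  have hkc : IsSquare (k * (f.leadingCoeff * nm f g)) := by
    refine ⟨g.leadingCoeff ^ d * nm g h / (k ^ m * f.leadingCoeff ^ m), ?_⟩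
    field_simp
    linear_combination (k ^ (2 * m + 1)) * e3 + g.leadingCoeff ^ (2 * d) * e2
  obtain ⟨u, hu, h | h⟩ := hu
  · refine isSquare_of_mul_left (a := nm f g) ?_ hn2 (by convert hkc using 1; ring)
    refine ⟨nm f s / u, ?_⟩
    rw [h] at e1
    field_simp
    linear_combination e1
  · refine absurd (isSquare_of_mul_left (a := f.leadingCoeff * nm f g) ?_ (mul_ne_zero hc hn2)
      (by convert hkc using 1; ring)) hns
    refine ⟨nm f s / u, ?_⟩
    rw [h] at e1
    field_simp
    linear_combination e1

theorem isUnit_of_natDegree_eq_zero {f : E[X]} (hf : f ≠ 0) (h : f.natDegree = 0) : IsUnit f := by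
  rw [eq_C_of_natDegree_eq_zero h] at hf ⊢
  exact isUnit_C.mpr (isUnit_iff_ne_zero.mpr fun h => hf (by rw [h, C_0]))

theorem LocalGlobal.exists_slot_final (H : LocalGlobal E) {f α : E[X]} (hf : Squarefree f)
    (hfα : IsCoprime f α)
    (hu : ∃ u : E, u ≠ 0 ∧ (nm f α = u ^ 2 ∨ nm f α = f.leadingCoeff * u ^ 2)) :
    ∃ g, IsCoprime f g ∧ (∃ s, f ∣ α * g - s ^ 2) ∧ ∃ h, g ∣ f - h ^ 2 := by
  have hf0 := hf.ne_zero
  rcases Nat.eq_zero_or_pos f.natDegree with hfd | hfd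
  · exact ⟨1, isCoprime_one_right, ⟨0, (isUnit_of_natDegree_eq_zero hf0 hfd).dvd⟩, 0, one_dvd _⟩
  obtain ⟨k, g, hk, hg, hfg, ⟨s, hs⟩, h, hh⟩ := H.exists_slot_mod _ rfl hf hfα
  by_cases hks : IsSquare k
  · obtain ⟨r, rfl⟩ := hks
    have hr : r ≠ 0 := left_ne_zero_of_mul hk
    refine ⟨g, hfg, ⟨s, hs⟩, C r⁻¹ * h, ?_⟩
    have e : f - (C r⁻¹ * h) ^ 2 = C (r⁻¹ ^ 2) * (C (r * r) * f - h ^ 2) := by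
      have : C r⁻¹ * C r = (1 : E[X]) := by rw [← C_mul, inv_mul_cancel₀ hr, C_1]
      rw [C_pow, C_mul]
      linear_combination (-f * C r⁻¹ * C r - f) * this
    rw [e]; exact hh.mul_left _
  have hg0 := hg.ne_zero
  have hA := squarefree_C_mul hk hf
  have hA0 := hA.ne_zero
  have hgA : -(g * (C k * f)) ≠ 0 := neg_ne_zero.mpr (mul_ne_zero hg0 hA0)
  have hKg := κ_ne_zero hg0
  have hKf := κ_ne_zero hf0
  have hpA : ∀ p, Prime p → (p ∣ C k * f ↔ p ∣ f) := fun p hp =>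
    ⟨fun h => (hp.dvd_or_dvd h).resolve_left (not_prime_dvd_C hk hp), fun h => h.mul_left _⟩
  have hne : ∀ i, (![κ g, κ (-(g * (C k * f))), κ (-1), κ (C k)] : Fin 4 → RatFunc E) i ≠ 0 := by
    intro i; fin_cases i
    exacts [hKg, κ_ne_zero hgA, κ_ne_zero (neg_ne_zero.mpr one_ne_zero), κ_ne_zero (C_ne_zero.mpr hk)]
  have hpair : ∀ v : Valuation (RatFunc E) ℤᵐ⁰, LocSq v (κ (C k * f)) →
      LocIso v ![κ g, κ (-(g * (C k * f))), κ (-1), κ (C k)] := by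
    intro v hv
    refine locIso_of_pair (i := 0) (j := 1) (by decide) ?_
    change LocSq v (-(κ g * κ (-(g * (C k * f)))))
    have e : -(κ g * κ (-(g * (C k * f)))) = κ (C k * f) * κ g ^ 2 := by
      simp only [← map_mul, ← map_neg, ← map_pow]; congr 1; ring
    rw [e]; exact hv.mul_sq hKg
  have x1 : ∀ v : Valuation (RatFunc E) ℤᵐ⁰, Ev v (κ (-1 : E[X])) := fun v => by
    rw [map_neg, ev_neg, map_one]; exact ev_one
  have p023 : ∀ v : Valuation (RatFunc E) ℤᵐ⁰, TernaryLoc v → Ev v (κ g) → Ev v (κ (C k)) →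
      LocIso v ![κ g, κ (-(g * (C k * f))), κ (-1), κ (C k)] := fun v hT h1 h2 =>
    locIso_of_three hT (i := 0) (j := 2) (k := 3) (by decide) (by decide) (by decide) hne
      (iff_of_true h1 (x1 v)) (iff_of_true h1 h2)
  obtain ⟨t, y, z, r, s', ht, e₁, e₂⟩ := H.exists_common_value hg0 hA0 (C_ne_zero.mpr hk)
    (not_isSquare_κ hA (by rwa [natDegree_C_mul hk])) (fun h => hks (isSquare_of_κ_C h)) (by
      intro v p hv
      by_cases hpg : p ∣ g
      · have hpf : ¬ p ∣ f := not_dvd_of_isCoprime hv.prime hfg.symm hpg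
        exact hpair v (hv.locSq (fun h => hpf ((hpA p hv.prime).mp h)) (hpg.trans hh))
      · exact p023 v (H.place v p hv) (hv.ev_of_not_dvd hpg) (hv.ev_C hk)) (by
      intro v hv
      by_cases hm : Even g.natDegree
      · exact p023 v (H.inf v hv) ((hv.ev_iff hg0).mpr hm) (hv.ev_C hk)
      by_cases hd : Even f.natDegree
      · refine hpair v (hv.locSq hA0 (by rwa [natDegree_C_mul hk]) ?_)
        rw [leadingCoeff_mul, leadingCoeff_C]
        exact isSquare_mul_of_norm hf0 hg0 hk hfα hfg ⟨_, hs.choose_spec⟩ hh hd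
          (Nat.not_even_iff_odd.mp hm) hks hu
      · have : Ev v (κ (-(g * (C k * f)))) := by
          rw [hv.ev_iff hgA, natDegree_neg, natDegree_mul hg0 hA0, natDegree_C_mul hk, Nat.even_add]
          exact iff_of_false hm hd
        exact locIso_of_three (H.inf v hv) (i := 1) (j := 2) (k := 3) (by decide) (by decide)
          (by decide) hne (iff_of_true this (x1 v)) (iff_of_true this (hv.ev_C hk)))
  obtain ⟨G, hG, hfG, htame⟩ := exists_slot (k := 1) (s := s' / κ f) hf hfd hA0 hg0 one_ne_zero ht e₁ (by
    rw [e₂, C_1, one_mul, map_mul κ (C k * f) f, map_mul κ (C k) f]; field_simp)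
  simp only [C_1, one_mul] at htame
  refine ⟨G, hfG, exists_dvd_sub_sq hf fun p hp hpf => ?_, exists_dvd_sub_sq hG fun p hp hpG => ?_⟩
  · obtain ⟨v, -, hv⟩ := exists_placeAt hp
    have hpα := not_dvd_of_isCoprime hp hfα hpf
    have hpG := not_dvd_of_isCoprime hp hfG hpf
    have hpg := not_dvd_of_isCoprime hp hfg hpf
    have htv := htame v
    have h1 : ¬ Ev v (κ f) := fun h => (hv.ev_iff hf).mp h hpf
    have h2 : ¬ Ev v (κ (C k * f)) := fun h => (hv.ev_iff hA).mp h (hpf.mul_left _)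
    rw [tame, tame, if_pos (hv.ev_of_not_dvd hpG), if_neg h1, if_pos (hv.ev_of_not_dvd hpg),
      if_neg h2] at htv
    refine hv.exists_of_locSq (fun h => (hp.dvd_or_dvd h).elim hpα hpG) ?_
    have h3 : LocSq v (κ (α * g)) := hv.locSq (fun h => (hp.dvd_or_dvd h).elim hpα hpg) (hpf.trans hs)
    rw [map_mul] at h3 ⊢
    refine LocSq.of_mul_sq (s := κ g) ?_
    convert h3.mul htv using 1
    ring
  · obtain ⟨v, -, hv⟩ := exists_placeAt hp
    have hpf : ¬ p ∣ f := not_dvd_of_isCoprime hp hfG.symm hpG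
    refine hv.exists_of_locSq hpf ?_
    have htv := htame v
    have h1 : ¬ Ev v (κ G) := fun h => (hv.ev_iff hG).mp h hpG
    rw [tame, if_neg h1, if_pos (hv.ev_of_not_dvd hpf)] at htv
    refine htv.locSq ?_
    have h2 : ¬ p ∣ C k * f := fun h => hpf ((hpA p hp).mp h)
    by_cases h3 : Ev v (κ g)
    · rw [tame, if_pos h3, if_pos (hv.ev_of_not_dvd h2)]
      simpa using locSq_sq (v := v) (one_ne_zero (α := RatFunc E))
    · rw [tame, if_neg h3, if_pos (hv.ev_of_not_dvd h2)]
      exact hv.locSq h2 ((not_not.mp fun h => h3 (hv.ev_of_not_dvd h)).trans hh)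

theorem isCoprime_of_isUnit_mk {f a : E[X]} (h : IsUnit (Ideal.Quotient.mk (Ideal.span {f}) a)) :
    IsCoprime f a := by
  obtain ⟨b, hb⟩ := h.exists_right_inv
  obtain ⟨b, rfl⟩ := Ideal.Quotient.mk_surjective b
  rw [← map_mul, ← map_one (Ideal.Quotient.mk _), Ideal.Quotient.eq, Ideal.mem_span_singleton] at hb
  obtain ⟨c, hc⟩ := hb
  exact ⟨-c, b, by linear_combination hc⟩

theorem isUnit_mk_of_isCoprime {f a : E[X]} (h : IsCoprime f a) :
    IsUnit (Ideal.Quotient.mk (Ideal.span {f}) a) := by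
  obtain ⟨b, c, hc⟩ := h
  refine IsUnit.of_mul_eq_one (Ideal.Quotient.mk _ c) ?_
  rw [← map_mul, ← map_one (Ideal.Quotient.mk _), Ideal.Quotient.eq, Ideal.mem_span_singleton]
  exact ⟨-b, by linear_combination hc⟩

theorem LocalGlobal.isSquareReflexive (H : LocalGlobal E) {f : E[X]} (hf : Squarefree f) :
    IsSquareReflexive f := by
  refine ⟨hf, fun α hu => ?_⟩
  obtain ⟨a, ha⟩ := Ideal.Quotient.mk_surjective (α : E[X] ⧸ Ideal.span {f})
  have hfa : IsCoprime f a := isCoprime_of_isUnit_mk (ha ▸ α.isUnit)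
  obtain ⟨g, hfg, ⟨s, hs⟩, h, hh⟩ := H.exists_slot_final hf hfa (by
    obtain ⟨u, hu⟩ := hu
    exact ⟨u, u.ne_zero, by rwa [← ha] at hu⟩)
  refine ⟨g, hfg, ?_, ⟨Ideal.Quotient.mk _ h, ?_⟩⟩
  · have hfs : IsCoprime f s := by
      obtain ⟨w, hw⟩ := hs
      have h1 : IsCoprime f (s ^ 2) := by
        have e : s ^ 2 = a * g + f * (-w) := by linear_combination -hw
        rw [e]; exact (hfa.mul_right hfg).add_mul_left_right (-w)
      exact h1.of_isCoprime_of_dvd_right (dvd_pow_self s two_ne_zero)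
    refine ⟨(isUnit_mk_of_isCoprime hfs).unit * α⁻¹, ?_⟩
    have hs' : Ideal.Quotient.mk (Ideal.span {f}) a * Ideal.Quotient.mk (Ideal.span {f}) g =
        Ideal.Quotient.mk (Ideal.span {f}) s ^ 2 := by
      rw [← map_mul, ← map_pow, Ideal.Quotient.eq, Ideal.mem_span_singleton]; exact hs
    rw [ha] at hs'
    rw [Units.val_mul, IsUnit.unit_spec, mul_pow, ← hs']
    have : (α : E[X] ⧸ Ideal.span {f}) * ((α⁻¹ : (E[X] ⧸ Ideal.span {f})ˣ) : E[X] ⧸ Ideal.span {f}) = 1 :=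
      α.mul_inv
    linear_combination (-(Ideal.Quotient.mk (Ideal.span {f}) g) *
      ((α : E[X] ⧸ Ideal.span {f}) * ((α⁻¹ : (E[X] ⧸ Ideal.span {f})ˣ) : E[X] ⧸ Ideal.span {f}) + 1)) * this
  · rw [← map_mul, Ideal.Quotient.eq, Ideal.mem_span_singleton, ← sq]; exact hh

theorem localGlobal_of_isotropic (hE : (2 : E) ≠ 0)
    (h5 : ∀ a : Fin 5 → RatFunc E, (∀ i, a i ≠ 0) → IsotropicDiag a)
    (hlg : ∀ (n : ℕ) (a : Fin n → RatFunc E), (∀ i, a i ≠ 0) → ¬ IsotropicDiag a →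
        ∃ v : Valuation (RatFunc E) ℤᵐ⁰, IsZValuationTrivialOnBase E v ∧ ¬ IsotropicCompletion v a) :
    LocalGlobal E where
  isotropic n a ha hloc := by
    by_contra hcon
    obtain ⟨v, hv, hva⟩ := hlg n a ha hcon
    exact hva (isotropicCompletion_of_locIso v (valuation_two hE hv) (hloc v (place_cases hv)))
  place v p hv := ternaryLoc_of_isotropic hv.surj h5
  inf v hv := ternaryLoc_of_isotropic hv.surj h5

end LocalGlobalToReflexive

end SquareReflexive

namespace SquareReflexive

open WithZero Matrix

section UnimodularValue

theorem exists_triangular_diag {F : Type*} [Field F] : ∀ (n : ℕ) (S : Matrix (Fin n) (Fin n) F), S.IsSymm →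
    (∀ x : Fin n → F, x ≠ 0 → x ⬝ᵥ S *ᵥ x ≠ 0) → ∃ (a : Fin n → F) (P : Matrix (Fin n) (Fin n) F),
      (∀ i, P i i = 1) ∧ (∀ i j, j < i → P i j = 0) ∧ S = Pᵀ * diagonal a * P := by
  intro n
  induction n with
  | zero => exact fun S _ _ => ⟨0, 0, fun i => i.elim0, fun i => i.elim0, by ext i; exact i.elim0⟩
  | succ n ih =>
    intro S hS han
    have hsymm : ∀ i j, S j i = S i j := fun i j => hS.apply i j
    have ha : S 0 0 ≠ 0 := by
      have := han (Pi.single 0 1) (by simp)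
      simpa using this
    obtain ⟨T, hT⟩ : ∃ T : Matrix (Fin n) (Fin n) F,
        ∀ i j, T i j = S i.succ j.succ - S 0 i.succ * S 0 j.succ / S 0 0 :=
      ⟨Matrix.of fun i j => S i.succ j.succ - S 0 i.succ * S 0 j.succ / S 0 0, fun i j => rfl⟩
    obtain ⟨a, P, h1, h2, h3⟩ := ih T (by
      ext i j; rw [transpose_apply, hT, hT, hsymm i.succ j.succ]; ring) (by
      intro y hy h0
      refine han (Fin.cons (-(∑ j, S 0 j.succ * y j) / S 0 0) y)
        (fun h => hy (by ext i; simpa using congrFun h i.succ)) ?_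
      have e1 : ∑ i, y i * ∑ j, S i.succ j.succ * y j = (∑ j, S 0 j.succ * y j) ^ 2 / S 0 0 := by
        have e2 : y ⬝ᵥ T *ᵥ y = ∑ i, y i * ∑ j, S i.succ j.succ * y j -
            (∑ j, S 0 j.succ * y j) ^ 2 / S 0 0 := by
          simp only [dotProduct, mulVec, hT, sub_mul, Finset.sum_sub_distrib, mul_sub]
          congr 1
          rw [sq, Finset.sum_mul, Finset.sum_div]
          refine Finset.sum_congr rfl fun i _ => ?_
          rw [Finset.mul_sum, Finset.mul_sum, Finset.sum_div]
          exact Finset.sum_congr rfl fun j _ => by ring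
        rw [h0] at e2
        linear_combination -e2
      simp only [dotProduct, mulVec, Fin.sum_univ_succ, Fin.cons_zero, Fin.cons_succ, mul_add,
        Finset.sum_add_distrib, e1]
      have e3 : ∀ w, ∑ i, y i * (S i.succ 0 * w) = (∑ j, S 0 j.succ * y j) * w := by
        intro w
        rw [Finset.sum_mul]
        exact Finset.sum_congr rfl fun i _ => by rw [hsymm 0 i.succ]; ring
      rw [e3]
      field_simp
      ring)
    refine ⟨Fin.cons (S 0 0) a, Matrix.of (Fin.cons (Fin.cons 1 fun j => S 0 j.succ / S 0 0)
      (fun i => Fin.cons 0 (P i))), ?_, ?_, ?_⟩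
    · intro i; refine Fin.cases ?_ (fun i => ?_) i <;> simp [h1]
    · intro i j
      refine Fin.cases ?_ (fun i => ?_) i
      · intro h; exact absurd h (Fin.not_lt_zero j)
      · refine Fin.cases ?_ (fun j => ?_) j
        · intro _; simp
        · intro h; simpa using h2 i j (Fin.succ_lt_succ_iff.mp h)
    · have h3' : ∀ i j, T i j = ∑ k, P k i * a k * P k j := by
        intro i j
        rw [h3, mul_apply]
        exact Finset.sum_congr rfl fun k _ => by rw [mul_diagonal, transpose_apply]
      have key : ∀ (b : Fin (n + 1) → F) (Q : Matrix (Fin (n + 1)) (Fin (n + 1)) F) i j,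
          (Qᵀ * diagonal b * Q) i j = ∑ k, Q k i * b k * Q k j := by
        intro b Q i j
        rw [mul_apply]
        exact Finset.sum_congr rfl fun k _ => by rw [mul_diagonal, transpose_apply]
      ext i j
      rw [key, Fin.sum_univ_succ]
      refine Fin.cases ?_ (fun i => ?_) i <;> refine Fin.cases ?_ (fun j => ?_) j
      · simp
      · simp; field_simp
      · simp; rw [hsymm 0 i.succ]; field_simp
      · simp only [Matrix.of_apply, Fin.cons_zero, Fin.cons_succ]
        rw [← h3', hT]
        field_simp
        ring

variable {E : Type*} [Field E]

theorem exists_triangular_small {n : ℕ} (P : Matrix (Fin n) (Fin n) E[X]) (hP : ∀ i j, j < i → P i j = 0)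
    (A : Fin n → ℤ) (hA : 0 < ∑ i, (A i + 1 - (P i i).natDegree)) :
    ∃ x : Fin n → E[X], x ≠ 0 ∧ ∀ i (k : ℕ), A i < k → ((P *ᵥ x) i).coeff k = 0 := by
  classical
  set K : ℕ := ∑ i, ∑ j, (P i j).natDegree + ∑ i, (A i).natAbs with hK
  have hK1 : ∀ i j, (P i j).natDegree ≤ K := fun i j =>
    ((Finset.single_le_sum (f := fun j => (P i j).natDegree) (fun _ _ => Nat.zero_le _)
      (Finset.mem_univ j)).trans (Finset.single_le_sum (f := fun i => ∑ j, (P i j).natDegree)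
      (fun _ _ => Nat.zero_le _) (Finset.mem_univ i))).trans (Nat.le_add_right _ _)
  have hK2 : ∀ i, A i ≤ K := fun i => by
    have : (A i).natAbs ≤ K := (Finset.single_le_sum (f := fun i => (A i).natAbs)
      (fun _ _ => Nat.zero_le _) (Finset.mem_univ i)).trans (Nat.le_add_left _ _)
    omega
  let N : Fin n → ℕ := fun i => (n - i) * K
  have hN1 : ∀ i, A i ≤ N i := fun i => by
    have h1 : 1 ≤ n - (i : ℕ) := by omega
    have h2 : K ≤ N i := Nat.le_mul_of_pos_left K h1
    exact (hK2 i).trans (by exact_mod_cast h2)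
  have hN2 : ∀ i j, i < j → (P i j).natDegree + N j ≤ N i := fun i j hij => by
    have h1 : n - (i : ℕ) = (n - j) + (j - i) := by omega
    have h2 : 1 ≤ (j : ℕ) - i := by omega
    have h3 : K ≤ (j - i : ℕ) * K := Nat.le_mul_of_pos_left K h2
    have := hK1 i j
    simp only [N]
    rw [h1, add_mul]
    omega
  let e : Fin n → ℕ := fun i => (P i i).natDegree
  let c : Fin n → ℕ := fun i => (N i + e i - A i).toNat
  let L : ((Σ i : Fin n, Fin (N i + 1)) → E) →ₗ[E] (Fin n → E[X]) :=
    LinearMap.pi fun i => ∑ t : Fin (N i + 1), (monomial (t : ℕ)) ∘ₗ (LinearMap.proj ⟨i, t⟩)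
  have hL : ∀ u i, L u i = ∑ t : Fin (N i + 1), monomial (t : ℕ) (u ⟨i, t⟩) := by
    intro u i; simp [L]
  have hLdeg : ∀ u i, (L u i).natDegree ≤ N i := by
    intro u i
    rw [hL]
    refine natDegree_sum_le_of_forall_le _ _ fun t _ => (natDegree_monomial_le _).trans ?_
    omega
  have hLinj : ∀ u, L u = 0 → u = 0 := by
    intro u hu
    ext ⟨i, t⟩
    have h1 : (L u i).coeff t = 0 := by rw [hu]; simp
    rw [hL, finsetSum_coeff, Finset.sum_eq_single t] at h1
    · simpa using h1
    · intro s _ hst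
      rw [coeff_monomial, if_neg]
      exact fun h => hst (Fin.ext h)
    · simp
  let Φ : ((Σ i : Fin n, Fin (N i + 1)) → E) →ₗ[E] ((Σ i : Fin n, Fin (c i)) → E) :=
    LinearMap.pi fun s => (lcoeff E (N s.1 + e s.1 - s.2)) ∘ₗ
      (LinearMap.proj s.1) ∘ₗ ((Matrix.mulVecLin P).restrictScalars E) ∘ₗ L
  have hker : LinearMap.ker Φ ≠ ⊥ := by
    apply LinearMap.ker_ne_bot_of_finrank_lt
    rw [Module.finrank_fintype_fun_eq_card, Module.finrank_fintype_fun_eq_card, Fintype.card_sigma,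
      Fintype.card_sigma]
    simp only [Fintype.card_fin]
    zify
    rw [← sub_pos, ← Finset.sum_sub_distrib]
    convert hA using 1
    refine Finset.sum_congr rfl fun i _ => ?_
    have := hN1 i
    simp only [c, e]
    omega
  obtain ⟨u, hu, hu0⟩ := (Submodule.ne_bot_iff _).mp hker
  refine ⟨L u, fun h => hu0 (hLinj u h), fun i k hk => ?_⟩
  by_cases hkN : k ≤ N i + e i
  · have h1 := congrFun (LinearMap.mem_ker.mp hu) ⟨i, ⟨N i + e i - k, by simp only [c]; omega⟩⟩
    simp only [Φ, LinearMap.pi_apply, LinearMap.comp_apply, LinearMap.proj_apply, lcoeff_apply,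
      LinearMap.restrictScalars_apply, Matrix.mulVecLin_apply, Pi.zero_apply] at h1
    rwa [Nat.sub_sub_self hkN] at h1
  · apply coeff_eq_zero_of_natDegree_lt
    refine lt_of_le_of_lt ?_ (not_le.mp hkN)
    rw [mulVec, dotProduct]
    refine natDegree_sum_le_of_forall_le _ _ fun j _ => ?_
    rcases lt_trichotomy i j with h | h | h
    · refine natDegree_mul_le.trans ((Nat.add_le_add_left (hLdeg u j) _).trans ((hN2 i j h).trans ?_))
      omega
    · subst h
      refine natDegree_mul_le.trans ((Nat.add_le_add_left (hLdeg u i) _).trans ?_)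
      simp only [e]; omega
    · rw [hP i j h, zero_mul, natDegree_zero]; omega

end UnimodularValue

end SquareReflexive

namespace SquareReflexive

open WithZero Matrix

section UnimodularValue

variable {E : Type*} [Field E]

local notation "κ" => algebraMap (Polynomial E) (RatFunc E)

theorem exists_common_denominator {ι : Type*} [Finite ι] (x : ι → RatFunc E) :
    ∃ (Q : E[X]) (y : ι → E[X]), Q ≠ 0 ∧ ∀ i, κ (y i) = κ Q * x i := by
  obtain ⟨b, hb⟩ := IsLocalization.exist_integer_multiples_of_finite (nonZeroDivisors E[X]) x
  choose y hy using hb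
  exact ⟨b, y, nonZeroDivisors.coe_ne_zero b, fun i => by rw [hy i, Algebra.smul_def]⟩

theorem dotProduct_map_mulVec {n : ℕ} (S : Matrix (Fin n) (Fin n) E[X]) (x : Fin n → E[X]) :
    κ (x ⬝ᵥ S *ᵥ x) = (fun i => κ (x i)) ⬝ᵥ (S.map κ) *ᵥ (fun i => κ (x i)) := by
  simp [dotProduct, mulVec, map_sum, map_mul]

theorem exists_isUnit_value {n : ℕ} (hn : 0 < n) (S : Matrix (Fin n) (Fin n) E[X]) (hS : S.IsSymm)
    (hdet : IsUnit S.det) :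
    ∃ x : Fin n → E[X], x ≠ 0 ∧ (x ⬝ᵥ S *ᵥ x = 0 ∨ IsUnit (x ⬝ᵥ S *ᵥ x)) := by
  classical
  by_cases han : ∀ x : Fin n → RatFunc E, x ≠ 0 → x ⬝ᵥ (S.map κ) *ᵥ x ≠ 0
  swap
  · push Not at han
    obtain ⟨x, hx, h0⟩ := han
    obtain ⟨Q, y, hQ, hy⟩ := exists_common_denominator x
    have hy' : (fun i => κ (y i)) = κ Q • x := funext hy
    refine ⟨y, fun h => hx ?_, Or.inl ?_⟩
    · ext i
      have := hy i
      rw [h, Pi.zero_apply, map_zero] at this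
      exact (mul_eq_zero.mp this.symm).resolve_left (κ_ne_zero hQ)
    · apply RatFunc.algebraMap_injective E
      rw [dotProduct_map_mulVec, hy', map_zero, mulVec_smul, smul_dotProduct, dotProduct_smul, h0]
      simp
  obtain ⟨a, P, hP1, hP0, hSP⟩ := exists_triangular_diag n (S.map κ)
    (hS.map _) han
  have hdetP : P.det = 1 := by
    rw [det_of_isUpperTriangular (fun i j h => hP0 i j h)]
    simp [hP1]
  obtain ⟨c, hc, hc'⟩ := Polynomial.isUnit_iff.mp hdet
  have hprod : ∏ i, a i = κ (C c) := by
    have := congrArg det hSP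
    rw [det_mul, det_mul, det_transpose, hdetP, det_diagonal, one_mul, mul_one] at this
    rw [← this, hc', RingHom.map_det]; rfl
  have ha : ∀ i, a i ≠ 0 := by
    have : ∏ i, a i ≠ 0 := by rw [hprod]; exact κ_ne_zero (C_ne_zero.mpr hc.ne_zero)
    exact fun i => (Finset.prod_ne_zero_iff.mp this) i (Finset.mem_univ i)
  obtain ⟨Q, P', hQ, hP'⟩ := exists_common_denominator (fun s : Fin n × Fin n => P s.1 s.2)
  set v := RatFunc.inftyValuation E with hv
  have hvpoly : ∀ f : E[X], f ≠ 0 → log (v (κ f)) = f.natDegree := by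
    intro f hf
    have : v (κ f) = exp (f.natDegree : ℤ) := RatFunc.inftyValuation.polynomial E hf
    rw [this, log_exp]
  have hsum : ∑ i, log (v (a i)) = 0 := by
    have h1 : log (v (∏ i, a i)) = ∑ i, log (v (a i)) := by
      rw [map_prod]
      have : ∀ s : Finset (Fin n), log (∏ i ∈ s, v (a i)) = ∑ i ∈ s, log (v (a i)) := by
        intro s
        induction s using Finset.induction_on with
        | empty => simp
        | insert i s his ih =>
          rw [Finset.prod_insert his, Finset.sum_insert his, log_mul ((v.ne_zero_iff).mpr (ha i))
            (Finset.prod_ne_zero_iff.mpr fun j _ => (v.ne_zero_iff).mpr (ha j)), ih]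
      exact this _
    rw [← h1, hprod, hvpoly _ (C_ne_zero.mpr hc.ne_zero), natDegree_C]; rfl
  let A : Fin n → ℤ := fun i => Q.natDegree + (-log (v (a i))) / 2
  have hdiag : ∀ i, (P' (i, i)) = Q := fun i => RatFunc.algebraMap_injective E (by
    rw [hP' (i, i)]; simp [hP1])
  obtain ⟨x, hx, hsmall⟩ := exists_triangular_small (Matrix.of fun i j => P' (i, j)) (by
    intro i j h
    apply RatFunc.algebraMap_injective E
    rw [of_apply, hP' (i, j), map_zero]; simp [hP0 i j h]) A (by
    have h2 : ∀ i, (1 : ℤ) ≤ 2 * (A i + 1 - ((of fun i j => P' (i, j)) i i).natDegree) + log (v (a i)) := by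
      intro i
      simp only [of_apply, hdiag, A]
      omega
    have h3 := Finset.sum_le_sum (s := Finset.univ) (fun i _ => h2 i)
    rw [Finset.sum_add_distrib, hsum, ← Finset.mul_sum] at h3
    simp only [Finset.sum_const, Finset.card_univ, Fintype.card_fin, nsmul_eq_mul, mul_one] at h3
    omega)
  refine ⟨x, hx, ?_⟩
  rw [or_iff_not_imp_left]
  intro hne
  have hval : κ (x ⬝ᵥ S *ᵥ x) = ∑ i, a i * (κ (((of fun i j => P' (i, j)) *ᵥ x) i) / κ Q) ^ 2 := by
    have h1 : P *ᵥ (fun i => κ (x i)) = fun i => κ (((of fun i j => P' (i, j)) *ᵥ x) i) / κ Q := by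
      ext i
      simp only [mulVec, dotProduct, of_apply, map_sum, map_mul, Finset.sum_div]
      refine Finset.sum_congr rfl fun j _ => ?_
      rw [hP' (i, j)]
      field_simp [κ_ne_zero hQ]
    rw [dotProduct_map_mulVec, hSP, ← mulVec_mulVec, ← mulVec_mulVec, dotProduct_mulVec,
      vecMul_transpose, h1]
    simp only [dotProduct, mulVec_diagonal]
    exact Finset.sum_congr rfl fun i _ => by ring
  have hle : v (κ (x ⬝ᵥ S *ᵥ x)) ≤ 1 := by
    rw [hval]
    refine Valuation.map_sum_le _ fun i _ => ?_
    set w := ((of fun i j => P' (i, j)) *ᵥ x) i with hw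
    rcases eq_or_ne w 0 with h0 | h0
    · simp [h0]
    have hdeg : (w.natDegree : ℤ) ≤ A i := by
      by_contra hcon
      exact h0 (leadingCoeff_eq_zero.mp (hsmall i w.natDegree (not_le.mp hcon)))
    have hne1 : a i * (κ w / κ Q) ^ 2 ≠ 0 :=
      mul_ne_zero (ha i) (pow_ne_zero 2 (div_ne_zero (κ_ne_zero h0) (κ_ne_zero hQ)))
    have hva : v (a i) ≠ 0 := (v.ne_zero_iff).mpr (ha i)
    have hvw : v (κ w) ≠ 0 := (v.ne_zero_iff).mpr (κ_ne_zero h0)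
    have hvQ : v (κ Q) ≠ 0 := (v.ne_zero_iff).mpr (κ_ne_zero hQ)
    rw [← log_le_log ((v.ne_zero_iff).mpr hne1) one_ne_zero, log_one, map_mul, map_pow, map_div₀,
      log_mul hva (pow_ne_zero 2 (div_ne_zero hvw hvQ)), log_pow, log_div hvw hvQ, hvpoly _ h0,
      hvpoly _ hQ]
    simp only [A] at hdeg
    simp only [nsmul_eq_mul, Nat.cast_ofNat]
    omega
  have hd : (x ⬝ᵥ S *ᵥ x).natDegree = 0 := by
    rw [← log_le_log ((v.ne_zero_iff).mpr (κ_ne_zero hne)) one_ne_zero, log_one, hvpoly _ hne] at hle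
    omega
  exact isUnit_of_natDegree_eq_zero hne hd

end UnimodularValue

end SquareReflexive

namespace SquareReflexive

open Matrix

section Lagrangian

set_option linter.unusedSectionVars false

universe u

/-- Every unimodular symmetric matrix represents zero or a unit nontrivially. -/
def RepresentsUnit (R : Type*) [CommRing R] : Prop :=
  ∀ (n : ℕ) (S : Matrix (Fin n) (Fin n) R), 0 < n → S.IsSymm → IsUnit S.det →
    ∃ x : Fin n → R, x ≠ 0 ∧ (x ⬝ᵥ S *ᵥ x = 0 ∨ IsUnit (x ⬝ᵥ S *ᵥ x))

variable {R : Type*} [CommRing R] [IsDomain R] [IsPrincipalIdealRing R]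
variable {M : Type u} [AddCommGroup M] [Module R M] [Module.Free R M] [Module.Finite R M]
variable {B : M →ₗ[R] M →ₗ[R] R}

theorem isUnit_det_gram (hB : Function.Bijective B) {ι : Type*} [Fintype ι] [DecidableEq ι]
    (b : Module.Basis ι R M) : IsUnit (Matrix.of fun i j => B (b i) (b j)).det := by
  have h := LinearEquiv.isUnit_det (LinearEquiv.ofBijective B hB) b b.dualBasis
  rw [← det_transpose] at h
  convert h using 2
  ext i j
  simp [LinearMap.toMatrix_apply]

theorem apply_equivFun_symm {ι : Type*} [Fintype ι] (b : Module.Basis ι R M) (c : ι → R) :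
    B (b.equivFun.symm c) (b.equivFun.symm c) = c ⬝ᵥ (Matrix.of fun i j => B (b i) (b j)) *ᵥ c := by
  simp only [Module.Basis.equivFun_symm_apply, map_sum, LinearMap.sum_apply, map_smul,
    LinearMap.smul_apply, smul_eq_mul, dotProduct, mulVec, of_apply, Finset.mul_sum]
  rw [Finset.sum_comm]
  exact Finset.sum_congr rfl fun i _ => Finset.sum_congr rfl fun j _ => by ring

theorem exists_isUnit_or_isotropic (hR : RepresentsUnit R) (hs : ∀ x y, B x y = B y x)
    (hB : Function.Bijective B) (h0 : 0 < Module.finrank R M) :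
    ∃ x : M, x ≠ 0 ∧ (B x x = 0 ∨ IsUnit (B x x)) := by
  let b := Module.finBasis R M
  obtain ⟨c, hc, h⟩ := hR _ (Matrix.of fun i j => B (b i) (b j)) h0 (by
    ext i j; simp [hs (b j) (b i)]) (isUnit_det_gram hB b)
  refine ⟨b.equivFun.symm c, fun h => hc (b.equivFun.symm.injective (by rw [h, map_zero])), ?_⟩
  rwa [apply_equivFun_symm]

theorem bijective_domRestrict (hs : ∀ x y, B x y = B y x) (hB : Function.Bijective B)
    (W : Submodule R M) (π : M →ₗ[R] M) (hπ : ∀ z, π z ∈ W) (hπW : ∀ w ∈ W, π w = w)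
    (hBπ : ∀ z, ∀ w ∈ W, B (π z) w = B z w) : Function.Bijective (B.domRestrict₁₂ W W) := by
  constructor
  · rw [injective_iff_map_eq_zero]
    intro w hw
    have : B (w : M) = 0 := by
      ext z
      rw [hs, ← hBπ z w w.2, hs]
      exact LinearMap.congr_fun hw ⟨π z, hπ z⟩
    exact Subtype.ext ((injective_iff_map_eq_zero B).mp hB.1 _ this)
  · intro l
    obtain ⟨z, hz⟩ := hB.2 (l ∘ₗ π.codRestrict W hπ)
    refine ⟨⟨π z, hπ z⟩, ?_⟩
    ext w
    change B (π z) w = l w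
    rw [hBπ z w w.2, hz]
    change l ⟨π w, _⟩ = l w
    congr 1
    exact Subtype.ext (hπW w w.2)

theorem unit_split (hs : ∀ x y, B x y = B y x) (hB : Function.Bijective B) {x : M} (hx : IsUnit (B x x)) :
    Function.Bijective (B.domRestrict₁₂ (LinearMap.ker (B x)) (LinearMap.ker (B x))) ∧
      Module.finrank R (LinearMap.ker (B x)) + 1 = Module.finrank R M := by
  obtain ⟨k, hk⟩ := hx.exists_left_inv
  constructor
  · refine bijective_domRestrict hs hB _ (LinearMap.id - (k • B x).smulRight x) ?_ ?_ ?_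
    · intro z
      simp only [LinearMap.mem_ker, LinearMap.sub_apply, LinearMap.id_apply, LinearMap.smulRight_apply,
        LinearMap.smul_apply, map_sub, map_smul, smul_eq_mul]
      linear_combination (-(B x) z) * hk
    · intro w hw
      simp [LinearMap.mem_ker.mp hw]
    · intro z w hw
      simp [LinearMap.mem_ker.mp hw]
  · have h1 := Submodule.finrank_quotient_add_finrank (LinearMap.ker (B x))
    have h2 : Function.Surjective (B x) := fun r =>
      ⟨(r * k) • x, by rw [map_smul, smul_eq_mul, mul_assoc, hk, mul_one]⟩
    rw [((B x).quotKerEquivOfSurjective h2).finrank_eq, Module.finrank_self] at h1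
    omega

theorem exists_isotropic_of_two_lt (hR : RepresentsUnit R) (hs : ∀ x y, B x y = B y x)
    (hB : Function.Bijective B) (h0 : 2 < Module.finrank R M)
    (h3 : ∀ k₁ k₂ k₃ : R, IsUnit k₁ → IsUnit k₂ → IsUnit k₃ → ∃ x : Fin 3 → R, x ≠ 0 ∧
      k₁ * x 0 ^ 2 + k₂ * x 1 ^ 2 + k₃ * x 2 ^ 2 = 0) : ∃ x : M, x ≠ 0 ∧ B x x = 0 := by
  obtain ⟨x, hx, h | hxu⟩ := exists_isUnit_or_isotropic hR hs hB (by omega)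
  · exact ⟨x, hx, h⟩
  obtain ⟨hB1, hr1⟩ := unit_split hs hB hxu
  have hs1 : ∀ y z, B.domRestrict₁₂ (LinearMap.ker (B x)) (LinearMap.ker (B x)) y z =
    B.domRestrict₁₂ (LinearMap.ker (B x)) (LinearMap.ker (B x)) z y := fun y z => hs y z
  obtain ⟨y, hy, h | hyu⟩ := exists_isUnit_or_isotropic hR hs1 hB1 (by omega)
  · exact ⟨y, by simpa using hy, h⟩
  obtain ⟨hB2, hr2⟩ := unit_split hs1 hB1 hyu
  obtain ⟨z, hz, h | hzu⟩ := exists_isUnit_or_isotropic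
    (B := (B.domRestrict₁₂ _ _).domRestrict₁₂ _ _) hR (fun z w => hs1 z w) hB2 (by omega)
  · exact ⟨z, by simpa using hz, h⟩
  obtain ⟨c, hc, h⟩ := h3 _ _ _ hxu hyu hzu
  change B x x * c 0 ^ 2 + B (y : M) y * c 1 ^ 2 + B (z : M) z * c 2 ^ 2 = 0 at h
  have hxy : B x y = 0 := y.2
  have hxz : B x (z : M) = 0 := z.1.2
  have hyz : B (y : M) (z : M) = 0 := z.2
  have hyx : B (y : M) x = 0 := by rw [hs]; exact hxy
  have hzx : B (z : M) x = 0 := by rw [hs]; exact hxz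
  have hzy : B (z : M) y = 0 := by rw [hs]; exact hyz
  have hval : ∀ w : M, B w (c 0 • x + c 1 • (y : M) + c 2 • (z : M)) =
      c 0 * B w x + c 1 * B w y + c 2 * B w z := by
    intro w; simp
  refine ⟨c 0 • x + c 1 • (y : M) + c 2 • (z : M), fun h0 => hc ?_, ?_⟩
  · have hx0 := hval x
    have hy0 := hval y
    have hz0 := hval z
    rw [h0, map_zero] at hx0 hy0 hz0
    rw [hxy, hxz] at hx0
    rw [hyx, hyz] at hy0
    rw [hzx, hzy] at hz0
    have e0 : B x x ≠ 0 := hxu.ne_zero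
    have e1 : B (y : M) y ≠ 0 := hyu.ne_zero
    have e2 : B (z : M) z ≠ 0 := hzu.ne_zero
    ext i
    fin_cases i
    · simpa [e0, eq_comm] using hx0
    · simpa [e1, eq_comm] using hy0
    · simpa [e2, eq_comm] using hz0
  · rw [hval, hs _ x, hs _ (y : M), hs _ (z : M), hval, hval, hval, hxy, hxz, hyx, hyz, hzx, hzy]
    linear_combination h

theorem exists_hyperbolic_pair (h2 : IsUnit (2 : R)) (hs : ∀ x y, B x y = B y x)
    (hB : Function.Bijective B) {z : M} (hz : z ≠ 0) (hzz : B z z = 0) :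
    ∃ x y : M, B x x = 0 ∧ B y y = 0 ∧ B x y = 1 := by
  obtain ⟨d, hd⟩ := IsPrincipalIdealRing.principal (LinearMap.range (B z))
  have hd0 : d ≠ 0 := by
    rintro rfl
    apply hz
    apply (injective_iff_map_eq_zero B).mp hB.1
    ext w
    have : B z w ∈ LinearMap.range (B z) := ⟨w, rfl⟩
    rw [hd] at this
    simpa using this
  have hdvd : ∀ w, ∃ r, B z w = r * d := fun w => by
    have : B z w ∈ LinearMap.range (B z) := ⟨w, rfl⟩
    rw [hd, Submodule.mem_span_singleton] at this
    obtain ⟨r, hr⟩ := this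
    exact ⟨r, hr.symm⟩
  choose l hl using hdvd
  obtain ⟨x, hx⟩ := hB.2 (
    { toFun := l
      map_add' := fun a b => mul_right_cancel₀ hd0 (by rw [← hl, add_mul, ← hl, ← hl, map_add])
      map_smul' := fun r a => mul_right_cancel₀ hd0 (by
        rw [← hl, map_smul, hl a, RingHom.id_apply, smul_eq_mul, smul_eq_mul, mul_assoc]) } : M →ₗ[R] R)
  have hxl : ∀ w, B x w = l w := fun w => by rw [hx]; rfl
  have hzx : z = d • x := hB.1 (by
    ext w; rw [map_smul, LinearMap.smul_apply, hxl, hl, smul_eq_mul, mul_comm])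
  have hxx : B x x = 0 := by
    rw [hzx] at hzz
    simpa [hd0] using hzz
  obtain ⟨y, hy⟩ : d ∈ LinearMap.range (B z) := by rw [hd]; exact Submodule.mem_span_singleton_self d
  have hxy : B x y = 1 := mul_right_cancel₀ hd0 (by rw [hxl, ← hl, hy, one_mul])
  obtain ⟨k, hk⟩ := h2.exists_left_inv
  refine ⟨x, y - (k * B y y) • x, hxx, ?_, ?_⟩
  · simp only [map_sub, map_smul, LinearMap.sub_apply, LinearMap.smul_apply, smul_eq_mul, hxx, hxy,
      hs y x]
    linear_combination (-(B y y)) * hk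
  · simp [hxx, hxy]

theorem gram_basis_change {ι ι' : Type*} [Fintype ι] [DecidableEq ι] [Fintype ι'] [DecidableEq ι']
    (b : Module.Basis ι R M) (c : Module.Basis ι' R M) :
    ∃ t : R, (Matrix.of fun i j => B (c i) (c j)).det = t ^ 2 * (Matrix.of fun i j => B (b i) (b j)).det := by
  let e := b.indexEquiv c
  let b' := b.reindex e
  have h1 := LinearMap.toMatrix₂_mul_basis_toMatrix b' b' c c B
  have h2 : ∀ {κ : Type _} [Fintype κ] [DecidableEq κ] (d : Module.Basis κ R M),
      LinearMap.toMatrix₂ d d B = Matrix.of fun i j => B (d i) (d j) := by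
    intro κ _ _ d; ext i j; simp [LinearMap.toMatrix₂_apply]
  have h3 : (Matrix.of fun i j => B (b' i) (b' j)) =
      (Matrix.of fun i j => B (b i) (b j)).submatrix e.symm e.symm := by
    ext i j; simp [b']
  rw [h2, h2, h3] at h1
  refine ⟨(b'.toMatrix c).det, ?_⟩
  rw [← h1, det_mul, det_mul, det_transpose, det_submatrix_equiv_self]
  ring

theorem hyperbolic_split (hs : ∀ x y, B x y = B y x) (hB : Function.Bijective B) {x y : M}
    (hx : B x x = 0) (hy : B y y = 0) (hxy : B x y = 1) {m : ℕ}
    (b : Module.Basis (Fin (2 * (m + 1))) R M) :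
    Function.Bijective
      (B.domRestrict₁₂ (LinearMap.ker (B x) ⊓ LinearMap.ker (B y))
        (LinearMap.ker (B x) ⊓ LinearMap.ker (B y))) ∧
    ∃ (c : Module.Basis (Fin (2 * m)) R ↥(LinearMap.ker (B x) ⊓ LinearMap.ker (B y))) (t : R),
      (Matrix.of fun i j => B (c i : M) (c j)).det =
        -(t ^ 2 * (Matrix.of fun i j => B (b i) (b j)).det) := by
  have hyx : B y x = 1 := by rw [hs, hxy]
  generalize hW : LinearMap.ker (B x) ⊓ LinearMap.ker (B y) = W
  have hmem : ∀ z, z ∈ W ↔ B x z = 0 ∧ B y z = 0 := fun z => by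
    rw [← hW, Submodule.mem_inf, LinearMap.mem_ker, LinearMap.mem_ker]
  have hWx : ∀ w : W, B x w = 0 := fun w => ((hmem w).mp w.2).1
  have hWy : ∀ w : W, B y w = 0 := fun w => ((hmem w).mp w.2).2
  have hxW : ∀ w : W, B w x = 0 := fun w => by rw [hs, hWx]
  have hyW : ∀ w : W, B w y = 0 := fun w => by rw [hs, hWy]
  let π : M →ₗ[R] M := LinearMap.id - (B y).smulRight x - (B x).smulRight y
  have hπ : ∀ z, π z = z - B y z • x - B x z • y := fun z => rfl
  have hπW : ∀ z, π z ∈ W := fun z => by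
    rw [hmem, hπ]
    simp [hx, hy, hxy, hyx]
  refine ⟨bijective_domRestrict hs hB W π hπW (fun w hw => ?_) (fun z w hw => ?_), ?_⟩
  · obtain ⟨h1, h2⟩ := (hmem w).mp hw
    simp [hπ, h1, h2]
  · obtain ⟨h1, h2⟩ := (hmem w).mp hw
    simp [hπ, h1, h2]
  let φ : (Fin 2 → R) × W →ₗ[R] M :=
    ((LinearMap.proj (R := R) (φ := fun _ : Fin 2 => R) 0).smulRight x +
      (LinearMap.proj (R := R) (φ := fun _ : Fin 2 => R) 1).smulRight y).coprod W.subtype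
  have hφ : ∀ u w, φ (u, w) = u 0 • x + u 1 • y + w := fun u w => by simp [φ]
  have hφb : Function.Bijective φ := by
    constructor
    · rw [injective_iff_map_eq_zero]
      rintro ⟨u, w⟩ h
      rw [hφ] at h
      have h0 := congrArg (B y) h
      have h1 := congrArg (B x) h
      simp only [map_add, map_smul, smul_eq_mul, hx, hy, hxy, hyx, hWx, hWy, mul_one, mul_zero,
        add_zero, zero_add, map_zero] at h0 h1
      rw [h0, h1, zero_smul, zero_smul, zero_add, zero_add] at h
      refine Prod.ext ?_ (Subtype.ext h)
      ext i
      fin_cases i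
      · exact h0
      · exact h1
    · intro z
      refine ⟨(![B y z, B x z], ⟨π z, hπW z⟩), ?_⟩
      rw [hφ]
      simp [hπ]
  let e := LinearEquiv.ofBijective φ hφb
  have hfin : Module.finrank R W = 2 * m := by
    have h1 := e.finrank_eq
    rw [Module.finrank_prod, Module.finrank_fin_fun, Module.finrank_eq_card_basis b,
      Fintype.card_fin] at h1
    omega
  let c := (Module.finBasis R W).reindex (finCongr hfin)
  let d := ((Pi.basisFun R (Fin 2)).prod c).map e
  have hd0 : d (Sum.inl 0) = x := by simp [d, e, hφ]
  have hd1 : d (Sum.inl 1) = y := by simp [d, e, hφ]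
  have hdr : ∀ i, d (Sum.inr i) = c i := fun i => by simp [d, e, hφ]
  obtain ⟨t, ht⟩ := gram_basis_change (B := B) b d
  refine ⟨c, t, ?_⟩
  have hblock : (Matrix.of fun i j => B (d i) (d j)) =
      fromBlocks !![0, 1; 1, 0] 0 0 (Matrix.of fun i j => B (c i : M) (c j)) := by
    ext i j
    rcases i with i | i <;> rcases j with j | j
    · fin_cases i <;> fin_cases j <;> simp [hd0, hd1, hx, hy, hxy, hyx]
    · fin_cases i <;> simp [hd0, hd1, hdr, hWx, hWy]
    · fin_cases j <;> simp [hd0, hd1, hdr, hxW, hyW]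
    · simp [hdr]
  rw [← ht, hblock, det_fromBlocks_zero₂₁, det_fin_two_of]
  ring

theorem exists_isotropic_of_det {s : R} (b : Module.Basis (Fin 2) R M)
    (hs : ∀ x y, B x y = B y x) (hd : (Matrix.of fun i j => B (b i) (b j)).det = -s ^ 2) :
    ∃ x : M, x ≠ 0 ∧ B x x = 0 := by
  rw [det_fin_two] at hd
  simp only [of_apply] at hd
  by_cases hA : B (b 0) (b 0) = 0
  · exact ⟨b 0, b.ne_zero 0, hA⟩
  refine ⟨(s - B (b 0) (b 1)) • b 0 + B (b 0) (b 0) • b 1, fun h => hA ?_, ?_⟩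
  · have := congrArg (fun z => b.repr z 1) h
    simpa using this
  · simp only [map_add, map_smul, LinearMap.add_apply, LinearMap.smul_apply, smul_eq_mul]
    rw [hs (b 1) (b 0)] at hd ⊢
    linear_combination B (b 0) (b 0) * hd

/-- A unimodular symmetric bilinear form of rank `2m` with discriminant `(-1)^m` up to squares
admits an `m`-dimensional totally isotropic submodule, provided that ternary diagonal forms with
unit coefficients are isotropic (this is not needed if `m ≤ 1`). -/
theorem exists_lagrangian (hR : RepresentsUnit R) (h2 : IsUnit (2 : R)) (m : ℕ) :
    ∀ {M : Type u} [AddCommGroup M] [Module R M] [Module.Free R M] [Module.Finite R M]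
      {B : M →ₗ[R] M →ₗ[R] R} (_ : ∀ x y, B x y = B y x) (_ : Function.Bijective B)
      (b : Module.Basis (Fin (2 * m)) R M) (s : R)
      (_ : (Matrix.of fun i j => B (b i) (b j)).det = (-1) ^ m * s ^ 2)
      (_ : m ≤ 1 ∨ ∀ k₁ k₂ k₃ : R, IsUnit k₁ → IsUnit k₂ → IsUnit k₃ → ∃ x : Fin 3 → R, x ≠ 0 ∧
        k₁ * x 0 ^ 2 + k₂ * x 1 ^ 2 + k₃ * x 2 ^ 2 = 0),
      ∃ j : (Fin m → R) →ₗ[R] M, Function.Injective j ∧ ∀ u w, B (j u) (j w) = 0 := by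
  induction m with
  | zero =>
    intro M _ _ _ _ B _ _ b s _ _
    exact ⟨0, fun u w _ => Subsingleton.elim u w, by simp⟩
  | succ m ih =>
    intro M _ _ _ _ B hs hB b s hd h3
    obtain ⟨z, hz, hzz⟩ : ∃ x : M, x ≠ 0 ∧ B x x = 0 := by
      rcases Nat.eq_zero_or_pos m with rfl | hm
      · exact exists_isotropic_of_det b hs (s := s) (by rw [hd]; ring)
      · refine exists_isotropic_of_two_lt hR hs hB ?_ (h3.resolve_left (by omega))
        rw [Module.finrank_eq_card_basis b, Fintype.card_fin]
        omega
    obtain ⟨x, y, hx, hy, hxy⟩ := exists_hyperbolic_pair h2 hs hB hz hzz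
    obtain ⟨hBW, c, t, hdet⟩ := hyperbolic_split hs hB hx hy hxy b
    obtain ⟨j, hj, hjB⟩ := ih (B := B.domRestrict₁₂ _ _) (fun u w => hs u w) hBW c (t * s) (by
      change (Matrix.of fun i j => B (c i : M) (c j)).det = _
      rw [hdet, hd]; ring) (h3.imp_left fun h => by omega)
    have hWx : ∀ u, B x (j u : M) = 0 := fun u => (j u).2.1
    have hWy : ∀ u, B y (j u : M) = 0 := fun u => (j u).2.2
    refine ⟨(LinearMap.proj 0).smulRight x +
      (Submodule.subtype _ ∘ₗ j ∘ₗ LinearMap.funLeft R R Fin.succ), ?_, ?_⟩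
    · rw [injective_iff_map_eq_zero]
      intro u hu
      have hu' : u 0 • x + (j (u ∘ Fin.succ) : M) = 0 := hu
      have h0 := congrArg (B y) hu'
      rw [map_add, map_smul, hWy, hs y x, hxy, map_zero, add_zero, smul_eq_mul, mul_one] at h0
      rw [h0, zero_smul, zero_add] at hu'
      have h1 : u ∘ Fin.succ = 0 := (injective_iff_map_eq_zero j).mp hj _ (Subtype.ext hu')
      ext i
      refine Fin.cases h0 (fun i => congrFun h1 i) i
    · intro u w
      change B (u 0 • x + (j (u ∘ Fin.succ) : M)) (w 0 • x + (j (w ∘ Fin.succ) : M)) = 0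
      have := hjB (u ∘ Fin.succ) (w ∘ Fin.succ)
      change B (j (u ∘ Fin.succ) : M) (j (w ∘ Fin.succ) : M) = 0 at this
      simp [hx, hWx, hs _ x, this]

end Lagrangian

end SquareReflexive

namespace SquareReflexive

section SelfDual

variable {ι : Type*} [Fintype ι] {R : Type*} [CommRing R]

/-- The diagonal bilinear form with coefficients `a`. -/
def diagForm (a : ι → R) : (ι → R) →ₗ[R] (ι → R) →ₗ[R] R :=
  LinearMap.mk₂ R (fun y z => ∑ i, a i * (y i * z i))
    (fun x y z => by simp only [Pi.add_apply, ← Finset.sum_add_distrib]; congr 1 with i; ring)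
    (fun c y z => by
      simp only [Pi.smul_apply, smul_eq_mul, Finset.mul_sum]; congr 1 with i; ring)
    (fun x y z => by simp only [Pi.add_apply, ← Finset.sum_add_distrib]; congr 1 with i; ring)
    (fun c y z => by
      simp only [Pi.smul_apply, smul_eq_mul, Finset.mul_sum]; congr 1 with i; ring)

theorem diagForm_apply (a y z : ι → R) : diagForm a y z = ∑ i, a i * (y i * z i) := rfl

theorem diagForm_comm (a y z : ι → R) : diagForm a y z = diagForm a z y := by
  rw [diagForm_apply, diagForm_apply]; congr 1 with i; ring

theorem diagForm_single [DecidableEq ι] (a y : ι → R) (i : ι) (c : R) :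
    diagForm a y (Pi.single i c) = a i * (y i * c) := by
  rw [diagForm_apply, Finset.sum_eq_single i]
  · simp
  · intro j _ hj
    simp [hj]
  · simp

theorem representsUnit_field (K : Type*) [Field K] : RepresentsUnit K := fun n S hn _ _ => by
  have : Nonempty (Fin n) := ⟨⟨0, hn⟩⟩
  obtain ⟨x, hx⟩ := exists_ne (0 : Fin n → K)
  exact ⟨x, hx, (eq_or_ne _ 0).imp_right fun h => IsUnit.mk0 _ h⟩

theorem exists_selfDual {K : Type*} [Field K] (h2 : (2 : K) ≠ 0) {J : Type*} [Fintype J]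
    (d : J → K) (hd : ∀ i, d i ≠ 0) (k : ℕ) (hcard : Fintype.card J = 2 * k) (s : K)
    (hprod : ∏ i, d i = (-1) ^ k * s ^ 2)
    (hk : k ≤ 1 ∨ ∀ k₁ k₂ k₃ : K, IsUnit k₁ → IsUnit k₂ → IsUnit k₃ → ∃ x : Fin 3 → K, x ≠ 0 ∧
      k₁ * x 0 ^ 2 + k₂ * x 1 ^ 2 + k₃ * x 2 ^ 2 = 0) :
    ∃ Λ : Submodule K (J → K), ∀ z, z ∈ Λ ↔ ∀ y ∈ Λ, diagForm d y z = 0 := by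
  classical
  have hinj : Function.Injective (diagForm d) := by
    rw [injective_iff_map_eq_zero]
    intro y hy
    ext i
    have := LinearMap.congr_fun hy (Pi.single i 1)
    rw [diagForm_single] at this
    simpa [hd i] using this
  have hbij : Function.Bijective (diagForm d) :=
    ⟨hinj, (LinearMap.injective_iff_surjective_of_finrank_eq_finrank
      (Subspace.dual_finrank_eq (K := K) (V := J → K)).symm).mp hinj⟩
  let e : J ≃ Fin (2 * k) := Fintype.equivFinOfCardEq hcard
  let b := (Pi.basisFun K J).reindex e
  have hb : ∀ i, b i = Pi.single (e.symm i) 1 := fun i => by simp [b]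
  obtain ⟨j, hj, hjB⟩ := exists_lagrangian (representsUnit_field K) (IsUnit.mk0 _ h2) k
    (diagForm_comm d) hbij b s (by
      have : (Matrix.of fun i j => diagForm d (b i) (b j)) =
          Matrix.diagonal fun i => d (e.symm i) := by
        ext i j
        rw [Matrix.of_apply, hb, hb, diagForm_single, Matrix.diagonal_apply, Pi.single_apply]
        by_cases h : i = j
        · simp [h]
        · simp [h, Ne.symm h]
      rw [this, Matrix.det_diagonal, Equiv.prod_comp e.symm d, hprod]) hk
  refine ⟨LinearMap.range j, fun z => ⟨?_, fun h => ?_⟩⟩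
  · rintro ⟨w, rfl⟩ _ ⟨u, rfl⟩
    exact hjB u w
  · have hrefl : LinearMap.IsRefl (diagForm d) := fun y z h => by rw [diagForm_comm, h]
    have hnd : LinearMap.BilinForm.Nondegenerate (diagForm d) :=
      (LinearMap.IsRefl.nondegenerate_iff_separatingLeft hrefl).mpr fun y hy =>
        (injective_iff_map_eq_zero _).mp hinj y (LinearMap.ext hy)
    have hle : LinearMap.range j ≤ LinearMap.BilinForm.orthogonal (diagForm d) (LinearMap.range j) := by
      rintro _ ⟨w, rfl⟩
      rw [LinearMap.BilinForm.mem_orthogonal_iff]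
      rintro _ ⟨u, rfl⟩
      exact hjB u w
    have h1 := LinearMap.BilinForm.finrank_orthogonal hnd (LinearMap.range j)
    rw [LinearMap.finrank_range_of_inj hj, Module.finrank_fin_fun, Module.finrank_fintype_fun_eq_card,
      hcard] at h1
    rw [Submodule.eq_of_le_of_finrank_eq hle (by
      rw [h1, LinearMap.finrank_range_of_inj hj, Module.finrank_fin_fun]; omega)]
    rw [LinearMap.BilinForm.mem_orthogonal_iff]
    exact h

end SelfDual

section Local

variable {E : Type*} [Field E]

/-- Ternary quadratic forms with coefficients prime to `p` have nontrivial zeros modulo `p`. -/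
def TernaryMod (p : E[X]) : Prop :=
  ∀ a b c : E[X], ¬ p ∣ a → ¬ p ∣ b → ¬ p ∣ c →
    ∃ x y z, ¬ (p ∣ x ∧ p ∣ y ∧ p ∣ z) ∧ p ∣ a * x ^ 2 + b * y ^ 2 + c * z ^ 2

open Classical in
theorem exists_local_lattice (h2 : (2 : E) ≠ 0) {p : E[X]} (hp : Prime p) {ι : Type*} [Fintype ι]
    (a c : ι → E[X]) (k : ℕ) (hc : ∀ i, p ∣ a i → a i = p * c i ∧ ¬ p ∣ c i)
    (hcard : Fintype.card {i // p ∣ a i} = 2 * k) (hk : k ≤ 1 ∨ TernaryMod p)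
    {s : E[X]} (hs : p ∣ ∏ i : {i // p ∣ a i}, c i - (-1) ^ k * s ^ 2) :
    ∃ L : Submodule E[X] (ι → E[X]), ∀ z, z ∈ L ↔
      (∀ i, ¬ p ∣ a i → p ∣ z i) ∧ ∀ y ∈ L, p ^ 2 ∣ diagForm a y z := by
  have hmax : (Ideal.span {p}).IsMaximal :=
    PrincipalIdealRing.isMaximal_of_irreducible hp.irreducible
  let _ := Ideal.Quotient.field (Ideal.span {p})
  let mk := Ideal.Quotient.mk (Ideal.span {p})
  have hmk : ∀ x, mk x = 0 ↔ p ∣ x := fun x => Ideal.Quotient.eq_zero_iff_dvd p x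
  obtain ⟨Λ, hΛ⟩ := exists_selfDual (K := E[X] ⧸ Ideal.span {p}) (by
    have : ¬ p ∣ C 2 := not_prime_dvd_C h2 hp
    rw [← hmk, map_ofNat, map_ofNat] at this
    exact this) (fun i : {i // p ∣ a i} => mk (c i)) (fun i => by
      rw [Ne, hmk]; exact (hc i i.2).2) k hcard (mk s) (by
      rw [← hmk, map_sub, sub_eq_zero] at hs
      rw [← map_prod, hs]; simp) (hk.imp_right fun h k₁ k₂ k₃ h₁ h₂ h₃ => by
      obtain ⟨k₁, rfl⟩ := Ideal.Quotient.mk_surjective k₁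
      obtain ⟨k₂, rfl⟩ := Ideal.Quotient.mk_surjective k₂
      obtain ⟨k₃, rfl⟩ := Ideal.Quotient.mk_surjective k₃
      obtain ⟨x, y, z, hxyz, h⟩ := h k₁ k₂ k₃ (fun h => h₁.ne_zero ((hmk _).mpr h))
        (fun h => h₂.ne_zero ((hmk _).mpr h)) (fun h => h₃.ne_zero ((hmk _).mpr h))
      refine ⟨![mk x, mk y, mk z], fun h0 => hxyz ?_, ?_⟩
      · exact ⟨(hmk _).mp (congrFun h0 0), (hmk _).mp (congrFun h0 1), (hmk _).mp (congrFun h0 2)⟩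
      · rw [← hmk] at h
        simpa using h)
  let r : (ι → E[X]) → {i // p ∣ a i} → E[X] ⧸ Ideal.span {p} := fun y i => mk (y i)
  have key : ∀ y z : ι → E[X], (∀ i, ¬ p ∣ a i → p ∣ y i) → (∀ i, ¬ p ∣ a i → p ∣ z i) →
      (p ^ 2 ∣ diagForm a y z ↔ diagForm (fun i : {i // p ∣ a i} => mk (c i)) (r y) (r z) = 0) := by
    intro y z hy hz
    have h1 : diagForm (fun i : {i // p ∣ a i} => mk (c i)) (r y) (r z) =
        mk (∑ i : {i // p ∣ a i}, c i * (y i * z i)) := by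
      simp [diagForm_apply, r]
    rw [h1, hmk, diagForm_apply, ← Fintype.sum_subtype_add_sum_subtype (fun i => p ∣ a i),
      dvd_add_left (a := p ^ 2) (Finset.dvd_sum fun i _ => Dvd.dvd.mul_left (by
          rw [pow_two]; exact mul_dvd_mul (hy i i.2) (hz i i.2)) _)]
    have h3 : ∑ i : {i // p ∣ a i}, a i * (y i * z i) =
        p * ∑ i : {i // p ∣ a i}, c i * (y i * z i) := by
      rw [Finset.mul_sum]
      exact Finset.sum_congr rfl fun i _ => by rw [(hc i i.2).1]; ring
    rw [h3, pow_two, mul_dvd_mul_iff_left hp.ne_zero]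
  let L : Submodule E[X] (ι → E[X]) :=
    { carrier := {y | (∀ i, ¬ p ∣ a i → p ∣ y i) ∧ r y ∈ Λ}
      add_mem' := fun {y z} hy hz => ⟨fun i hi => dvd_add (hy.1 i hi) (hz.1 i hi), by
        have : r (y + z) = r y + r z := by ext i; simp [r]
        rw [this]; exact Λ.add_mem hy.2 hz.2⟩
      zero_mem' := ⟨fun i _ => dvd_zero p, by
        have : r 0 = 0 := by ext i; simp [r]
        rw [this]; exact Λ.zero_mem⟩
      smul_mem' := fun f y hy => ⟨fun i hi => Dvd.dvd.mul_left (hy.1 i hi) f, by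
        have : r (f • y) = mk f • r y := by ext i; simp [r]
        rw [this]; exact Λ.smul_mem _ hy.2⟩ }
  have hL : ∀ y, y ∈ L ↔ (∀ i, ¬ p ∣ a i → p ∣ y i) ∧ r y ∈ Λ := fun y => Iff.rfl
  refine ⟨L, fun z => ?_⟩
  rw [hL, and_congr_right_iff]
  intro hz
  rw [hΛ]
  constructor
  · intro h y hy
    exact (key y z hy.1 hz).mpr (h _ hy.2)
  · intro h l hl
    choose t ht using fun i => Ideal.Quotient.mk_surjective (I := Ideal.span {p}) (l i)
    let y : ι → E[X] := fun i => if hi : p ∣ a i then t ⟨i, hi⟩ else 0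
    have hry : r y = l := by
      ext i
      change mk (y i) = l i
      rw [← ht]
      simp [y, mk, i.2]
    have hy : y ∈ L := ⟨fun i hi => by simp [y, hi], by rw [hry]; exact hl⟩
    rw [← hry]
    exact (key y z hy.1 hz).mp (h y hy)

end Local

end SquareReflexive

namespace SquareReflexive

section Global

variable {E : Type*} [Field E] {ι : Type*} [Fintype ι]

/-- Every ternary diagonal quadratic form over `E` is isotropic. -/
def TernaryIsotropic (E : Type*) [Field E] : Prop :=
  ∀ a b c : E, a ≠ 0 → b ≠ 0 → c ≠ 0 →
    ∃ x : Fin 3 → E, x ≠ 0 ∧ a * x 0 ^ 2 + b * x 1 ^ 2 + c * x 2 ^ 2 = 0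

theorem TernaryIsotropic.polynomial (hE : TernaryIsotropic E) (k₁ k₂ k₃ : E[X]) (h₁ : IsUnit k₁)
    (h₂ : IsUnit k₂) (h₃ : IsUnit k₃) : ∃ x : Fin 3 → E[X], x ≠ 0 ∧
      k₁ * x 0 ^ 2 + k₂ * x 1 ^ 2 + k₃ * x 2 ^ 2 = 0 := by
  obtain ⟨a, ha, rfl⟩ := Polynomial.isUnit_iff.mp h₁
  obtain ⟨b, hb, rfl⟩ := Polynomial.isUnit_iff.mp h₂
  obtain ⟨c, hc, rfl⟩ := Polynomial.isUnit_iff.mp h₃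
  obtain ⟨x, hx, h⟩ := hE a b c ha.ne_zero hb.ne_zero hc.ne_zero
  refine ⟨fun i => C (x i), fun h0 => hx ?_, ?_⟩
  · ext i
    simpa using congrFun h0 i
  · simp only [← C_mul, ← C_pow, ← C_add, h, C_0]

theorem exists_totally_isotropic_of_lattice (h2 : (2 : E) ≠ 0) (hE : TernaryIsotropic E)
    {a : ι → E[X]} {m : ℕ} (hcard : Fintype.card ι = 2 * m) {s : E[X]}
    (hprod : ∏ i, a i = (-1) ^ m * s ^ 2) {D : E[X]} (hD : D ≠ 0) (ha : ∀ i, a i ∣ D)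
    (N : Submodule E[X] (ι → E[X])) (hDN : ∀ y, D • y ∈ N)
    (hN : ∀ z, z ∈ N ↔ ∀ y ∈ N, D ^ 2 ∣ diagForm a y z) :
    ∃ j : (Fin m → E[X]) →ₗ[E[X]] (ι → E[X]), Function.Injective j ∧
      ∀ u w, diagForm a (j u) (j w) = 0 := by
  classical
  have hD2 : D ^ 2 ≠ 0 := pow_ne_zero 2 hD
  have ha0 : ∀ i, a i ≠ 0 := fun i => ne_zero_of_dvd_ne_zero hD (ha i)
  have hdvd : ∀ y z : N, ∃ q, diagForm a y z = D ^ 2 * q := fun y z => (hN z).mp z.2 y y.2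
  choose q hq using hdvd
  let B : N →ₗ[E[X]] N →ₗ[E[X]] E[X] := LinearMap.mk₂ E[X] q
    (fun x y z => mul_left_cancel₀ hD2 (by
      rw [mul_add, ← hq, ← hq, ← hq, Submodule.coe_add, map_add, LinearMap.add_apply]))
    (fun c x z => mul_left_cancel₀ hD2 (by
      rw [← hq, Submodule.coe_smul, map_smul, LinearMap.smul_apply, hq, smul_eq_mul, smul_eq_mul]
      ring))
    (fun x y z => mul_left_cancel₀ hD2 (by
      rw [mul_add, ← hq, ← hq, ← hq, Submodule.coe_add, map_add]))
    (fun c x z => mul_left_cancel₀ hD2 (by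
      rw [← hq, Submodule.coe_smul, map_smul, hq, smul_eq_mul, smul_eq_mul]
      ring))
  have hB : ∀ y z : N, diagForm a y z = D ^ 2 * B y z := hq
  have hs : ∀ y z, B y z = B z y := fun y z => mul_left_cancel₀ hD2 (by
    rw [← hB, ← hB, diagForm_comm])
  let e : ι → N := fun i => ⟨D • Pi.single i 1, hDN _⟩
  have hBe : ∀ (y : ι → E[X]) i, diagForm a y (e i) = a i * y i * D := fun y i => by
    change diagForm a y (D • Pi.single i 1) = _
    rw [map_smul, diagForm_single, smul_eq_mul]; ring
  have hbij : Function.Bijective B := by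
    constructor
    · rw [injective_iff_map_eq_zero]
      intro y hy
      ext1
      funext i
      have h := hBe y i
      rw [hB, hy, LinearMap.zero_apply, mul_zero] at h
      simpa [ha0 i, hD] using h.symm
    · intro l
      choose c hc using ha
      have key : ∀ y : N, diagForm a y (fun i => c i * l (e i)) = D ^ 2 * l y := by
        intro y
        have h1 : D • y = ∑ i, (y : ι → E[X]) i • e i := by
          ext1
          funext i
          rw [Submodule.coe_smul, AddSubmonoidClass.coe_finsetSum, Finset.sum_apply,
            Finset.sum_eq_single i]
          · simp [e, mul_comm]
          · intro j _ hj
            simp [e, Ne.symm hj]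
          · simp
        have h2 := congrArg l h1
        rw [map_smul, map_sum, smul_eq_mul] at h2
        rw [diagForm_apply, pow_two, mul_assoc, h2, Finset.mul_sum]
        refine Finset.sum_congr rfl fun i _ => ?_
        rw [map_smul, smul_eq_mul]
        linear_combination (-((y : ι → E[X]) i * l (e i))) * hc i
      refine ⟨⟨fun i => c i * l (e i), (hN _).mpr fun y hy => ⟨_, key ⟨y, hy⟩⟩⟩, ?_⟩
      ext1 y
      apply mul_left_cancel₀ hD2
      rw [hs, ← hB]
      exact key y
  have hfin : Module.finrank E[X] N = 2 * m := by
    rw [← hcard, ← Module.finrank_fintype_fun_eq_card (R := E[X])]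
    refine le_antisymm (LinearMap.finrank_le_finrank_of_injective N.injective_subtype) ?_
    refine LinearMap.finrank_le_finrank_of_injective
      (f := (LinearMap.lsmul E[X] (ι → E[X]) D).codRestrict N hDN) ?_
    rw [injective_iff_map_eq_zero]
    intro y hy
    have : D • y = 0 := congrArg Subtype.val hy
    exact (smul_eq_zero.mp this).resolve_left hD
  let b : Module.Basis (Fin (2 * m)) E[X] N := (Module.finBasis E[X] N).reindex (finCongr hfin)
  let f : Fin (2 * m) ≃ ι := (Fintype.equivFinOfCardEq hcard).symm
  let P : Matrix (Fin (2 * m)) (Fin (2 * m)) E[X] := Matrix.of fun i k => (b i : ι → E[X]) (f k)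
  have hgram : D ^ 2 • (Matrix.of fun i j => B (b i) (b j)) =
      P * Matrix.diagonal (fun k => a (f k)) * P.transpose := by
    ext1 i j
    rw [Matrix.smul_apply, Matrix.of_apply, smul_eq_mul, ← hB, diagForm_apply,
      ← Equiv.sum_comp f, Matrix.mul_apply]
    refine Finset.sum_congr rfl fun k _ => ?_
    rw [Matrix.mul_diagonal, Matrix.transpose_apply]
    simp only [P, Matrix.of_apply]
    ring
  have hdet := congrArg Matrix.det hgram
  rw [Matrix.det_smul, Fintype.card_fin, Matrix.det_mul, Matrix.det_mul, Matrix.det_transpose,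
    Matrix.det_diagonal, Equiv.prod_comp f a, hprod] at hdet
  have hm : ((-1 : E[X]) ^ m) ^ 2 = 1 := by rw [← pow_mul, mul_comm, pow_mul]; simp
  have hdet' : (P.det * s) ^ 2 =
      (D ^ (2 * m)) ^ 2 * ((-1) ^ m * (Matrix.of fun i j => B (b i) (b j)).det) := by
    rw [← pow_mul, mul_comm (2 * m) 2, pow_mul, mul_left_comm, hdet]
    linear_combination -(P.det * s) ^ 2 * hm
  obtain ⟨r, hr⟩ := (IsIntegrallyClosed.pow_dvd_pow_iff two_ne_zero).mp
    (Dvd.intro _ hdet'.symm)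
  rw [hr, mul_pow] at hdet'
  have hdet2 := mul_left_cancel₀ (pow_ne_zero 2 (pow_ne_zero (2 * m) hD)) hdet'
  obtain ⟨j, hj, hjB⟩ := exists_lagrangian (R := E[X]) (fun n S hn hS hdet =>
    exists_isUnit_value hn S hS hdet) (by
      rw [← C_ofNat]; exact isUnit_C.mpr (IsUnit.mk0 _ h2)) m hs hbij b r (by
      rw [hdet2, ← mul_assoc, ← pow_two, hm, one_mul]) (Or.inr hE.polynomial)
  refine ⟨N.subtype ∘ₗ j, N.injective_subtype.comp hj, fun u w => ?_⟩
  change diagForm a (j u) (j w) = 0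
  rw [hB, hjB, mul_zero]

theorem exists_totally_isotropic (h2 : (2 : E) ≠ 0) (hE : TernaryIsotropic E)
    {a : ι → E[X]} (ha : ∀ i, Squarefree (a i)) {m : ℕ} (hcard : Fintype.card ι = 2 * m) {s : E[X]}
    (hprod : ∏ i, a i = (-1) ^ m * s ^ 2)
    (hL : ∀ p, Prime p → (∃ i, p ∣ a i) → ∃ L : Submodule E[X] (ι → E[X]), ∀ z, z ∈ L ↔
      (∀ i, ¬ p ∣ a i → p ∣ z i) ∧ ∀ y ∈ L, p ^ 2 ∣ diagForm a y z) :
    ∃ j : (Fin m → E[X]) →ₗ[E[X]] (ι → E[X]), Function.Injective j ∧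
      ∀ u w, diagForm a (j u) (j w) = 0 := by
  classical
  have ha0 : ∏ i, a i ≠ 0 := Finset.prod_ne_zero_iff.mpr fun i _ => (ha i).ne_zero
  let S := (UniqueFactorizationMonoid.normalizedFactors (∏ i, a i)).toFinset
  have hS : ∀ p ∈ S, Prime p ∧ ∃ i, p ∣ a i := fun p hp => by
    have h1 := Multiset.mem_toFinset.mp hp
    have h2 := UniqueFactorizationMonoid.prime_of_normalized_factor p h1
    obtain ⟨i, _, hi⟩ := (h2.dvd_finsetProd_iff _).mp
      (UniqueFactorizationMonoid.dvd_of_mem_normalizedFactors h1)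
    exact ⟨h2, i, hi⟩
  have hS' : ∀ q, Prime q → ∀ i, q ∣ a i → ∃ p ∈ S, Associated q p := fun q hq i hi => by
    obtain ⟨p, hp, h⟩ := UniqueFactorizationMonoid.exists_mem_normalizedFactors_of_dvd ha0
      hq.irreducible (hi.trans (Finset.dvd_prod_of_mem a (Finset.mem_univ i)))
    exact ⟨p, Multiset.mem_toFinset.mpr hp, h⟩
  have hcop : (S : Set E[X]).Pairwise (Function.onFun IsCoprime id) := by
    intro p hp q hq hpq
    have hp' := (hS p hp).1
    have hq' := (hS q hq).1
    refine (hp'.irreducible.coprime_iff_not_dvd).mpr fun h => hpq ?_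
    exact UniqueFactorizationMonoid.mem_normalizedFactors_eq_of_associated
      (Multiset.mem_toFinset.mp hp) (Multiset.mem_toFinset.mp hq)
      (hp'.irreducible.associated_of_dvd hq'.irreducible h)
  have hD0 : ∏ p ∈ S, p ≠ 0 := Finset.prod_ne_zero_iff.mpr fun p hp => (hS p hp).1.ne_zero
  have hex : ∀ p, ∃ L : Submodule E[X] (ι → E[X]), p ∈ S → ∀ z, z ∈ L ↔
      (∀ i, ¬ p ∣ a i → p ∣ z i) ∧ ∀ y ∈ L, p ^ 2 ∣ diagForm a y z := fun p => by
    by_cases hp : p ∈ S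
    · obtain ⟨L, hL⟩ := hL p (hS p hp).1 (hS p hp).2
      exact ⟨L, fun _ => hL⟩
    · exact ⟨⊤, fun h => absurd h hp⟩
  choose L hL' using hex
  have hpL : ∀ p ∈ S, ∀ y : ι → E[X], p • y ∈ L p := fun p hp y => by
    rw [hL' p hp]
    refine ⟨fun i _ => ⟨y i, rfl⟩, fun z hz => ?_⟩
    have hz1 := ((hL' p hp z).mp hz).1
    rw [map_smul, smul_eq_mul, pow_two]
    refine mul_dvd_mul_left p (Finset.dvd_sum fun i _ => ?_)
    by_cases hi : p ∣ a i
    · exact hi.mul_right _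
    · exact ((hz1 i hi).mul_right _).mul_left _
  have hdL : ∀ p ∈ S, ∀ (d : E[X]) (y : ι → E[X]), p ∣ d → d • y ∈ L p := by
    rintro p hp _ y ⟨c, rfl⟩
    rw [mul_smul]
    exact hpL p hp _
  let N : Submodule E[X] (ι → E[X]) := ⨅ p ∈ S, L p
  have hN : ∀ z, z ∈ N ↔ ∀ p ∈ S, z ∈ L p := fun z => by simp [N, Submodule.mem_iInf]
  have hDN : ∀ y : ι → E[X], (∏ p ∈ S, p) • y ∈ N := fun y => (hN _).mpr fun p hp =>
    hdL p hp _ y (Finset.dvd_prod_of_mem _ hp)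
  refine exists_totally_isotropic_of_lattice h2 hE hcard hprod hD0 (fun i => ?_) N hDN (fun z => ?_)
  · refine dvd_of_forall_prime_dvd (ha i) fun q hq hqi => ?_
    obtain ⟨p, hp, hqp⟩ := hS' q hq i hqi
    exact hqp.dvd.trans (Finset.dvd_prod_of_mem _ hp)
  · constructor
    · intro hz y hy
      rw [← Finset.prod_pow]
      refine Finset.prod_dvd_of_coprime (fun p hp q hq hpq => (hcop hp hq hpq).pow) fun p hp => ?_
      exact ((hL' p hp z).mp ((hN z).mp hz p hp)).2 y ((hN y).mp hy p hp)
    · intro hz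
      rw [hN]
      intro p hp
      have hp0 := (hS p hp).1.ne_zero
      have hD : ∏ p ∈ S, p = p * ∏ q ∈ S.erase p, q := (Finset.mul_prod_erase S _ hp).symm
      rw [hL' p hp]
      refine ⟨fun i hi => ?_, fun y hy => ?_⟩
      · have h1 := hz _ (hDN (Pi.single i 1))
        rw [map_smul, LinearMap.smul_apply, diagForm_comm, diagForm_single, smul_eq_mul, pow_two,
          mul_dvd_mul_iff_left hD0, mul_one] at h1
        exact ((hS p hp).1.dvd_or_dvd ((Finset.dvd_prod_of_mem _ hp).trans h1)).resolve_left hi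
      · have hmem : (∏ q ∈ S.erase p, q) • y ∈ N := (hN _).mpr fun q hq => by
          by_cases hqp : q = p
          · rw [hqp]; exact (L p).smul_mem _ hy
          · exact hdL q hq _ y (Finset.dvd_prod_of_mem _ (Finset.mem_erase.mpr ⟨hqp, hq⟩))
        have h1 := hz _ hmem
        have hne : ∏ q ∈ S.erase p, q ≠ 0 := right_ne_zero_of_mul (hD ▸ hD0)
        rw [map_smul, LinearMap.smul_apply, smul_eq_mul, hD] at h1
        obtain ⟨c, hc⟩ := h1
        refine ⟨(∏ q ∈ S.erase p, q) * c, mul_left_cancel₀ hne ?_⟩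
        rw [hc]; ring

/-- A submatrix of more than half of the entries of a form with a large totally isotropic
subspace is isotropic. -/
theorem isotropicDiag_of_totally_isotropic {R : Type*} [CommRing R] [IsDomain R] {a : ι → R}
    {m n : ℕ} (hcard : Fintype.card ι = 2 * m) (j : (Fin m → R) →ₗ[R] (ι → R))
    (hj : Function.Injective j) (hja : ∀ u w, diagForm a (j u) (j w) = 0)
    (e : Fin n → ι) (he : Function.Injective e) (hmn : m < n) :
    IsotropicDiag fun i => a (e i) := by
  classical
  let q : (Fin m → R) →ₗ[R] ({i // i ∉ Set.range e} → R) :=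
    LinearMap.funLeft R R Subtype.val ∘ₗ j
  have hq : ¬ Function.Injective q := fun h => by
    have h1 := LinearMap.finrank_le_finrank_of_injective h
    rw [Module.finrank_fin_fun, Module.finrank_fintype_fun_eq_card, Fintype.card_subtype_compl,
      hcard] at h1
    have h2 : Fintype.card {i // i ∈ Set.range e} = n := by
      rw [Set.card_range_of_injective he, Fintype.card_fin]
    have h3 := Fintype.card_subtype_le fun i => i ∈ Set.range e
    omega
  rw [injective_iff_map_eq_zero] at hq
  push Not at hq
  obtain ⟨u, hu, hu0⟩ := hq
  have hout : ∀ i, i ∉ Set.range e → j u i = 0 := fun i hi => congrFun hu ⟨i, hi⟩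
  refine ⟨fun i => j u (e i), fun h => hu0 ((injective_iff_map_eq_zero j).mp hj u ?_), ?_⟩
  · ext i
    by_cases hi : i ∈ Set.range e
    · obtain ⟨k, rfl⟩ := hi
      exact congrFun h k
    · exact hout i hi
  · rw [← hja u u, diagForm_apply]
    rw [← Finset.sum_subset (Finset.subset_univ (Finset.univ.image e)) (fun i _ hi => by
      rw [hout i (by simpa using hi)]; ring), Finset.sum_image he.injOn]
    exact Finset.sum_congr rfl fun i _ => by ring

end Global

end SquareReflexive

namespace SquareReflexive

section LocalToGlobal

open WithZero

variable {E : Type*} [Field E] {ι : Type*} [Fintype ι]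

local notation "κ" => algebraMap (Polynomial E) (RatFunc E)

open Classical in
/-- The indicator of `p ∣ f`. -/
noncomputable def dvdInd (p f : E[X]) : ℕ := if p ∣ f then 1 else 0

open Classical in
/-- `f` if `p ∣ f`, and `1` otherwise. -/
noncomputable def dvdPart (p f : E[X]) : E[X] := if p ∣ f then f else 1

theorem dvdInd_of_dvd {p f : E[X]} (h : p ∣ f) : dvdInd p f = 1 := if_pos h

theorem dvdInd_of_not_dvd {p f : E[X]} (h : ¬ p ∣ f) : dvdInd p f = 0 := if_neg h

theorem dvdPart_of_dvd {p f : E[X]} (h : p ∣ f) : dvdPart p f = f := if_pos h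

theorem dvdPart_of_not_dvd {p f : E[X]} (h : ¬ p ∣ f) : dvdPart p f = 1 := if_neg h

theorem dvdInd_neg (p f : E[X]) : dvdInd p (-f) = dvdInd p f := by
  by_cases h : p ∣ f <;> simp [dvdInd, h]

/-- The residue form at `p` of the diagonal form with coefficients `a` is a sum of hyperbolic
planes, as witnessed by its dimension and its discriminant. -/
def LocallySplit (p : E[X]) (v : Valuation (RatFunc E) ℤᵐ⁰) (a : ι → E[X]) : Prop :=
  ∃ k, ∑ i, dvdInd p (a i) = 2 * k ∧ (k ≤ 1 ∨ TernaryMod p) ∧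
    LocSq v ((-1) ^ k * ∏ i, κ (dvdPart p (a i)))

theorem LocallySplit.exists_lattice (h2 : (2 : E) ≠ 0) {p : E[X]} {v : Valuation (RatFunc E) ℤᵐ⁰}
    (hv : PlaceAt v p) {a : ι → E[X]} (ha : ∀ i, Squarefree (a i)) (h : LocallySplit p v a) :
    ∃ L : Submodule E[X] (ι → E[X]), ∀ z, z ∈ L ↔
      (∀ i, ¬ p ∣ a i → p ∣ z i) ∧ ∀ y ∈ L, p ^ 2 ∣ diagForm a y z := by
  classical
  obtain ⟨k, hk, hk1, hsq⟩ := h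
  have hp := hv.prime
  have hc : ∀ i, ∃ c, p ∣ a i → a i = p * c ∧ ¬ p ∣ c := fun i => by
    by_cases h : p ∣ a i
    · obtain ⟨c, hc⟩ := h
      exact ⟨c, fun _ => ⟨hc, not_dvd_of_squarefree_mul hp (hc ▸ ha i) dvd_rfl⟩⟩
    · exact ⟨0, fun h' => absurd h' h⟩
  choose c hc using hc
  have hcard : Fintype.card {i // p ∣ a i} = 2 * k := by
    rw [Fintype.card_subtype, Finset.card_filter, ← hk]
    exact Finset.sum_congr rfl fun i _ => by unfold dvdInd; congr
  have hpr : (∏ i, κ (dvdPart p (a i))) =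
      κ (∏ i : {i // p ∣ a i}, c i) * (κ p ^ k) ^ 2 := by
    have h1 : ∀ i, κ (dvdPart p (a i)) = if p ∣ a i then κ (a i) else 1 := fun i => by
      split_ifs with h
      · rw [dvdPart_of_dvd h]
      · rw [dvdPart_of_not_dvd h, map_one]
    rw [Finset.prod_congr rfl fun i _ => h1 i, ← Finset.prod_filter, ← Finset.prod_subtype_eq_prod_filter, Finset.subtype_univ, map_prod,
      ← pow_mul, mul_comm k 2, ← hcard, ← Finset.card_univ, ← Finset.prod_const,
      ← Finset.prod_mul_distrib]
    exact Finset.prod_congr rfl fun i _ => by rw [(hc i i.2).1, map_mul κ, mul_comm]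
  rw [hpr, ← mul_assoc] at hsq
  have h1 : LocSq v (κ ((-1) ^ k * ∏ i : {i // p ∣ a i}, c i)) := by
    rw [map_mul κ, map_pow, map_neg, map_one]
    exact hsq.of_mul_sq
  have hm : ((-1 : E[X]) ^ k) ^ 2 = 1 := by rw [← pow_mul, mul_comm, pow_mul]; simp
  have hnd : ¬ p ∣ (-1) ^ k * ∏ i : {i // p ∣ a i}, c i := fun hd => by
    have h2 : p ∣ ∏ i : {i // p ∣ a i}, c i := by
      have := hd.mul_left ((-1) ^ k)
      rwa [← mul_assoc, ← pow_two, hm, one_mul] at this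
    obtain ⟨i, _, hi⟩ := (hp.dvd_finsetProd_iff _).mp h2
    exact (hc i i.2).2 hi
  obtain ⟨s, hs⟩ := hv.exists_of_locSq hnd h1
  refine exists_local_lattice h2 hp a c k hc hcard hk1 (s := s) ?_
  have := hs.mul_left ((-1) ^ k)
  rwa [mul_sub, ← mul_assoc, ← pow_two, hm, one_mul] at this

theorem exists_totally_isotropic_of_locallySplit (h2 : (2 : E) ≠ 0) (hE : TernaryIsotropic E)
    {a : ι → E[X]} (ha : ∀ i, Squarefree (a i)) {m : ℕ} (hcard : Fintype.card ι = 2 * m)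
    {s : E[X]} (hprod : ∏ i, a i = (-1) ^ m * s ^ 2)
    (hloc : ∀ p v, PlaceAt v p → (∃ i, p ∣ a i) → LocallySplit p v a) :
    ∃ j : (Fin m → E[X]) →ₗ[E[X]] (ι → E[X]), Function.Injective j ∧
      ∀ u w, diagForm a (j u) (j w) = 0 :=
  exists_totally_isotropic h2 hE ha hcard hprod fun p hp hi => by
    obtain ⟨v, _, hv⟩ := exists_placeAt hp
    exact (hloc p v hv hi).exists_lattice h2 hv ha

/-- The prime factors of an appended form `⟨-f, -g, fg⟩` are the ones of `f` and `g`. -/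
theorem exists_totally_isotropic_append (h2 : (2 : E) ≠ 0) (hE : TernaryIsotropic E) {n m : ℕ}
    {a : Fin n → E[X]} (ha : ∀ i, Squarefree (a i)) (hn : n + 3 = 2 * m) {s f g h : E[X]}
    (hprod : ∏ i, a i = (-1) ^ m * s ^ 2) (hf : Squarefree f) (hg : Squarefree g)
    (hfg : IsCoprime f g) (haf : ∀ p i, Prime p → p ∣ a i → p ∣ f) (hh : g ∣ f - h ^ 2)
    (hloc : ∀ p v, PlaceAt v p → p ∣ f →
      ∃ k, ∑ i, dvdInd p (a i) = 2 * k ∧ (k = 0 ∨ TernaryMod p) ∧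
        LocSq v ((-1) ^ k * (∏ i, κ (dvdPart p (a i))) * κ g)) :
    ∃ j : (Fin m → E[X]) →ₗ[E[X]] (Fin n ⊕ Fin 3 → E[X]), Function.Injective j ∧
      ∀ u w, diagForm (Sum.elim a ![-f, -g, f * g]) (j u) (j w) = 0 := by
  have hf0 := hf.ne_zero
  have hg0 := hg.ne_zero
  have hsf : ∀ i, Squarefree (Sum.elim a ![-f, -g, f * g] i) := by
    rintro (i | i)
    · exact ha i
    · fin_cases i
      · exact (Associated.neg_left (Associated.refl f)).squarefree_iff.mpr hf
      · exact (Associated.neg_left (Associated.refl g)).squarefree_iff.mpr hg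
      · exact squarefree_mul_of_isCoprime hfg hf hg
  refine exists_totally_isotropic_of_locallySplit h2 hE hsf (s := s * (f * g)) (by simp [hn]) ?_ ?_
  · rw [Fintype.prod_sum_type, Fin.prod_univ_three]
    simp only [Sum.elim_inl, Sum.elim_inr, Matrix.cons_val]
    rw [hprod]; ring
  · intro p v hv hi
    have hp := hv.prime
    have hpfg : p ∣ f * g := by
      obtain ⟨i | i, hi⟩ := hi
      · exact (haf p i hp hi).mul_right g
      · fin_cases i
        · exact ((dvd_neg (α := E[X])).mp hi).mul_right g
        · exact ((dvd_neg (α := E[X])).mp hi).mul_left f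
        · exact hi
    have hf1 := κ_ne_zero hf0
    have hg1 := κ_ne_zero hg0
    by_cases hpf : p ∣ f
    · have hpg : ¬ p ∣ g := not_dvd_of_isCoprime hp hfg hpf
      obtain ⟨k, hk, hk1, hsq⟩ := hloc p v hv hpf
      refine ⟨k + 1, ?_, ?_, ?_⟩
      · rw [Fintype.sum_sum_type, Fin.sum_univ_three]
        simp only [Sum.elim_inl, Sum.elim_inr, Matrix.cons_val, dvdInd_neg, dvdInd_of_dvd hpf,
          dvdInd_of_not_dvd hpg, dvdInd_of_dvd (hpf.mul_right g), hk]
        ring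
      · exact hk1.imp_left fun h => by omega
      · rw [Fintype.prod_sum_type, Fin.prod_univ_three]
        have := hsq.mul_sq hf1
        convert this using 1
        simp only [Sum.elim_inl, Sum.elim_inr, Matrix.cons_val,
          dvdPart_of_dvd ((dvd_neg (α := E[X])).mpr hpf),
          dvdPart_of_not_dvd (fun h => hpg ((dvd_neg (α := E[X])).mp h)),
          dvdPart_of_dvd (hpf.mul_right g), map_neg, map_mul κ, map_one]
        ring
    · have hpg : p ∣ g := (hp.dvd_or_dvd hpfg).resolve_left hpf
      have hpa : ∀ i, ¬ p ∣ a i := fun i hi => hpf (haf p i hp hi)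
      refine ⟨1, ?_, Or.inl le_rfl, ?_⟩
      · rw [Fintype.sum_sum_type, Fin.sum_univ_three]
        simp only [Sum.elim_inl, Sum.elim_inr, Matrix.cons_val, dvdInd_neg, dvdInd_of_dvd hpg,
          dvdInd_of_not_dvd hpf, dvdInd_of_dvd (hpg.mul_left f), dvdInd_of_not_dvd (hpa _),
          Finset.sum_const_zero]
        rfl
      · rw [Fintype.prod_sum_type, Fin.prod_univ_three]
        have := (hv.locSq hpf (hpg.trans hh)).mul_sq hg1
        convert this using 1
        simp only [Sum.elim_inl, Sum.elim_inr, Matrix.cons_val,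
          dvdPart_of_dvd ((dvd_neg (α := E[X])).mpr hpg),
          dvdPart_of_not_dvd (fun h => hpf ((dvd_neg (α := E[X])).mp h)),
          dvdPart_of_dvd (hpg.mul_left f), dvdPart_of_not_dvd (hpa _), Finset.prod_const_one,
          map_neg, map_mul κ, map_one]
        ring

end LocalToGlobal

end SquareReflexive

namespace SquareReflexive

section Reflexive

variable {E : Type*} [Field E]

/-- A polynomial reformulation of square-reflexivity of `f`. -/
def Reflexive (f : E[X]) : Prop :=
  ∀ α, IsCoprime f α →
    (Odd f.natDegree ∨ ∃ u, u ≠ 0 ∧ (nm f α = u ^ 2 ∨ nm f α = f.leadingCoeff * u ^ 2)) →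
    ∃ g, Squarefree g ∧ IsCoprime f g ∧ (∃ s, f ∣ α * g - s ^ 2) ∧ ∃ h, g ∣ f - h ^ 2

theorem exists_of_norm_of_isSquareReflexive {f : E[X]} (H : IsSquareReflexive f) {α : E[X]}
    (hα : IsCoprime f α)
    (hN : ∃ u, u ≠ 0 ∧ (nm f α = u ^ 2 ∨ nm f α = f.leadingCoeff * u ^ 2)) :
    ∃ g, Squarefree g ∧ IsCoprime f g ∧ (∃ s, f ∣ α * g - s ^ 2) ∧ ∃ h, g ∣ f - h ^ 2 := by
  obtain ⟨u, hu, hN⟩ := hN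
  obtain ⟨a, ha⟩ := isUnit_mk_of_isCoprime hα
  obtain ⟨g, hfg, ⟨β, hβ⟩, hsq⟩ := H.2 a ⟨Units.mk0 u hu, by rw [ha]; exact hN⟩
  by_cases hg : g = 0
  · rw [hg, isCoprime_zero_right] at hfg
    exact ⟨1, squarefree_one, isCoprime_one_right, ⟨0, hfg.dvd⟩, 0, one_dvd _⟩
  obtain ⟨b, w, hb, hw, e⟩ := exists_squarefree_mul_sq hg
  have hbg : b ∣ g := ⟨_, e⟩
  have hfw : IsCoprime f w := hfg.of_isCoprime_of_dvd_right (by rw [e, pow_two]; exact ⟨b * w, by ring⟩)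
  refine ⟨b, hb, hfg.of_isCoprime_of_dvd_right hbg, ?_, ?_⟩
  · obtain ⟨r, t, hrt⟩ := hfw
    obtain ⟨β', hβ'⟩ := Ideal.Quotient.mk_surjective (β : E[X] ⧸ Ideal.span {f})
    refine ⟨α * β' * t, ?_⟩
    rw [ha, ← hβ', ← map_pow, ← map_mul, Ideal.Quotient.eq, Ideal.mem_span_singleton] at hβ
    have h1 : f ∣ 1 - t * w := ⟨r, by linear_combination -hrt⟩
    have h2 : α * b - (α * β' * t) ^ 2 =
        (1 - t * w) * ((1 + t * w) * (α * b)) + (g - α * β' ^ 2) * (α * t ^ 2) := by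
      rw [e]; ring
    rw [h2]
    exact dvd_add (h1.mul_right _) (hβ.mul_right _)
  · obtain ⟨h, hh⟩ := hsq
    obtain ⟨h, rfl⟩ := Ideal.Quotient.mk_surjective h
    rw [← map_mul, Ideal.Quotient.eq, Ideal.mem_span_singleton] at hh
    exact ⟨h, hbg.trans (by rwa [pow_two])⟩

theorem reflexive_of_isSquareReflexive {f : E[X]} (H : IsSquareReflexive f) : Reflexive f := by
  intro α hα hN
  rcases hN with hodd | hN
  swap
  · exact exists_of_norm_of_isSquareReflexive H hα hN
  have hf := H.1.ne_zero
  have hn := nm_ne_zero hf hα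
  have hunit : IsUnit (C (nm f α)) := isUnit_C.mpr hn.isUnit
  obtain ⟨k, hk⟩ := hodd
  obtain ⟨g, hg, hfg, ⟨s, hs⟩, h, hh⟩ := exists_of_norm_of_isSquareReflexive H
    ((isCoprime_mul_unit_left_right hunit f α).mpr hα)
    ⟨nm f α ^ (k + 1), pow_ne_zero _ hn, Or.inl (by
      rw [nm_mul, nm_C hf, hk]; ring)⟩
  refine ⟨C (nm f α) * g, squarefree_C_mul hn hg,
    (isCoprime_mul_unit_left_right hunit f g).mpr hfg, ⟨s, ?_⟩, h, hunit.mul_left_dvd.mpr hh⟩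
  convert hs using 1
  ring

end Reflexive

end SquareReflexive

namespace SquareReflexive

section BaseField

variable {E : Type*} [Field E]

/-- At the simple root `ρ` of `(X - ρ) * f₁`, the polynomial `g` has square class `β`. -/
def RootClass (f₁ : E[X]) (ρ β : E) (g : E[X]) : Prop :=
  (g.eval ρ ≠ 0 ∧ IsSquare (β * g.eval ρ)) ∨
    ∃ u, g = (X - C ρ) * u ∧ u.eval ρ ≠ 0 ∧ IsSquare (-(β * u.eval ρ * f₁.eval ρ))

theorem isSquare_of_mul_sq {a b s : E} (hs : s ≠ 0) (h : a * b = s ^ 2) {c : E}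
    (ha : IsSquare (c * a)) : IsSquare (c * b) := by
  have ha0 : a ≠ 0 := left_ne_zero_of_mul (h ▸ pow_ne_zero 2 hs)
  obtain ⟨t, ht⟩ := ha
  exact ⟨t * s / a, by field_simp; linear_combination c * a * h + s ^ 2 * ht⟩

theorem RootClass.descend {f₁ : E[X]} {ρ β : E} (hf₁ : f₁.eval ρ ≠ 0) {g g' h : E[X]}
    (hg : RootClass f₁ ρ β g) (e : g * g' = h ^ 2 - (X - C ρ) * f₁) : RootClass f₁ ρ β g' := by
  have key : ∀ {a b h₁ : E[X]}, h = (X - C ρ) * h₁ → (X - C ρ) * (a * b) = g * g' →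
      a.eval ρ * b.eval ρ = -f₁.eval ρ := by
    intro a b h₁ hh hab
    have h1 : a * b = (X - C ρ) * h₁ ^ 2 - f₁ := by
      apply mul_left_cancel₀ (X_sub_C_ne_zero ρ)
      rw [hab, e, hh]; ring
    have := congrArg (eval ρ) h1
    simpa using this
  have e0 : g.eval ρ * g'.eval ρ = h.eval ρ ^ 2 := by
    have := congrArg (eval ρ) e
    simpa using this
  have hroot : h.eval ρ = 0 → ∃ h₁, h = (X - C ρ) * h₁ := fun h0 => dvd_iff_isRoot.mpr h0
  rcases hg with ⟨hg0, hsq⟩ | ⟨u, hu, hu0, hsq⟩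
  · by_cases hg' : g'.eval ρ = 0
    · right
      obtain ⟨u', hu'⟩ := dvd_iff_isRoot.mpr hg'
      obtain ⟨h₁, hh₁⟩ := hroot (by simpa [hg'] using e0.symm)
      have h1 := key (a := g) (b := u') hh₁ (by rw [hu']; ring)
      have hu0 : u'.eval ρ ≠ 0 := by
        intro h0; rw [h0, mul_zero] at h1; exact hf₁ (by simpa using h1.symm)
      refine ⟨u', hu', hu0, ?_⟩
      have := isSquare_of_mul_sq (a := g.eval ρ) (b := -(u'.eval ρ * f₁.eval ρ)) hf₁
        (by linear_combination -f₁.eval ρ * h1) hsq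
      convert this using 1; ring
    · left
      have hh : h.eval ρ ≠ 0 := by
        intro h0; rw [h0] at e0; exact mul_ne_zero hg0 hg' (by simpa using e0)
      exact ⟨hg', isSquare_of_mul_sq hh e0 hsq⟩
  · left
    have hg0 : g.eval ρ = 0 := by simp [hu]
    obtain ⟨h₁, hh₁⟩ := hroot (by simpa [hg0] using e0.symm)
    have h1 := key (a := u) (b := g') hh₁ (by rw [hu]; ring)
    have hg' : g'.eval ρ ≠ 0 := by
      intro h0; rw [h0, mul_zero] at h1; exact hf₁ (by simpa using h1.symm)
    refine ⟨hg', isSquare_of_mul_sq (a := -(u.eval ρ * f₁.eval ρ)) hf₁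
      (by linear_combination -f₁.eval ρ * h1) (by convert hsq using 1; ring)⟩

/-- Reduction of a divisor of `h ^ 2 - f` to a divisor of degree at most one. -/
theorem exists_reduced_divisor {f : E[X]} (hf : f.natDegree = 3) {P : E[X] → Prop}
    (hP : ∀ g g' h, P g → g * g' = h ^ 2 - f → P g') {g : E[X]} (hg : P g)
    (hsq : ∃ h, g ∣ f - h ^ 2) :
    ∃ g, P g ∧ g ≠ 0 ∧ g.natDegree ≤ 1 ∧ ∃ h, g ∣ f - h ^ 2 := by
  have hne : ∀ h : E[X], h ^ 2 - f ≠ 0 := by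
    intro h h0
    have h1 := congrArg natDegree (sub_eq_zero.mp h0)
    rw [natDegree_pow, hf] at h1
    omega
  induction hn : g.natDegree using Nat.strong_induction_on generalizing g with
  | _ n ih =>
    obtain ⟨h, hh⟩ := hsq
    have hg0 : g ≠ 0 := by
      rintro rfl
      exact hne h (by rw [← neg_sub, zero_dvd_iff.mp hh, neg_zero])
    by_cases hn1 : g.natDegree ≤ 1
    · exact ⟨g, hg, hg0, hn1, h, hh⟩
    have hdiv : g ∣ (h % g) ^ 2 - f := by
      have h2 : (h % g) ^ 2 - f =
          -(f - h ^ 2) - g * ((h / g) * (h + h % g)) := by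
        have := EuclideanDomain.div_add_mod h g
        linear_combination (h + h % g) * this
      rw [h2]
      exact dvd_sub ((dvd_neg (α := E[X])).mpr hh) (dvd_mul_right _ _)
    obtain ⟨g', hg'⟩ := hdiv
    have hlt : (h % g).natDegree < g.natDegree := natDegree_mod_lt h (by omega)
    have hdeg : g.natDegree + g'.natDegree = ((h % g) ^ 2 - f).natDegree := by
      rw [hg', natDegree_mul hg0]
      rintro rfl
      exact hne _ (by rw [hg', mul_zero])
    have hle : ((h % g) ^ 2 - f).natDegree ≤ max (2 * (h % g).natDegree) 3 := by
      refine (natDegree_sub_le _ _).trans ?_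
      rw [natDegree_pow, hf]
    refine ih g'.natDegree ?_ (hP g g' _ hg hg'.symm) ⟨h % g, ?_⟩ rfl
    · rcases le_max_iff.mp hle with h3 | h3 <;> omega
    · rw [← neg_sub, hg']
      exact (dvd_neg (α := E[X])).mpr (dvd_mul_left _ _)

end BaseField

end SquareReflexive

namespace SquareReflexive

section BaseFieldIsotropy

variable {E : Type*} [Field E]

theorem exists_isotropic_of_no_element (h2 : (2 : E) ≠ 0)
    (hE : ∀ r : E, r = 0 ∨ r = 1 ∨ r = -1) {e b : E} (he : e ≠ 0) (hb : b ≠ 0) :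
    ∃ x y z : E, (x ≠ 0 ∨ y ≠ 0 ∨ z ≠ 0) ∧ x ^ 2 = e * y ^ 2 + b * z ^ 2 := by
  rcases hE e with h | rfl | rfl
  · exact absurd h he
  · exact ⟨1, 1, 0, by simp, by ring⟩
  rcases hE b with h | rfl | rfl
  · exact absurd h hb
  · exact ⟨1, 0, 1, by simp, by ring⟩
  refine ⟨1, 1, 1, by simp, ?_⟩
  rcases hE 2 with h | h | h
  · exact absurd h h2
  · exact absurd (by linear_combination h) (one_ne_zero (α := E))
  · linear_combination h

theorem isCoprime_X_sub_C {ρ : E} {α : E[X]} (h : α.eval ρ ≠ 0) : IsCoprime (X - C ρ) α :=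
  (irreducible_X_sub_C ρ).coprime_iff_not_dvd.mpr fun h' => h (dvd_iff_isRoot.mp h')

theorem eval_ne_zero_of_isCoprime {ρ : E} {g : E[X]} (h : IsCoprime (X - C ρ) g) :
    g.eval ρ ≠ 0 := fun h' =>
  (irreducible_X_sub_C ρ).coprime_iff_not_dvd.mp h (dvd_iff_isRoot.mpr h')

theorem rootClass_of_dvd {f₁ α f g s : E[X]} {ρ : E} (hf : f = (X - C ρ) * f₁)
    (hfg : IsCoprime f g) (hs : f ∣ α * g - s ^ 2) : RootClass f₁ ρ (α.eval ρ) g := by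
  refine Or.inl ⟨eval_ne_zero_of_isCoprime (hfg.of_isCoprime_of_dvd_left ⟨f₁, hf⟩), s.eval ρ, ?_⟩
  obtain ⟨t, ht⟩ := hs
  have := congrArg (eval ρ) ht
  rw [hf] at this
  simp only [eval_sub, eval_mul, eval_pow, eval_X, eval_C, sub_self, zero_mul] at this
  linear_combination this

theorem rootClass_C {f₁ : E[X]} {ρ β l : E} (h : RootClass f₁ ρ β (C l)) : IsSquare (β * l) := by
  rcases h with ⟨-, h⟩ | ⟨u, hu, hu0, -⟩
  · simpa using h
  · have h1 := congrArg natDegree hu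
    rw [natDegree_C, natDegree_mul (X_sub_C_ne_zero ρ) (by rintro rfl; simp at hu0),
      natDegree_X_sub_C] at h1
    omega

theorem rootClass_linear_of_ne {f₁ : E[X]} {ρ σ β l : E} (hl : l ≠ 0) (hσ : σ ≠ ρ)
    (h : RootClass f₁ ρ β (C l * (X - C σ))) : IsSquare (β * (l * (ρ - σ))) := by
  rcases h with ⟨-, h⟩ | ⟨u, hu, hu0, -⟩
  · simpa using h
  · have h1 := congrArg (eval ρ) hu
    simp [hl, sub_eq_zero, hσ.symm] at h1

theorem rootClass_linear_self {f₁ : E[X]} {ρ β l : E}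
    (h : RootClass f₁ ρ β (C l * (X - C ρ))) : IsSquare (-(β * l * f₁.eval ρ)) := by
  rcases h with ⟨h, -⟩ | ⟨u, hu, hu0, h⟩
  · simp at h
  · have h1 : u = C l := by
      apply mul_left_cancel₀ (X_sub_C_ne_zero ρ)
      rw [← hu]; ring
    simpa [h1] using h

theorem eq_C_or_linear {g : E[X]} (hg : g ≠ 0) (h : g.natDegree ≤ 1) :
    ∃ l, l ≠ 0 ∧ (g = C l ∨ ∃ σ, g = C l * (X - C σ)) := by
  rcases Nat.le_one_iff_eq_zero_or_eq_one.mp h with h0 | h1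
  · obtain ⟨l, rfl⟩ := natDegree_eq_zero.mp h0
    exact ⟨l, by rintro rfl; simp at hg, Or.inl rfl⟩
  · obtain ⟨a, ha, b, rfl⟩ := natDegree_eq_one.mp h1
    refine ⟨a, ha, Or.inr ⟨-(b / a), ?_⟩⟩
    rw [C_neg, sub_neg_eq_add, mul_add, ← C_mul, mul_div_cancel₀ _ ha]

theorem exists_isotropic_of_reflexive (HR : ∀ f : E[X], Squarefree f → Reflexive f)
    {r : E} (hr0 : r ≠ 0) (hr1 : r ^ 2 ≠ 1) {e b : E} (he : e ≠ 0) (hb : b ≠ 0) :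
    ∃ x y z : E, (x ≠ 0 ∨ y ≠ 0 ∨ z ≠ 0) ∧ x ^ 2 = e * y ^ 2 + b * z ^ 2 := by
  have of_sq : IsSquare e →
      ∃ x y z : E, (x ≠ 0 ∨ y ≠ 0 ∨ z ≠ 0) ∧ x ^ 2 = e * y ^ 2 + b * z ^ 2 := by
    rintro ⟨s, hs⟩
    exact ⟨s, 1, 0, by simp, by rw [hs]; ring⟩
  set ρ := e * r ^ 2 with hρ
  have hρ0 : ρ ≠ 0 := mul_ne_zero he (pow_ne_zero 2 hr0)
  have hρe : ρ ≠ e := by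
    intro h; exact hr1 (mul_left_cancel₀ he (by rw [← hρ, h, mul_one]))
  set f₀ : E[X] := (X - C e) * (X - C ρ) with hf₀
  set f₁ : E[X] := (X - C 0) * (X - C ρ) with hf₁
  set f₂ : E[X] := (X - C 0) * (X - C e) with hf₂
  set f : E[X] := (X - C 0) * f₀ with hf
  have hf1 : f = (X - C e) * f₁ := by rw [hf, hf₀, hf₁]; ring
  have hf2 : f = (X - C ρ) * f₂ := by rw [hf, hf₀, hf₂]; ring
  have hv0 : f₀.eval 0 = e * ρ := by simp [hf₀]
  have hv1 : f₁.eval e = e * (e - ρ) := by simp [hf₁]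
  have hv2 : f₂.eval ρ = ρ * (ρ - e) := by simp [hf₂]
  have hdeg : f.natDegree = 3 := by
    rw [hf, hf₀, natDegree_mul (X_sub_C_ne_zero _)
      (mul_ne_zero (X_sub_C_ne_zero _) (X_sub_C_ne_zero _)),
      natDegree_mul (X_sub_C_ne_zero _) (X_sub_C_ne_zero _)]
    simp only [natDegree_X_sub_C]
  have hsf : Squarefree f := by
    refine squarefree_mul_of_isCoprime ?_ (irreducible_X_sub_C 0).squarefree
      (squarefree_mul_of_isCoprime ?_ (irreducible_X_sub_C e).squarefree
        (irreducible_X_sub_C ρ).squarefree)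
    · exact isCoprime_X_sub_C (by rw [hv0]; exact mul_ne_zero he hρ0)
    · exact isCoprime_X_sub_C (by simpa [sub_eq_zero] using hρe.symm)
  set α : E[X] := 1 + C ((b - 1) / (e * ρ)) * f₀ with hα
  have ha0 : α.eval 0 = b := by
    simp only [hα, eval_add, eval_mul, eval_C, eval_one, hv0]; field_simp; ring
  have ha1 : α.eval e = 1 := by simp [hα, hf₀]
  have ha2 : α.eval ρ = 1 := by simp [hα, hf₀]
  have hfα : IsCoprime f α := by
    refine (isCoprime_X_sub_C (by rwa [ha0])).mul_left
      ((isCoprime_X_sub_C (by simp [ha1])).mul_left (isCoprime_X_sub_C (by simp [ha2])))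
  obtain ⟨g, -, hfg, ⟨s, hs⟩, hh⟩ := HR f hsf α hfα (Or.inl (by rw [hdeg]; decide))
  obtain ⟨g, ⟨c0, c1, c2⟩, hg0, hgd, h, hh⟩ := exists_reduced_divisor hdeg
    (P := fun g => RootClass f₀ 0 b g ∧ RootClass f₁ e 1 g ∧ RootClass f₂ ρ 1 g)
    (fun g g' h hg e' => ⟨hg.1.descend (by rw [hv0]; exact mul_ne_zero he hρ0) e',
      hg.2.1.descend (by rw [hv1]; exact mul_ne_zero he (sub_ne_zero.mpr hρe.symm))
        (by rw [e', hf1]),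
      hg.2.2.descend (by rw [hv2]; exact mul_ne_zero hρ0 (sub_ne_zero.mpr hρe))
        (by rw [e', hf2])⟩)
    (g := g) ⟨ha0 ▸ rootClass_of_dvd hf hfg hs, ha1 ▸ rootClass_of_dvd hf1 hfg hs,
      ha2 ▸ rootClass_of_dvd hf2 hfg hs⟩ hh
  obtain ⟨l, hl, rfl | ⟨σ, rfl⟩⟩ := eq_C_or_linear hg0 hgd
  · have h1 := rootClass_C c1
    rw [one_mul] at h1
    obtain ⟨t, ht⟩ := isSquare_of_mul_left h1 hl (by rw [mul_comm]; exact rootClass_C c0)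
    exact ⟨t, 0, 1, by simp, by rw [ht]; ring⟩
  by_cases h0 : σ = 0
  · subst h0
    have s0 := rootClass_linear_self c0
    have s1 := rootClass_linear_of_ne hl he.symm c1
    rw [one_mul, sub_zero] at s1
    rw [hv0] at s0
    obtain ⟨t, ht⟩ := isSquare_of_mul_left s1 (mul_ne_zero hl he)
      (b := -(b * e)) (by
        obtain ⟨w, hw⟩ := s0
        refine ⟨w / r, ?_⟩
        have : w / r * (w / r) = w * w / r ^ 2 := by field_simp
        rw [this, ← hw, hρ]
        field_simp)
    exact ⟨0, t, e, by simp [he], by linear_combination e * ht⟩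
  by_cases h1 : σ = e
  · subst h1
    have s1 := rootClass_linear_self c1
    have s2 := rootClass_linear_of_ne hl hρe.symm c2
    rw [one_mul] at s1 s2
    apply of_sq
    refine isSquare_of_mul_left s2 (mul_ne_zero hl (sub_ne_zero.mpr hρe)) ?_
    convert s1 using 1
    rw [hv1]; ring
  by_cases h3 : σ = ρ
  · have s2 := rootClass_linear_self (h3 ▸ c2)
    have s1 := rootClass_linear_of_ne hl (h3 ▸ hρe) c1
    rw [one_mul] at s1 s2
    rw [h3] at s1
    apply of_sq
    refine isSquare_of_mul_left s1 (mul_ne_zero hl (sub_ne_zero.mpr hρe.symm)) ?_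
    rw [hv2] at s2
    obtain ⟨w, hw⟩ := s2
    refine ⟨w / r, ?_⟩
    have : w / r * (w / r) = w * w / r ^ 2 := by field_simp
    rw [this, ← hw, hρ]
    field_simp
    ring
  have s0 := rootClass_linear_of_ne hl h0 c0
  have s1 := rootClass_linear_of_ne hl h1 c1
  have s2 := rootClass_linear_of_ne hl h3 c2
  rw [one_mul] at s1 s2
  have s3 : IsSquare (σ * ((σ - e) * (σ - ρ))) := by
    obtain ⟨t, ht⟩ := hh
    refine ⟨h.eval σ, ?_⟩
    have := congrArg (eval σ) ht
    simp only [hf, hf₀, eval_sub, eval_mul, eval_pow, eval_X, eval_C, sub_self, zero_mul,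
      mul_zero, sub_zero] at this
    linear_combination this
  have hσe : e - σ ≠ 0 := sub_ne_zero.mpr (Ne.symm h1)
  have hσρ : ρ - σ ≠ 0 := sub_ne_zero.mpr (Ne.symm h3)
  have s4 : IsSquare σ := by
    refine isSquare_of_mul_left (s1.mul s2) (mul_ne_zero (mul_ne_zero hl hσe)
      (mul_ne_zero hl hσρ)) ?_
    rw [show l * (e - σ) * (l * (ρ - σ)) * σ = σ * ((σ - e) * (σ - ρ)) * (l * l) by ring]
    exact s3.mul ⟨l, rfl⟩
  have s5 : IsSquare (-(b * (e - σ))) := by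
    refine isSquare_of_mul_left (s4.mul s1) (mul_ne_zero h0 (mul_ne_zero hl hσe)) ?_
    rw [show σ * (l * (e - σ)) * -(b * (e - σ)) =
      b * (l * (0 - σ)) * ((e - σ) * (e - σ)) by ring]
    exact s0.mul ⟨e - σ, rfl⟩
  obtain ⟨τ, hτ⟩ := s4
  obtain ⟨w, hw⟩ := s5
  exact ⟨b * τ, b, w, by simp [hb], by linear_combination (-b ^ 2) * hτ + b * hw⟩

theorem ternaryIsotropic_of_reflexive (h2 : (2 : E) ≠ 0)
    (HR : ∀ f : E[X], Squarefree f → Reflexive f) : TernaryIsotropic E := by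
  intro a b c ha hb hc
  have he : -(a * b) ≠ 0 := neg_ne_zero.mpr (mul_ne_zero ha hb)
  have hb' : -(a * c) ≠ 0 := neg_ne_zero.mpr (mul_ne_zero ha hc)
  obtain ⟨x, y, z, hne, h⟩ : ∃ x y z : E, (x ≠ 0 ∨ y ≠ 0 ∨ z ≠ 0) ∧
      x ^ 2 = -(a * b) * y ^ 2 + -(a * c) * z ^ 2 := by
    by_cases hE : ∀ r : E, r = 0 ∨ r = 1 ∨ r = -1
    · exact exists_isotropic_of_no_element h2 hE he hb'
    · push Not at hE
      obtain ⟨r, hr0, hr1, hr2⟩ := hE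
      exact exists_isotropic_of_reflexive HR hr0
        (fun h => (sq_eq_one_iff.mp h).elim hr1 hr2) he hb'
  refine ⟨![x / a, y, z], ?_, ?_⟩
  · intro h0
    have e0 := congrFun h0 0
    have e1 := congrFun h0 1
    have e2 := congrFun h0 2
    simp [ha] at e0 e1 e2
    simp [e0, e1, e2] at hne
  · simp only [Matrix.cons_val]
    field_simp
    linear_combination h

end BaseFieldIsotropy

end SquareReflexive

namespace SquareReflexive

open WithZero

section Approximation

variable {E : Type*} [Field E]

local notation "κ" => algebraMap (Polynomial E) (RatFunc E)

theorem dvdInd_congr {p q : E[X]} (h : Associated p q) (f : E[X]) : dvdInd p f = dvdInd q f := by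
  by_cases hp : p ∣ f
  · rw [dvdInd_of_dvd hp, dvdInd_of_dvd (h.dvd_iff_dvd_left.mp hp)]
  · rw [dvdInd_of_not_dvd hp, dvdInd_of_not_dvd (h.dvd_iff_dvd_left.not.mp hp)]

theorem dvdPart_congr {p q : E[X]} (h : Associated p q) (f : E[X]) : dvdPart p f = dvdPart q f := by
  by_cases hp : p ∣ f
  · rw [dvdPart_of_dvd hp, dvdPart_of_dvd (h.dvd_iff_dvd_left.mp hp)]
  · rw [dvdPart_of_not_dvd hp, dvdPart_of_not_dvd (h.dvd_iff_dvd_left.not.mp hp)]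

theorem PlaceAt.congr {v : Valuation (RatFunc E) ℤᵐ⁰} {p q : E[X]} (hv : PlaceAt v p)
    (h : Associated p q) : PlaceAt v q :=
  ⟨h.prime hv.prime, hv.le_one, fun f => by rw [hv.lt_one, h.dvd_iff_dvd_left], hv.surj⟩

theorem PlaceAt.ev_prod_iff {v : Valuation (RatFunc E) ℤᵐ⁰} {p : E[X]} (hv : PlaceAt v p)
    {ι : Type*} {a : ι → E[X]} (ha : ∀ i, Squarefree (a i)) (S : Finset ι) :
    Ev v (κ (∏ i ∈ S, a i)) ↔ Even (∑ i ∈ S, dvdInd p (a i)) := by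
  classical
  induction S using Finset.induction_on with
  | empty => simpa using ev_one
  | insert i S hi ih =>
    rw [Finset.prod_insert hi, Finset.sum_insert hi, map_mul κ,
      ev_mul (κ_ne_zero (ha i).ne_zero)
        (κ_ne_zero (Finset.prod_ne_zero_iff.mpr fun j _ => (ha j).ne_zero)), ih, Nat.even_add,
      hv.ev_iff (ha i)]
    by_cases h : p ∣ a i
    · simp [h, dvdInd_of_dvd]
    · simp [h, dvdInd_of_not_dvd]

theorem PlaceAt.even_sum_dvdInd {v : Valuation (RatFunc E) ℤᵐ⁰} {p : E[X]} (hv : PlaceAt v p)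
    {ι : Type*} [Fintype ι] {a : ι → E[X]} (ha : ∀ i, Squarefree (a i)) {m : ℕ} {s : E[X]}
    (hprod : ∏ i, a i = (-1) ^ m * s ^ 2) : Even (∑ i, dvdInd p (a i)) := by
  rw [← hv.ev_prod_iff ha, hprod]
  rw [map_mul κ, map_pow κ, map_pow κ, map_neg κ, map_one κ]
  rcases neg_one_pow_eq_or (RatFunc E) m with h | h
  · rw [h, one_mul]; exact ev_sq _
  · rw [h, neg_one_mul, ev_neg]; exact ev_sq _

/-- An auxiliary polynomial with prescribed residues of square classes at the primes
dividing `P`. -/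
theorem exists_residues {ι : Type*} [Fintype ι] {a : ι → E[X]} (ha : ∀ i, Squarefree (a i))
    {m : ℕ} {s : E[X]} (hprod : ∏ i, a i = (-1) ^ m * s ^ 2) {P : E[X]} (hP : Squarefree P) :
    ∃ α, IsCoprime P α ∧ ∀ p v, PlaceAt v p → p ∣ P →
      ∃ k, ∑ i, dvdInd p (a i) = 2 * k ∧
        LocSq v ((-1) ^ k * (∏ i, κ (dvdPart p (a i))) * κ α) := by
  suffices H : ∃ α, ∀ p, Prime p → p ∣ P → ¬ p ∣ α ∧ ∀ v, PlaceAt v p →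
      ∃ k, ∑ i, dvdInd p (a i) = 2 * k ∧
        LocSq v ((-1) ^ k * (∏ i, κ (dvdPart p (a i))) * κ α) by
    obtain ⟨α, hα⟩ := H
    exact ⟨α, isCoprime_of_forall_prime hP.ne_zero fun p hp hpP => (hα p hp hpP).1,
      fun p v hv hpP => (hα p hv.prime hpP).2 v hv⟩
  refine exists_forall_prime hP (fun p x => ¬ p ∣ x ∧ ∀ v, PlaceAt v p →
    ∃ k, ∑ i, dvdInd p (a i) = 2 * k ∧
      LocSq v ((-1) ^ k * (∏ i, κ (dvdPart p (a i))) * κ x)) ?_ ?_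
  · rintro p q x y hpq hxy ⟨hx, h⟩
    have hy : ¬ p ∣ y := fun h' => hx (by simpa using dvd_add hxy h')
    refine ⟨hpq.dvd_iff_dvd_left.not.mp hy, fun v hv => ?_⟩
    have hv' := hv.congr hpq.symm
    obtain ⟨k, hk, hsq⟩ := h v hv'
    refine ⟨k, by simpa only [dvdInd_congr hpq] using hk, ?_⟩
    simp only [dvdPart_congr hpq] at hsq
    have hxy' : LocSq v (κ (x * y)) := hv'.locSq (k := x)
      (hv'.prime.not_dvd_mul hx hy) (by
        rw [show x * y - x ^ 2 = -(x * (x - y)) by ring]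
        exact (dvd_neg (α := E[X])).mpr (hxy.mul_left _))
    rw [map_mul κ] at hxy'
    refine LocSq.of_mul_sq (s := κ x) ?_
    convert hsq.mul hxy' using 1
    ring
  · intro p hp hpP
    have hc : ∀ i, ∃ c, p ^ dvdInd p (a i) * c = dvdPart p (a i) ∧ ¬ p ∣ c := by
      intro i
      by_cases h : p ∣ a i
      · obtain ⟨c, hc⟩ := h
        refine ⟨c, by rw [dvdInd_of_dvd ⟨c, hc⟩, dvdPart_of_dvd ⟨c, hc⟩, hc, pow_one], ?_⟩
        exact not_dvd_of_squarefree_mul hp (hc ▸ ha i) dvd_rfl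
      · exact ⟨1, by rw [dvdInd_of_not_dvd h, dvdPart_of_not_dvd h]; simp,
          fun h' => hp.not_isUnit (isUnit_of_dvd_one h')⟩
    choose c hc hpc using hc
    obtain ⟨v₀, -, hv₀⟩ := exists_placeAt hp
    obtain ⟨k, hk⟩ := hv₀.even_sum_dvdInd ha hprod
    rw [← two_mul] at hk
    have hpc' : ¬ p ∣ ∏ i, c i := by
      rw [hp.dvd_finsetProd_iff]
      rintro ⟨i, -, h⟩
      exact hpc i h
    have hpx : ¬ p ∣ (-1) ^ k * ∏ i, c i := by
      rcases neg_one_pow_eq_or E[X] k with h | h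
      · rwa [h, one_mul]
      · rwa [h, neg_one_mul, dvd_neg]
    refine ⟨(-1) ^ k * ∏ i, c i, hpx, fun v hv => ⟨k, hk, ?_⟩⟩
    have e : ∏ i, κ (dvdPart p (a i)) = κ (p ^ k) ^ 2 * κ (∏ i, c i) := by
      rw [← map_prod κ, ← map_pow κ, ← map_mul κ]
      congr 1
      rw [← pow_mul, mul_comm k, ← hk, ← Finset.prod_pow_eq_pow_sum, ← Finset.prod_mul_distrib]
      exact Finset.prod_congr rfl fun i _ => (hc i).symm
    have e2 : (-1) ^ k * (∏ i, κ (dvdPart p (a i))) * κ ((-1) ^ k * ∏ i, c i) =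
        κ (p ^ k * ((-1) ^ k * ∏ i, c i)) ^ 2 := by
      rw [e]
      simp only [map_mul κ, map_pow κ, map_neg κ, map_one κ]
      ring
    rw [e2]
    exact locSq_sq (κ_ne_zero (mul_ne_zero (pow_ne_zero _ hp.ne_zero)
      (fun h => hpx (by rw [h]; exact dvd_zero _))))

theorem exists_totally_isotropic_of_reflexive (h2 : (2 : E) ≠ 0) (hE : TernaryIsotropic E)
    (HR : ∀ f : E[X], Squarefree f → Reflexive f) {n m : ℕ} {a : Fin n → E[X]}
    (ha : ∀ i, Squarefree (a i)) (hn : n + 3 = 2 * m) {s P : E[X]}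
    (hprod : ∏ i, a i = (-1) ^ m * s ^ 2) (hP : Squarefree P)
    (haP : ∀ p i, Prime p → p ∣ a i → p ∣ P)
    (hU : ∀ p i, Prime p → p ∣ a i → TernaryMod p) :
    ∃ c g h, c ≠ 0 ∧ Squarefree g ∧ IsCoprime P g ∧ g ∣ C c * P - h ^ 2 ∧
      ∃ j : (Fin m → E[X]) →ₗ[E[X]] (Fin n ⊕ Fin 3 → E[X]), Function.Injective j ∧
        ∀ u w, diagForm (Sum.elim a ![-(C c * P), -g, C c * P * g]) (j u) (j w) = 0 := by
  obtain ⟨α, hPα, hα⟩ := exists_residues ha hprod hP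
  have hN := nm_ne_zero hP.ne_zero hPα
  have hlc : P.leadingCoeff ≠ 0 := leadingCoeff_ne_zero.mpr hP.ne_zero
  set c := nm P α / P.leadingCoeff with hc
  have hc0 : c ≠ 0 := div_ne_zero hN hlc
  have hu : IsUnit (C c) := isUnit_C.mpr hc0.isUnit
  have hf : Squarefree (C c * P) := squarefree_C_mul hc0 hP
  obtain ⟨g, hg, hfg, ⟨t, ht⟩, h, hh⟩ := HR (C c * P) hf α
    ((isCoprime_mul_unit_left_left hu P α).mpr hPα)
    (Or.inr ⟨1, one_ne_zero, Or.inr (by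
      rw [nm_mul_left (C_ne_zero.mpr hc0) hP.ne_zero, nm_C_left hc0, leadingCoeff_mul,
        leadingCoeff_C, hc]
      field_simp)⟩)
  have hPg := (isCoprime_mul_unit_left_left hu P g).mp hfg
  refine ⟨c, g, h, hc0, hg, hPg, hh, ?_⟩
  refine exists_totally_isotropic_append h2 hE ha hn hprod hf hg hfg
    (fun p i hp hpa => (haP p i hp hpa).mul_left _) hh fun p v hv hpf => ?_
  have hp := hv.prime
  have hpP : p ∣ P := (hp.dvd_or_dvd hpf).resolve_left (not_prime_dvd_C hc0 hp)
  obtain ⟨k, hk, hsq⟩ := hα p v hv hpP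
  refine ⟨k, hk, ?_, ?_⟩
  · by_cases hi : ∃ i, p ∣ a i
    · exact Or.inr (hU p hi.choose hp hi.choose_spec)
    · push Not at hi
      simp only [dvdInd_of_not_dvd (hi _), Finset.sum_const_zero] at hk
      exact Or.inl (by omega)
  · have hα' := not_dvd_of_isCoprime hp hPα hpP
    have hg' := not_dvd_of_isCoprime hp hPg hpP
    have h1 : LocSq v (κ (α * g)) := hv.locSq (hp.not_dvd_mul hα' hg') (hpf.trans ht)
    rw [map_mul κ] at h1
    refine LocSq.of_mul_sq (s := κ α) ?_
    convert hsq.mul h1 using 1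
    ring

end Approximation

end SquareReflexive

namespace SquareReflexive

section ResidueFields

variable {E : Type*} [Field E]

theorem exists_squarefree_support {f : E[X]} (hf : f ≠ 0) :
    ∃ Q, Squarefree Q ∧ Q ∣ f ∧ ∀ p, Prime p → p ∣ f → p ∣ Q := by
  classical
  exact ⟨UniqueFactorizationMonoid.radical f, UniqueFactorizationMonoid.squarefree_radical,
    UniqueFactorizationMonoid.radical_dvd_self, fun p hp h =>
    (UniqueFactorizationMonoid.dvd_radical_iff_of_irreducible hp.irreducible hf).mpr h⟩

theorem exists_primitive {p : E[X]} (hp : Prime p) {ι : Type*} {x : ι → E[X]} (hx : x ≠ 0) :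
    ∃ k y, x = p ^ k • y ∧ ∃ i, ¬ p ∣ y i := by
  obtain ⟨i, hi⟩ := Function.ne_iff.mp hx
  rw [Pi.zero_apply] at hi
  have hpd := natDegree_pos_of_not_isUnit hp.ne_zero hp.not_isUnit
  induction hn : (x i).natDegree using Nat.strong_induction_on generalizing x with
  | _ n ih =>
    by_cases h : ∃ i, ¬ p ∣ x i
    · exact ⟨0, x, by simp, h⟩
    push Not at h
    choose z hz using h
    have hzi : z i ≠ 0 := by
      intro h0; exact hi (by rw [hz, h0, mul_zero])
    obtain ⟨k, y, hy, hy'⟩ := ih (z i).natDegree (by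
      rw [← hn, hz, natDegree_mul hp.ne_zero hzi]; omega) (x := z)
      (fun h0 => hzi (congrFun h0 i)) hzi rfl
    refine ⟨k + 1, y, ?_, hy'⟩
    funext l
    rw [hz l, hy]
    simp only [Pi.smul_apply, smul_eq_mul]
    ring

/-- To solve ternary forms modulo `p` it suffices to treat forms `⟨a, b, -ab⟩` whose coefficients
have small degree. -/
theorem ternaryMod_of_forall_squarefree {p : E[X]} (hp : Prime p)
    (H : ∀ a b c t : E[X], Squarefree a → Squarefree b → Squarefree c →
      a.natDegree < p.natDegree → b.natDegree < p.natDegree → -(a * b) = c * t ^ 2 →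
      ∃ x y z, ¬ (p ∣ x ∧ p ∣ y ∧ p ∣ z) ∧ p ∣ a * x ^ 2 + b * y ^ 2 + c * z ^ 2) :
    TernaryMod p := by
  intro a b c ha hb hc
  have hpd := natDegree_pos_of_not_isUnit hp.ne_zero hp.not_isUnit
  have red : ∀ d : E[X], ¬ p ∣ d → ∃ d' w, Squarefree d' ∧ d'.natDegree < p.natDegree ∧
      ¬ p ∣ d' ∧ ¬ p ∣ w ∧ p ∣ d - d' * w ^ 2 := by
    intro d hd
    have hm : p ∣ d - d % p := ⟨d / p, by
      have := EuclideanDomain.div_add_mod d p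
      linear_combination -this⟩
    have hd' : ¬ p ∣ d % p := fun h => hd (by simpa using dvd_add hm h)
    have h0 : d % p ≠ 0 := by intro h; exact hd' (by rw [h]; exact dvd_zero _)
    obtain ⟨d', w, hsf, -, e⟩ := exists_squarefree_mul_sq h0
    refine ⟨d', w, hsf, (natDegree_le_of_eq_mul_sq h0 e).trans_lt (natDegree_mod_lt d hpd.ne'),
      fun h => hd' (by rw [e]; exact h.mul_right _),
      fun h => hd' (by rw [e, pow_two]; exact (h.mul_right _).mul_left _), by rwa [← e]⟩
  obtain ⟨a', u, ha', hda, hpa, hpu, hau⟩ := red (-(b * c))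
    (by rw [dvd_neg]; exact hp.not_dvd_mul hb hc)
  obtain ⟨b', w, hb', hdb, hpb, hpw, hbw⟩ := red (-(a * c))
    (by rw [dvd_neg]; exact hp.not_dvd_mul ha hc)
  obtain ⟨c', t, hc', -, ht⟩ := exists_squarefree_mul_sq
    (neg_ne_zero.mpr (mul_ne_zero ha'.ne_zero hb'.ne_zero))
  obtain ⟨x, y, z, hne, hd⟩ := H a' b' c' t ha' hb' hc' hda hdb ht
  have hpt : ¬ p ∣ t := by
    intro h
    have h1 : p ∣ -(a' * b') := by rw [ht, pow_two]; exact (h.mul_right _).mul_left _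
    rw [dvd_neg] at h1
    exact hp.not_dvd_mul hpa hpb h1
  refine ⟨b * c * (w * t * x), a * c * (u * t * y), a * b * c * z, ?_, ?_⟩
  · rintro ⟨h1, h2, h3⟩
    refine hne ⟨?_, ?_, ?_⟩
    · exact ((hp.dvd_or_dvd h1).resolve_left (hp.not_dvd_mul hb hc) |> hp.dvd_or_dvd).resolve_left
        (hp.not_dvd_mul hpw hpt)
    · exact ((hp.dvd_or_dvd h2).resolve_left (hp.not_dvd_mul ha hc) |> hp.dvd_or_dvd).resolve_left
        (hp.not_dvd_mul hpu hpt)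
    · exact (hp.dvd_or_dvd h3).resolve_left (hp.not_dvd_mul (hp.not_dvd_mul ha hb) hc)
  · obtain ⟨q, hq⟩ := hd
    obtain ⟨q₁, hq₁⟩ := hau
    obtain ⟨q₂, hq₂⟩ := hbw
    refine ⟨-(a * b * c) * (u ^ 2 * w ^ 2 * t ^ 2 * q + q₁ * (w * t * x) ^ 2
      + q₂ * (u * t * y) ^ 2 + (a * c * q₁ - a' * u ^ 2 * q₂) * z ^ 2), ?_⟩
    linear_combination a * b * c * (-(w * t * x) ^ 2 * hq₁ - (u * t * y) ^ 2 * hq₂ +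
      z ^ 2 * (-(a * c) * hq₁ + a' * u ^ 2 * hq₂) - u ^ 2 * w ^ 2 * t ^ 2 * hq -
      u ^ 2 * w ^ 2 * z ^ 2 * ht)

theorem ternaryMod_of_reflexive (h2 : (2 : E) ≠ 0) (hE : TernaryIsotropic E)
    (HR : ∀ f : E[X], Squarefree f → Reflexive f) {p : E[X]} (hp : Prime p) : TernaryMod p := by
  induction hn : p.natDegree using Nat.strong_induction_on generalizing p with
  | _ n ih =>
    refine ternaryMod_of_forall_squarefree hp fun a b c t ha hb hc hda hdb ht => ?_
    have hnd : ∀ {d : E[X]}, Squarefree d → d.natDegree < p.natDegree → ¬ p ∣ d :=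
      fun hd hlt h => (natDegree_le_of_dvd h hd.ne_zero).not_gt hlt
    have hpab := hp.not_dvd_mul (hnd ha hda) (hnd hb hdb)
    obtain ⟨Q, hQ, hQd, hQp⟩ := exists_squarefree_support (mul_ne_zero ha.ne_zero hb.ne_zero)
    have hpQ : ¬ p ∣ Q := fun h => hpab (h.trans hQd)
    have hpP : Squarefree (p * Q) := squarefree_mul_of_isCoprime
      ((hp.irreducible.coprime_iff_not_dvd).mpr hpQ) hp.squarefree hQ
    have hall : ∀ q i, q ∣ ![a, b, c] i → q ∣ a * b := by
      intro q i h
      fin_cases i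
      · exact h.mul_right _
      · exact h.mul_left _
      · exact (dvd_neg (α := E[X])).mp (ht ▸ h.mul_right _)
    obtain ⟨e, g, h, he, -, -, -, j, hj, hja⟩ := exists_totally_isotropic_of_reflexive h2 hE HR
      (a := ![a, b, c]) (m := 3) (s := c * t) (P := p * Q)
      (by intro i; fin_cases i <;> assumption) rfl
      (by rw [Fin.prod_univ_three]; simp only [Matrix.cons_val]; linear_combination -c * ht) hpP
      (fun q i hq h => (hQp q hq (hall q i h)).mul_left _)
      (fun q i hq h => by
        rcases hq.dvd_or_dvd (hall q i h) with h | h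
        · exact ih q.natDegree (by
            have := natDegree_le_of_dvd h ha.ne_zero; omega) hq rfl
        · exact ih q.natDegree (by
            have := natDegree_le_of_dvd h hb.ne_zero; omega) hq rfl)
    obtain ⟨x, hx, hx0⟩ := isotropicDiag_of_totally_isotropic (by simp) j hj hja
      ![Sum.inl 0, Sum.inl 1, Sum.inl 2, Sum.inr 0] (by decide) (by omega)
    obtain ⟨k, y, rfl, i, hi⟩ := exists_primitive hp hx
    simp only [Fin.sum_univ_four, Matrix.cons_val, Sum.elim_inl, Sum.elim_inr, Pi.smul_apply,
      smul_eq_mul] at hx0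
    have hy : a * y 0 ^ 2 + b * y 1 ^ 2 + c * y 2 ^ 2 = C e * (p * Q) * y 3 ^ 2 := by
      apply mul_left_cancel₀ (pow_ne_zero (2 * k) hp.ne_zero)
      rw [pow_mul']
      linear_combination hx0
    refine ⟨y 0, y 1, y 2, ?_, by rw [hy]; exact ⟨C e * Q * y 3 ^ 2, by ring⟩⟩
    rintro ⟨⟨y₀, h0⟩, ⟨y₁, h1⟩, ⟨y₂, h2⟩⟩
    have h3 : p ∣ C e * Q * y 3 ^ 2 := by
      refine ⟨a * y₀ ^ 2 + b * y₁ ^ 2 + c * y₂ ^ 2, ?_⟩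
      apply mul_left_cancel₀ hp.ne_zero
      rw [h0, h1, h2] at hy
      linear_combination -hy
    have h3' : p ∣ y 3 := hp.dvd_of_dvd_pow ((hp.dvd_or_dvd h3).resolve_left
      (hp.not_dvd_mul (not_prime_dvd_C he hp) hpQ))
    fin_cases i
    · exact hi ⟨_, h0⟩
    · exact hi ⟨_, h1⟩
    · exact hi ⟨_, h2⟩
    · exact hi h3'

end ResidueFields

end SquareReflexive

namespace SquareReflexive

open WithZero

section Transfer

theorem IsotropicDiag.map {R S : Type*} [CommRing R] [CommRing S] (φ : R →+* S)
    (hφ : Function.Injective φ) {n : ℕ} {a : Fin n → R} (h : IsotropicDiag a) :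
    IsotropicDiag fun i => φ (a i) := by
  obtain ⟨x, hx, h0⟩ := h
  refine ⟨fun i => φ (x i), fun h => hx (funext fun i => hφ ?_), ?_⟩
  · rw [Pi.zero_apply, map_zero]; exact congrFun h i
  · simpa using congrArg φ h0

theorem IsotropicDiag.of_comp {R : Type*} [CommRing R] {m n : ℕ} {a : Fin n → R} {e : Fin m → Fin n}
    (he : Function.Injective e) (h : IsotropicDiag fun i => a (e i)) : IsotropicDiag a := by
  obtain ⟨x, hx, h0⟩ := h
  refine ⟨Function.extend e x 0, fun h => hx (funext fun i => ?_), ?_⟩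
  · rw [← he.extend_apply x 0 i, h]; rfl
  · rw [← h0]
    refine (Fintype.sum_of_injective e he _ _ (fun i hi => ?_) fun i => ?_).symm
    · rw [Function.extend_apply' _ _ _ hi]; simp
    · rw [he.extend_apply]

variable {L : Type*} [Field L]

theorem isotropicDiag_of_eq_mul_sq {n : ℕ} {a b : Fin n → L} {D : L} {s : Fin n → L} (hD : D ≠ 0)
    (hs : ∀ i, s i ≠ 0) (e : ∀ i, b i * s i ^ 2 = D * a i) (h : IsotropicDiag b) :
    IsotropicDiag a := by
  obtain ⟨x, hx, h0⟩ := h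
  refine ⟨fun i => x i / s i, fun h => hx (funext fun i => ?_), ?_⟩
  · simpa [hs i] using congrFun h i
  · apply mul_left_cancel₀ hD
    rw [mul_zero, ← h0, Finset.mul_sum]
    refine Finset.sum_congr rfl fun i _ => ?_
    have := hs i
    rw [div_pow, ← mul_assoc, ← e]
    field_simp

theorem isotropicDiag_iff_of_eq_mul_sq {n : ℕ} {a b : Fin n → L} {D : L} {s : Fin n → L}
    (hD : D ≠ 0) (hs : ∀ i, s i ≠ 0) (e : ∀ i, b i * s i ^ 2 = D * a i) :
    IsotropicDiag b ↔ IsotropicDiag a := by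
  refine ⟨isotropicDiag_of_eq_mul_sq hD hs e, isotropicDiag_of_eq_mul_sq (D := D⁻¹)
    (s := fun i => (s i)⁻¹) (inv_ne_zero hD) (fun i => inv_ne_zero (hs i)) fun i => ?_⟩
  have := hs i
  have h := e i
  field_simp
  linear_combination -h

variable {n : ℕ} {u q : Fin n → L} {T : Matrix (Fin n) (Fin n) L}

theorem det_ne_zero_of_isometry (hq : ∀ i, q i ≠ 0)
    (hT : T.transpose * Matrix.diagonal u * T = Matrix.diagonal q) : T.det ≠ 0 := by
  intro h
  have := congrArg Matrix.det hT
  rw [Matrix.det_mul, h, mul_zero, Matrix.det_diagonal] at this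
  exact Finset.prod_ne_zero_iff.mpr (fun i _ => hq i) this.symm

theorem isotropicDiag_cons_of_isometry (d : L) (hq : ∀ i, q i ≠ 0)
    (hT : T.transpose * Matrix.diagonal u * T = Matrix.diagonal q)
    (h : IsotropicDiag (Matrix.vecCons d q)) : IsotropicDiag (Matrix.vecCons d u) := by
  obtain ⟨x, hx, h0⟩ := h
  have hsum : ∀ (w : Fin n → L) (y : Fin n → L),
      ∑ i, w i * y i ^ 2 = dotProduct y ((Matrix.diagonal w).mulVec y) := by
    intro w y
    simp only [dotProduct, Matrix.mulVec_diagonal]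
    exact Finset.sum_congr rfl fun i _ => by ring
  refine ⟨Matrix.vecCons (x 0) (T.mulVec (Matrix.vecTail x)), fun h => hx ?_, ?_⟩
  · have h1 : x 0 = 0 := congrFun h 0
    have h2 : T.mulVec (Matrix.vecTail x) = 0 := funext fun i => congrFun h i.succ
    have h3 := Matrix.eq_zero_of_mulVec_eq_zero (det_ne_zero_of_isometry hq hT) h2
    funext i
    refine Fin.cases h1 (fun i => congrFun h3 i) i
  · rw [Fin.sum_univ_succ] at h0 ⊢
    simp only [Matrix.cons_val_zero, Matrix.cons_val_succ] at h0 ⊢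
    rw [← h0, hsum]
    congr 1
    change _ = ∑ i, q i * (Matrix.vecTail x i) ^ 2
    rw [hsum, ← hT, ← Matrix.mulVec_mulVec, ← Matrix.mulVec_mulVec,
      Matrix.dotProduct_mulVec _ T.transpose, Matrix.vecMul_transpose]

theorem isotropicDiag_cons_iff_of_isometry (d : L) (hq : ∀ i, q i ≠ 0)
    (hT : T.transpose * Matrix.diagonal u * T = Matrix.diagonal q) :
    IsotropicDiag (Matrix.vecCons d q) ↔ IsotropicDiag (Matrix.vecCons d u) := by
  have hdet := (det_ne_zero_of_isometry hq hT).isUnit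
  have hu : ∀ i, u i ≠ 0 := by
    have := congrArg Matrix.det hT
    rw [Matrix.det_mul, Matrix.det_mul, Matrix.det_diagonal, Matrix.det_diagonal] at this
    have h1 : ∏ i, u i ≠ 0 := by
      intro h0
      rw [h0] at this
      exact Finset.prod_ne_zero_iff.mpr (fun i _ => hq i) (by rw [← this]; ring)
    exact fun i => Finset.prod_ne_zero_iff.mp h1 i (Finset.mem_univ i)
  refine ⟨isotropicDiag_cons_of_isometry d hq hT,
    isotropicDiag_cons_of_isometry (T := T⁻¹) d hu ?_⟩
  rw [← hT, Matrix.transpose_nonsing_inv, ← Matrix.mul_assoc, ← Matrix.mul_assoc,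
    Matrix.nonsing_inv_mul _ (by rwa [Matrix.det_transpose]), Matrix.one_mul, Matrix.mul_assoc,
    Matrix.mul_nonsing_inv _ hdet, Matrix.mul_one]

open UniformSpace in
theorem isotropicCompletion_congr.{u} {F : Type u} [Field F] (v : Valuation F ℤᵐ⁰) {m n : ℕ}
    {a : Fin m → F} {b : Fin n → F}
    (H : ∀ (L : Type u) [Field L] (φ : F →+* L),
      IsotropicDiag (fun i => φ (a i)) → IsotropicDiag fun i => φ (b i))
    (h : IsotropicCompletion v a) : IsotropicCompletion v b := by
  let _ : Valued F ℤᵐ⁰ := Valued.mk' v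
  exact H (Completion F) Completion.coeRingHom h

end Transfer

section FiveDimensional

variable {E : Type*} [Field E]

local notation "κ" => algebraMap (Polynomial E) (RatFunc E)

theorem exists_eq_sq_of_κ {f : E[X]} {x : RatFunc E} (h : κ f = x ^ 2) : ∃ s, f = s ^ 2 := by
  obtain ⟨s, hs⟩ := IsIntegrallyClosed.exists_algebraMap_eq_of_isIntegral_pow (R := E[X])
    (K := RatFunc E) (x := x) (n := 2) two_pos (by rw [← h]; exact isIntegral_algebraMap)
  refine ⟨s, RatFunc.algebraMap_injective E ?_⟩
  rw [h, ← hs, map_pow]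

theorem isotropicDiag_of_five (h2 : (2 : E) ≠ 0) (hE : TernaryIsotropic E)
    (HR : ∀ f : E[X], Squarefree f → Reflexive f) (a : Fin 5 → RatFunc E) (ha : ∀ i, a i ≠ 0) :
    IsotropicDiag a := by
  set D := ∏ i, a i with hDdef
  have hD : D ≠ 0 := Finset.prod_ne_zero_iff.mpr fun i _ => ha i
  choose A s hA hs e using fun i => exists_squarefree_ratFunc (mul_ne_zero hD (ha i))
  refine isotropicDiag_of_eq_mul_sq (b := fun i => κ (A i)) hD hs (fun i => (e i).symm) ?_
  refine IsotropicDiag.map κ (RatFunc.algebraMap_injective E) ?_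
  have hps : ∏ i, s i ≠ 0 := Finset.prod_ne_zero_iff.mpr fun i _ => hs i
  obtain ⟨t, ht⟩ : ∃ t, ∏ i, A i = t ^ 2 := by
    refine exists_eq_sq_of_κ (x := D ^ 3 / ∏ i, s i) ?_
    have h1 : ∏ i, (D * a i) = ∏ i, (κ (A i) * s i ^ 2) := Finset.prod_congr rfl fun i _ => e i
    rw [Finset.prod_mul_distrib, Finset.prod_mul_distrib, Finset.prod_const, Finset.card_univ,
      Fintype.card_fin, ← hDdef, Finset.prod_pow, ← map_prod κ] at h1
    rw [div_pow, eq_div_iff (pow_ne_zero 2 hps), ← h1]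
    ring
  obtain ⟨P, hP, -, hPp⟩ := exists_squarefree_support
    (Finset.prod_ne_zero_iff.mpr fun i (_ : i ∈ Finset.univ) => (hA i).ne_zero)
  obtain ⟨c, g, h, -, -, -, -, j, hj, hja⟩ := exists_totally_isotropic_of_reflexive h2 hE HR hA
    (m := 4) rfl (s := t) (by rw [ht]; ring) hP
    (fun p i hp h => hPp p hp (h.trans (Finset.dvd_prod_of_mem A (Finset.mem_univ i))))
    (fun p i hp _ => ternaryMod_of_reflexive h2 hE HR hp)
  exact isotropicDiag_of_totally_isotropic (by simp) j hj hja Sum.inl Sum.inl_injective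
    (by norm_num)

end FiveDimensional

end SquareReflexive

namespace SquareReflexive

open WithZero

section TwoPairs

variable {F : Type*} [Field F] {v : Valuation F ℤᵐ⁰} {f P G : F}

theorem LocIso.perm {n : ℕ} {a b : Fin n → F} (h : LocIso v a) (σ : Equiv.Perm (Fin n))
    (e : ∀ i, b (σ i) = a i) : LocIso v b :=
  locIso_of_embedding σ.toEmbedding (by
    have : (fun k => b (σ.toEmbedding k)) = a := funext e
    rwa [this])

theorem locSq_of_odd_even (hf : f ≠ 0) (hP : P ≠ 0) (hG : G ≠ 0) (hfe : Ev v f) (hPo : ¬ Ev v P)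
    (hGe : Ev v G) (h : LocIso v ![-f, f * P, G, -(f * P * G)]) :
    LocSq v (f * G) ∨ LocSq v G := by
  have h1 := locSq_of_locIso_two_pairs (v := v) (a := -f) (b := G) (c := f * P) (d := -(f * P * G))
    (by simp [hf]) hG (by simp [*]) (by simp [*])
    (by rw [ev_mul (by simp [hf]) hG, ev_neg]; tauto)
    (by rw [ev_mul (by simp [*]) (by simp [*]), ev_neg, ev_mul (by simp [*]) hG]; tauto)
    (by rw [ev_mul (by simp [*]) (by simp [*]), ev_neg, ev_mul (by simp [*]) hP]; tauto)
    (h.perm (Equiv.swap 1 2) fun i => by fin_cases i <;> rfl)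
  refine h1.imp (fun h => ?_) fun h => ?_
  · rwa [neg_mul, neg_neg] at h
  · exact LocSq.of_mul_sq (s := f * P) (by convert h using 1; ring)

theorem locSq_of_even_odd (hf : f ≠ 0) (hP : P ≠ 0) (hG : G ≠ 0) (hfe : Ev v f) (hPe : Ev v P)
    (hGo : ¬ Ev v G) (h : LocIso v ![-f, f * P, G, -(f * P * G)]) :
    LocSq v P ∨ LocSq v (f * P) := by
  have h1 := locSq_of_locIso_two_pairs (v := v) (a := -f) (b := f * P) (c := G) (d := -(f * P * G))
    (by simp [hf]) (by simp [*]) hG (by simp [*])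
    (by rw [ev_mul (by simp [*]) (by simp [*]), ev_neg, ev_mul hf hP]; tauto)
    (by rw [ev_mul hG (by simp [*]), ev_neg, ev_mul (by simp [*]) hG, ev_mul hf hP]; tauto)
    (by rw [ev_mul (by simp [*]) hG, ev_neg]; tauto) h
  refine h1.imp (fun h => ?_) fun h => ?_
  · exact LocSq.of_mul_sq (s := f) (by convert h using 1; ring)
  · exact LocSq.of_mul_sq (s := G) (by convert h using 1; ring)

theorem locSq_of_odd_odd (hf : f ≠ 0) (hP : P ≠ 0) (hG : G ≠ 0) (hfe : Ev v f) (hPo : ¬ Ev v P)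
    (hGo : ¬ Ev v G) (h : LocIso v ![-f, f * P, G, -(f * P * G)]) :
    LocSq v (-(P * G)) ∨ LocSq v (-(f * P * G)) := by
  have h1 := locSq_of_locIso_two_pairs (v := v) (a := -f) (b := -(f * P * G)) (c := f * P) (d := G)
    (by simp [hf]) (by simp [*]) (by simp [*]) hG
    (by rw [ev_mul (by simp [*]) (by simp [*]), ev_neg, ev_neg, ev_mul (by simp [*]) hG,
          ev_mul hf hP]; tauto)
    (by rw [ev_mul (by simp [*]) hG, ev_mul hf hP]; tauto)
    (by rw [ev_mul (by simp [*]) (by simp [*]), ev_neg, ev_mul hf hP]; tauto)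
    (h.perm (Equiv.swap 1 2 * Equiv.swap 2 3) fun i => by fin_cases i <;> rfl)
  refine h1.imp (fun h => ?_) fun h => ?_
  · exact LocSq.of_mul_sq (s := f) (by convert h using 1; ring)
  · exact h

end TwoPairs

section NormClass

variable {E : Type*} [Field E]

/-- `x` is a nonzero element of `E² ∪ c E²`, up to squares. -/
def SqOr (c x : E) : Prop := x ≠ 0 ∧ (IsSquare x ∨ IsSquare (c * x))

variable {c x y : E}

theorem SqOr.of_isSquare (hx : x ≠ 0) (h : IsSquare x) : SqOr c x := ⟨hx, Or.inl h⟩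

theorem SqOr.mul (hx : SqOr c x) (hy : SqOr c y) : SqOr c (x * y) := by
  refine ⟨mul_ne_zero hx.1 hy.1, ?_⟩
  rcases hx.2 with h | h <;> rcases hy.2 with h' | h'
  · exact Or.inl (h.mul h')
  · exact Or.inr (by rw [show c * (x * y) = x * (c * y) by ring]; exact h.mul h')
  · exact Or.inr (by rw [← mul_assoc]; exact h.mul h')
  · by_cases hc : c = 0
    · exact Or.inr (by simp [hc])
    · refine Or.inl (isSquare_of_mul_left (a := c ^ 2) ⟨c, by ring⟩ (by simp [hc]) ?_)
      rw [show c ^ 2 * (x * y) = (c * x) * (c * y) by ring]; exact h.mul h'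

theorem SqOr.of_mul (hx : SqOr c x) (h : SqOr c (x * y)) : SqOr c y := by
  have := hx.mul h
  have hy : y ≠ 0 := right_ne_zero_of_mul h.1
  rw [show x * (x * y) = x ^ 2 * y by ring] at this
  refine ⟨hy, this.2.imp (fun h => isSquare_of_mul_left ⟨x, by ring⟩ (pow_ne_zero 2 hx.1) h)
    fun h => isSquare_of_mul_left (a := x ^ 2) ⟨x, by ring⟩ (pow_ne_zero 2 hx.1) ?_⟩
  rwa [show x ^ 2 * (c * y) = c * (x ^ 2 * y) by ring]

theorem SqOr.pow_of_odd {n : ℕ} (hn : Odd n) (h : SqOr c x) : SqOr c (x ^ n) := by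
  obtain ⟨k, rfl⟩ := hn
  rw [pow_succ, pow_mul']
  exact (SqOr.of_isSquare (pow_ne_zero _ (pow_ne_zero _ h.1)) ⟨_, pow_two _⟩).mul h

theorem SqOr.pow_of_even {n : ℕ} (hn : Even n) (hx : x ≠ 0) : SqOr c (x ^ n) :=
  SqOr.of_isSquare (pow_ne_zero _ hx) (hn.isSquare_pow x)

theorem SqOr.self (hc : c ≠ 0) : SqOr c c := ⟨hc, Or.inr ⟨c, rfl⟩⟩

theorem SqOr.self_pow (hc : c ≠ 0) (n : ℕ) : SqOr c (c ^ n) := by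
  rcases Nat.even_or_odd n with h | h
  · exact SqOr.pow_of_even h hc
  · exact (SqOr.self hc).pow_of_odd h

theorem SqOr.exists (hc : c ≠ 0) (h : SqOr c x) : ∃ u, u ≠ 0 ∧ (x = u ^ 2 ∨ x = c * u ^ 2) := by
  obtain ⟨hx, ⟨u, hu⟩ | ⟨u, hu⟩⟩ := h
  · exact ⟨u, by rintro rfl; exact hx (by simpa using hu), Or.inl (by rw [hu, pow_two])⟩
  · refine ⟨u / c, ?_, Or.inr ?_⟩
    · refine div_ne_zero ?_ hc
      rintro rfl
      simp [hc, hx] at hu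
    · field_simp; linear_combination hu

theorem sqOr_nm_mul_nm {f g : E[X]} (hf : f ≠ 0) (hg : g ≠ 0) (hfg : IsCoprime f g)
    (he : Even f.natDegree) : SqOr f.leadingCoeff (nm f g * nm g f) := by
  have hc := leadingCoeff_ne_zero.mpr hf
  have h1 := nm_ne_zero hf hfg
  have h2 := nm_ne_zero hg hfg.symm
  refine (SqOr.self_pow hc g.natDegree).of_mul ?_
  rw [← mul_assoc, nm_reciprocity hf hg, Even.neg_one_pow (he.mul_right _), one_mul, mul_assoc]
  exact (SqOr.pow_of_even he (leadingCoeff_ne_zero.mpr hg)).mul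
    (SqOr.of_isSquare (mul_ne_zero h2 h2) ⟨_, rfl⟩)

/-- The sign and leading coefficients occurring in the reciprocity law for `P` and `G`. -/
noncomputable def symbolAtInfinity (P G : E[X]) : E :=
  G.leadingCoeff ^ P.natDegree * (-1) ^ (P.natDegree * G.natDegree) * P.leadingCoeff ^ G.natDegree

theorem symbolAtInfinity_ne_zero {P G : E[X]} (hP : P ≠ 0) (hG : G ≠ 0) :
    symbolAtInfinity P G ≠ 0 := by
  simp [symbolAtInfinity, hP, hG]

theorem isSquare_symbolAtInfinity_mul {P G : E[X]} (hP : P ≠ 0) (hG : G ≠ 0) :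
    IsSquare (symbolAtInfinity P G * (nm G P * nm P G)) := by
  have := nm_reciprocity hG hP
  refine ⟨(-1) ^ (P.natDegree * G.natDegree) * P.leadingCoeff ^ G.natDegree * nm P G, ?_⟩
  rw [symbolAtInfinity, mul_comm P.natDegree]
  linear_combination (-1) ^ (G.natDegree * P.natDegree) * P.leadingCoeff ^ G.natDegree * nm P G * this

theorem sqOr_nm_mul {f P₁ P₂ G h k l : E[X]} (hf : f ≠ 0) (hP₁ : P₁ ≠ 0) (hP₂ : P₂ ≠ 0) (hG : G ≠ 0)
    (he : Even f.natDegree) (hfP : IsCoprime f P₂) (hfG : IsCoprime f G)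
    (hPG : IsCoprime (P₁ * P₂) G) (hh : G ∣ f * (P₁ * P₂) - h ^ 2) (hk : P₁ ∣ G - k ^ 2)
    (hl : P₂ ∣ f * G - l ^ 2) (hε : SqOr f.leadingCoeff (symbolAtInfinity (P₁ * P₂) G)) :
    SqOr f.leadingCoeff (nm f (G * P₂)) := by
  have hP := mul_ne_zero hP₁ hP₂
  have a1 := sqOr_nm_mul_nm hf hP₂ hfP he
  have a2 := sqOr_nm_mul_nm hf hG hfG he
  have n1 := nm_ne_zero hG hfG.symm
  have n2 := nm_ne_zero hG hPG.symm
  have n3 := nm_ne_zero hP₂ hfP.symm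
  have n4 := nm_ne_zero hP₁ hPG.of_mul_left_left
  have n5 := nm_ne_zero hP₂ hPG.of_mul_left_right
  have n6 := symbolAtInfinity_ne_zero hP hG
  have a3 : SqOr f.leadingCoeff (nm G f * nm G (P₁ * P₂)) :=
    SqOr.of_isSquare (by simp [*]) ⟨nm G h, by rw [← nm_mul, nm_congr hh, nm_pow, pow_two]⟩
  have a4 : SqOr f.leadingCoeff (nm G (P₁ * P₂) * (nm P₁ G * nm P₂ G)) := by
    refine hε.of_mul (SqOr.of_isSquare (by simp [*]) ?_)
    rw [← nm_mul_left hP₁ hP₂]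
    exact isSquare_symbolAtInfinity_mul hP hG
  have a5 : SqOr f.leadingCoeff (nm P₁ G) :=
    SqOr.of_isSquare n4 ⟨nm P₁ k, by rw [nm_congr hk, nm_pow, pow_two]⟩
  have a6 : SqOr f.leadingCoeff (nm P₂ f * nm P₂ G) :=
    SqOr.of_isSquare (by simp [*]) ⟨nm P₂ l, by rw [← nm_mul, nm_congr hl, nm_pow, pow_two]⟩
  refine SqOr.of_mul (x := (nm G f * nm G (P₁ * P₂) * nm P₂ f * nm P₁ G * nm P₂ G) ^ 2)
    (SqOr.of_isSquare (by simp [*]) ⟨_, pow_two _⟩) ?_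
  rw [nm_mul f]
  convert ((((a1.mul a2).mul a3).mul a4).mul a5).mul a6 using 1
  ring

end NormClass

section Infinity

variable {E : Type*} [Field E]

local notation "κ" => algebraMap (Polynomial E) (RatFunc E)

theorem sqOr_symbolAtInfinity {v : Valuation (RatFunc E) ℤᵐ⁰} (hv : InfPlace v) {f P G : E[X]}
    (hf : f ≠ 0) (hP : P ≠ 0) (hG : G ≠ 0) (he : Even f.natDegree)
    (h : LocIso v ![-κ f, κ f * κ P, κ G, -(κ f * κ P * κ G)]) :
    SqOr f.leadingCoeff (symbolAtInfinity P G) := by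
  have hf' := κ_ne_zero hf
  have hP' := κ_ne_zero hP
  have hG' := κ_ne_zero hG
  have cf := leadingCoeff_ne_zero.mpr hf
  have cP := leadingCoeff_ne_zero.mpr hP
  have cG := leadingCoeff_ne_zero.mpr hG
  have hfe := (hv.ev_iff hf).mpr he
  have key : ∀ g : E[X], LocSq v (κ g) → IsSquare g.leadingCoeff := fun g h => (hv.of_locSq h).2
  rw [symbolAtInfinity]
  rcases Nat.even_or_odd P.natDegree with dP | dP <;> rcases Nat.even_or_odd G.natDegree with dG | dG
  · rw [Even.neg_one_pow (dP.mul_right _), mul_one]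
    exact (SqOr.pow_of_even dP cG).mul (SqOr.pow_of_even dG cP)
  · rw [Even.neg_one_pow (dP.mul_right _), mul_one]
    refine (SqOr.pow_of_even dP cG).mul (SqOr.pow_of_odd dG ⟨cP, ?_⟩)
    have := locSq_of_even_odd hf' hP' hG' hfe ((hv.ev_iff hP).mpr dP)
      (by rw [hv.ev_iff hG]; simpa using dG) h
    refine this.imp (key P) fun h => ?_
    rw [← map_mul κ] at h
    simpa using key _ h
  · rw [Even.neg_one_pow (dG.mul_left _), mul_one]
    refine (SqOr.pow_of_odd dP ⟨cG, ?_⟩).mul (SqOr.pow_of_even dG cP)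
    have := locSq_of_odd_even hf' hP' hG' hfe (by rw [hv.ev_iff hP]; simpa using dP)
      ((hv.ev_iff hG).mpr dG) h
    refine this.symm.imp (key G) fun h => ?_
    rw [← map_mul κ] at h
    simpa using key _ h
  · have := locSq_of_odd_odd hf' hP' hG' hfe (by rw [hv.ev_iff hP]; simpa using dP)
      (by rw [hv.ev_iff hG]; simpa using dG) h
    rw [← map_mul κ, ← map_mul κ, ← map_mul κ, ← map_neg κ, ← map_neg κ] at this
    have h1 : SqOr f.leadingCoeff (-(P.leadingCoeff * G.leadingCoeff)) := by
      refine ⟨by simp [*], this.imp (fun h => by simpa using key _ h) fun h => ?_⟩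
      rw [show f.leadingCoeff * -(P.leadingCoeff * G.leadingCoeff) = (-(f * P * G)).leadingCoeff by
        rw [leadingCoeff_neg, leadingCoeff_mul, leadingCoeff_mul]; ring]
      exact key _ h
    obtain ⟨m, hm⟩ := dP
    obtain ⟨n, hn⟩ := dG
    rw [Odd.neg_one_pow (by rw [hm, hn]; exact (odd_two_mul_add_one m).mul (odd_two_mul_add_one n)),
      hm, hn]
    convert (SqOr.of_isSquare (c := f.leadingCoeff) (x := (G.leadingCoeff ^ m * P.leadingCoeff ^ n) ^ 2)
      (by simp [*]) ⟨_, pow_two _⟩).mul h1 using 1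
    ring

end Infinity

end SquareReflexive

namespace SquareReflexive

open WithZero

section Quaternary

variable {E : Type*} [Field E]

local notation "κ" => algebraMap (Polynomial E) (RatFunc E)

theorem exists_mul_of_isSquare_mod {P : E[X]} (hP : Squarefree P) (G : E[X]) :
    ∃ P₁ P₂, P = P₁ * P₂ ∧ (∀ p, Prime p → p ∣ P₁ → ∃ k, p ∣ G - k ^ 2) ∧
      ∀ p, Prime p → p ∣ P₂ → ¬ ∃ k, p ∣ G - k ^ 2 := by
  induction P, hP using squarefree_induction with
  | hu u hu =>
    exact ⟨u, 1, (mul_one u).symm, fun p hp h => (hp.not_isUnit (isUnit_of_dvd_unit h hu)).elim,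
      fun p hp h => (hp.not_isUnit (isUnit_of_dvd_one h)).elim⟩
  | hm p f hp hf hpf ih =>
    obtain ⟨P₁, P₂, rfl, h₁, h₂⟩ := ih
    by_cases hk : ∃ k, p ∣ G - k ^ 2
    · refine ⟨p * P₁, P₂, by ring, fun q hq h => ?_, h₂⟩
      refine (hq.dvd_or_dvd h).elim (fun h => ?_) (h₁ q hq)
      exact hk.imp fun k hk => h.trans hk
    · refine ⟨P₁, p * P₂, by ring, h₁, fun q hq h => ?_⟩
      refine (hq.dvd_or_dvd h).elim (fun h h' => hk ?_) (h₂ q hq)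
      exact h'.imp fun k hk => ((hq.associated_of_dvd hp h).dvd_iff_dvd_left).mp hk

variable {f P G P₁ P₂ H g : E[X]}

set_option maxHeartbeats 1000000 in
theorem locallySplit_six {p : E[X]} {v : Valuation (RatFunc E) ℤᵐ⁰} (hv : PlaceAt v p)
    (hT : TernaryMod p) (hf0 : f ≠ 0) (hP0 : P ≠ 0) (hG0 : G ≠ 0) (hH0 : H ≠ 0)
    (hfP : p ∣ f → ¬ p ∣ P) (hfG : p ∣ f → ¬ p ∣ G) (hfH : p ∣ f → ¬ p ∣ H) (hPG : p ∣ P → ¬ p ∣ G)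
    (h₁ : p ∣ f → LocSq v (κ (G * H))) (h₂ : p ∣ P → ¬ p ∣ H → LocSq v (κ G))
    (h₃ : p ∣ P → p ∣ H → LocSq v (κ (f * G))) (h₄ : p ∣ G → LocSq v (κ (f * P)))
    (h₅ : ¬ p ∣ P → p ∣ H → LocSq v (κ f))
    (hd : p ∣ f ∨ p ∣ P ∨ p ∣ G ∨ p ∣ H) :
    LocallySplit p v ![f * P, G, -(f * P * G), -f, -H, f * H] := by
  have hp := hv.prime
  by_cases df : p ∣ f
  · have dP := hfP df
    have dG := hfG df
    have dH := hfH df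
    refine ⟨2, ?_, Or.inr hT, ?_⟩
    · rw [Fin.sum_univ_six]; simp [dvdInd, dvd_neg, hp.dvd_mul, df, dP, dG, dH]
    · convert (h₁ df).mul_sq (κ_ne_zero (mul_ne_zero (pow_ne_zero 2 hf0) hP0)) using 1
      simp [Fin.prod_univ_six, dvdPart, dvd_neg, hp.dvd_mul, df, dP, dG, dH]
      ring
  by_cases dP : p ∣ P
  · have dG := hPG dP
    by_cases dH : p ∣ H
    · refine ⟨2, ?_, Or.inr hT, ?_⟩
      · rw [Fin.sum_univ_six]; simp [dvdInd, dvd_neg, hp.dvd_mul, df, dP, dG, dH]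
      · convert (h₃ dP dH).mul_sq (κ_ne_zero (mul_ne_zero (mul_ne_zero hf0 hP0) hH0)) using 1
        simp [Fin.prod_univ_six, dvdPart, dvd_neg, hp.dvd_mul, df, dP, dG, dH]
        ring
    · refine ⟨1, ?_, Or.inl le_rfl, ?_⟩
      · rw [Fin.sum_univ_six]; simp [dvdInd, dvd_neg, hp.dvd_mul, df, dP, dG, dH]
      · convert (h₂ dP dH).mul_sq (κ_ne_zero (mul_ne_zero hf0 hP0)) using 1
        simp [Fin.prod_univ_six, dvdPart, dvd_neg, hp.dvd_mul, df, dP, dG, dH]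
        ring
  by_cases dG : p ∣ G
  · by_cases dH : p ∣ H
    · refine ⟨2, ?_, Or.inr hT, ?_⟩
      · rw [Fin.sum_univ_six]; simp [dvdInd, dvd_neg, hp.dvd_mul, df, dP, dG, dH]
      · convert ((h₄ dG).mul (h₅ dP dH)).mul_sq (κ_ne_zero (mul_ne_zero hG0 hH0)) using 1
        simp [Fin.prod_univ_six, dvdPart, dvd_neg, hp.dvd_mul, df, dP, dG, dH]
        ring
    · refine ⟨1, ?_, Or.inl le_rfl, ?_⟩
      · rw [Fin.sum_univ_six]; simp [dvdInd, dvd_neg, hp.dvd_mul, df, dP, dG, dH]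
      · convert (h₄ dG).mul_sq (κ_ne_zero hG0) using 1
        simp [Fin.prod_univ_six, dvdPart, dvd_neg, hp.dvd_mul, df, dP, dG, dH]
        ring
  · have dH : p ∣ H := by tauto
    refine ⟨1, ?_, Or.inl le_rfl, ?_⟩
    · rw [Fin.sum_univ_six]; simp [dvdInd, dvd_neg, hp.dvd_mul, df, dP, dG, dH]
    · convert (h₅ dP dH).mul_sq (κ_ne_zero hH0) using 1
      simp [Fin.prod_univ_six, dvdPart, dvd_neg, hp.dvd_mul, df, dP, dG, dH]
      ring

set_option maxHeartbeats 1000000 in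
theorem isotropicDiag_of_locIso_quaternary (h2 : (2 : E) ≠ 0) (hE : TernaryIsotropic E)
    (HR : ∀ f : E[X], Squarefree f → Reflexive f) {f P G h : E[X]} (hf : Squarefree f)
    (hP : Squarefree P) (hG : Squarefree G) (hfP : IsCoprime f P) (hfG : IsCoprime f G)
    (hPG : IsCoprime P G) (hh : G ∣ f * P - h ^ 2)
    (hloc : ∀ v, IsZValuationTrivialOnBase E v →
      LocIso v ![-κ f, κ f * κ P, κ G, -(κ f * κ P * κ G)]) :
    IsotropicDiag ![-f, f * P, G, -(f * P * G)] := by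
  have hf0 := hf.ne_zero
  have hP0 := hP.ne_zero
  have hG0 := hG.ne_zero
  obtain ⟨P₁, P₂, rfl, hP₁, hP₂⟩ := exists_mul_of_isSquare_mod hP G
  have hP₁0 := left_ne_zero_of_mul hP0
  have hP₂0 := right_ne_zero_of_mul hP0
  have hsP₂ : Squarefree P₂ := hP.squarefree_of_dvd (dvd_mul_left _ _)
  obtain ⟨k, hk⟩ := exists_dvd_sub_sq (hP.squarefree_of_dvd (dvd_mul_right P₁ P₂)) hP₁
  have hfP₂ : IsCoprime f P₂ := hfP.of_mul_right_right
  have key : ∀ p, Prime p → p ∣ P₂ → ∃ l, p ∣ f * G - l ^ 2 := by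
    intro p hp hpP
    obtain ⟨v, hz, hv⟩ := exists_placeAt hp
    have hpf : ¬ p ∣ f := not_dvd_of_isCoprime hp hfP₂.symm hpP
    have hpG : ¬ p ∣ G := not_dvd_of_isCoprime hp hPG (hpP.mul_left _)
    rcases locSq_of_odd_even (κ_ne_zero hf0) (κ_ne_zero hP0) (κ_ne_zero hG0)
      ((hv.ev_iff hf).mpr hpf) (by rw [hv.ev_iff hP]; simpa using hpP.mul_left _)
      ((hv.ev_iff hG).mpr hpG) (hloc v hz) with h | h
    · rw [← map_mul κ] at h
      exact hv.exists_of_locSq (hp.not_dvd_mul hpf hpG) h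
    · exact (hP₂ p hp hpP (hv.exists_of_locSq hpG h)).elim
  obtain ⟨l, hl⟩ := exists_dvd_sub_sq hsP₂ key
  obtain ⟨g, hg, hfg, ⟨s, hs⟩, k', hk'⟩ := HR f hf (G * P₂) (hfG.mul_right hfP₂) (by
    rcases Nat.even_or_odd f.natDegree with he | ho
    · right
      obtain ⟨v, hz, hv⟩ := exists_infPlace (E := E)
      exact (sqOr_nm_mul hf0 hP₁0 hP₂0 hG0 he hfP₂ hfG hPG hh hk hl
        (sqOr_symbolAtInfinity hv hf0 hP0 hG0 he (hloc v hz))).exists (leadingCoeff_ne_zero.mpr hf0)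
    · exact Or.inl ho)
  have hg0 := hg.ne_zero
  obtain ⟨H, w, hH, hw, eH⟩ := exists_squarefree_mul_sq (mul_ne_zero hP₂0 hg0)
  have hH0 := hH.ne_zero
  have hfH : IsCoprime f H :=
    (hfP₂.mul_right hfg).of_isCoprime_of_dvd_right (by rw [eH]; exact dvd_mul_right _ _)
  have hlocsplit : ∀ p v, PlaceAt v p →
      (∃ i, p ∣ ![f * (P₁ * P₂), G, -(f * (P₁ * P₂) * G), -f, -H, f * H] i) →
      LocallySplit p v ![f * (P₁ * P₂), G, -(f * (P₁ * P₂) * G), -f, -H, f * H] := by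
    intro p v hv hd
    have hp := hv.prime
    have hxor : p ∣ H ↔ (p ∣ P₂ ↔ ¬ p ∣ g) := by
      have h1 : Ev v (κ H) ↔ Ev v (κ P₂ * κ g) := by
        rw [← map_mul κ, eH, map_mul κ, map_pow κ, ev_mul (κ_ne_zero hH0)
          (pow_ne_zero 2 (κ_ne_zero hw))]
        simp [ev_sq]
      rw [ev_mul (κ_ne_zero hP₂0) (κ_ne_zero hg0), hv.ev_iff hH, hv.ev_iff hsP₂, hv.ev_iff hg] at h1
      tauto
    have lf : p ∣ g → LocSq v (κ f) := fun h =>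
      hv.locSq (not_dvd_of_isCoprime hp hfg.symm h) (h.trans hk')
    have l₁ : p ∣ P₁ → LocSq v (κ G) := fun h =>
      hv.locSq (not_dvd_of_isCoprime hp hPG (h.mul_right _)) (h.trans hk)
    have l₂ : p ∣ P₂ → LocSq v (κ (f * G)) := fun h =>
      hv.locSq (hp.not_dvd_mul (not_dvd_of_isCoprime hp hfP₂.symm h)
        (not_dvd_of_isCoprime hp hPG (h.mul_left _))) (h.trans hl)
    refine locallySplit_six hv (ternaryMod_of_reflexive h2 hE HR hp) hf0 hP0 hG0 hH0
      (not_dvd_of_isCoprime hp hfP) (not_dvd_of_isCoprime hp hfG) (not_dvd_of_isCoprime hp hfH)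
      (not_dvd_of_isCoprime hp hPG) (fun h => ?_) (fun h hn => ?_) (fun h hH => ?_) (fun h => ?_)
      (fun hn hH => ?_) ?_
    · have h1 : LocSq v (κ (G * P₂ * g)) := hv.locSq (hp.not_dvd_mul (hp.not_dvd_mul
        (not_dvd_of_isCoprime hp hfG h) (not_dvd_of_isCoprime hp hfP₂ h))
        (not_dvd_of_isCoprime hp hfg h)) (h.trans hs)
      refine LocSq.of_mul_sq (s := κ w) ?_
      rwa [← map_pow κ, ← map_mul κ, mul_assoc G H, ← eH, ← mul_assoc]
    · by_cases hp₂ : p ∣ P₂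
      · refine (lf (by tauto)).of_mul ?_
        rw [← map_mul κ]; exact l₂ hp₂
      · exact l₁ ((hp.dvd_or_dvd h).resolve_right hp₂)
    · by_cases hp₂ : p ∣ P₂
      · exact l₂ hp₂
      · rw [map_mul κ]
        exact (lf (by tauto)).mul (l₁ ((hp.dvd_or_dvd h).resolve_right hp₂))
    · exact hv.locSq (hp.not_dvd_mul (not_dvd_of_isCoprime hp hfG.symm h)
        (not_dvd_of_isCoprime hp hPG.symm h)) (h.trans hh)
    · have : ¬ p ∣ P₂ := fun h => hn (h.mul_left _)
      exact lf (by tauto)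
    · obtain ⟨i, hi⟩ := hd
      clear lf l₁ l₂ hxor hl hk hs hk' hP₁ hP₂ key
      rw [hp.dvd_mul]
      fin_cases i <;> simp [dvd_neg, hp.dvd_mul] at hi <;> tauto
  have hfPs : Squarefree (f * (P₁ * P₂)) := squarefree_mul_of_isCoprime hfP hf hP
  have hfPGs : Squarefree (f * (P₁ * P₂) * G) :=
    squarefree_mul_of_isCoprime (hfG.mul_left hPG) hfPs hG
  have hfHs : Squarefree (f * H) := squarefree_mul_of_isCoprime hfH hf hH
  have hneg : ∀ {x : E[X]}, Squarefree x → Squarefree (-x) := fun {x} hx => by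
    have := squarefree_C_mul (c := -1) (by simp) hx
    simpa using this
  obtain ⟨j, hj, hja⟩ := exists_totally_isotropic_of_locallySplit h2 hE
    (a := ![f * (P₁ * P₂), G, -(f * (P₁ * P₂) * G), -f, -H, f * H])
    (by
      intro i
      fin_cases i
      exacts [hfPs, hG, hneg hfPGs, hneg hf, hneg hH, hfHs])
    (m := 3) (by simp) (s := f * (P₁ * P₂) * G * f * H)
    (by simp [Fin.prod_univ_six]; ring) hlocsplit
  have := isotropicDiag_of_totally_isotropic (by simp) j hj hja ![3, 0, 1, 2] (by decide)
    (by norm_num)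
  convert this using 1
  funext i
  fin_cases i <;> rfl

end Quaternary

end SquareReflexive

namespace SquareReflexive

open WithZero

section Isometry

theorem isotropicDiag_or_exists_isometry {R K : Type*} [CommRing R] [IsDomain R] [Field K]
    {φ : R →+* K} (hφ : Function.Injective φ) {n : ℕ} {u q : Fin n → R}
    (j : (Fin n → R) →ₗ[R] (Fin n ⊕ Fin n → R)) (hj : Function.Injective j)
    (hja : ∀ x y, diagForm (Sum.elim u q) (j x) (j y) = 0) :
    IsotropicDiag u ∨ ∃ T : Matrix (Fin n) (Fin n) K,
      T.transpose * Matrix.diagonal (fun i => φ (u i)) * T = Matrix.diagonal fun i => -φ (q i) := by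
  set Z := LinearMap.toMatrix' (LinearMap.funLeft R R Sum.inl ∘ₗ j) with hZ
  set Y := LinearMap.toMatrix' (LinearMap.funLeft R R Sum.inr ∘ₗ j) with hY
  by_cases hdet : Y.det = 0
  · left
    obtain ⟨x, hx, hx0⟩ := Matrix.exists_mulVec_eq_zero_iff.mpr hdet
    rw [hY, LinearMap.toMatrix'_mulVec] at hx0
    have hr : ∀ i, j x (Sum.inr i) = 0 := fun i => congrFun hx0 i
    refine ⟨fun i => j x (Sum.inl i), fun h => hx (hj ?_), ?_⟩
    · rw [map_zero]
      funext i
      rcases i with i | i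
      · exact congrFun h i
      · exact hr i
    · have := hja x x
      rw [diagForm_apply, Fintype.sum_sum_type] at this
      simpa [hr, pow_two] using this
  · right
    have hM : Z.transpose * Matrix.diagonal u * Z = -(Y.transpose * Matrix.diagonal q * Y) := by
      rw [eq_neg_iff_add_eq_zero]
      ext k l
      have := hja (Pi.single k 1) (Pi.single l 1)
      rw [diagForm_apply, Fintype.sum_sum_type] at this
      rw [Matrix.zero_apply, ← this, Matrix.add_apply, Matrix.mul_apply, Matrix.mul_apply]
      simp only [Matrix.mul_diagonal, Matrix.transpose_apply, hZ, hY, LinearMap.toMatrix'_apply]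
      congr 1 <;> refine Finset.sum_congr rfl fun i _ => ?_
      · simp [LinearMap.funLeft_apply]; ring
      · simp [LinearMap.funLeft_apply]; ring
    have hM' := congrArg (fun M => φ.mapMatrix M) hM
    simp only [map_mul, map_neg, RingHom.mapMatrix_apply, Matrix.transpose_map] at hM'
    have hdet' : IsUnit (Y.map φ).det := by
      rw [← RingHom.mapMatrix_apply, ← RingHom.map_det]
      exact ((map_ne_zero_iff φ hφ).mpr hdet).isUnit
    have hd : ∀ w : Fin n → R, (Matrix.diagonal w).map φ = Matrix.diagonal fun i => φ (w i) :=
      fun w => Matrix.diagonal_map (map_zero φ)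
    rw [hd, hd] at hM'
    have hYY : Y.map φ * (Y.map φ)⁻¹ = 1 := Matrix.mul_nonsing_inv _ hdet'
    have hYY' : ((Y.map φ)⁻¹).transpose * (Y.map φ).transpose = 1 := by
      rw [← Matrix.transpose_mul, hYY, Matrix.transpose_one]
    refine ⟨Z.map φ * (Y.map φ)⁻¹, ?_⟩
    calc _ = ((Y.map φ)⁻¹).transpose * ((Z.map φ).transpose * Matrix.diagonal (fun i => φ (u i)) *
          Z.map φ) * (Y.map φ)⁻¹ := by
          rw [Matrix.transpose_mul]; simp only [Matrix.mul_assoc]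
      _ = -(((Y.map φ)⁻¹).transpose * (Y.map φ).transpose * Matrix.diagonal (fun i => φ (q i)) *
          (Y.map φ * (Y.map φ)⁻¹)) := by
          rw [hM', Matrix.mul_neg, Matrix.neg_mul]; simp only [Matrix.mul_assoc]
      _ = _ := by
          rw [hYY, hYY', Matrix.one_mul, Matrix.mul_one, ← Matrix.diagonal_neg]

end Isometry

section Quaternary

variable {E : Type*} [Field E]

local notation "κ" => algebraMap (Polynomial E) (RatFunc E)

theorem isotropicDiag_of_completion_four (h2 : (2 : E) ≠ 0) (hE : TernaryIsotropic E)
    (HR : ∀ f : E[X], Squarefree f → Reflexive f) (a : Fin 4 → RatFunc E) (ha : ∀ i, a i ≠ 0)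
    (hloc : ∀ v, IsZValuationTrivialOnBase E v → IsotropicCompletion v a) : IsotropicDiag a := by
  have hD : ∏ i, a i ≠ 0 := Finset.prod_ne_zero_iff.mpr fun i _ => ha i
  obtain ⟨f, s₀, hf, hs₀, e₀⟩ := exists_squarefree_ratFunc hD
  have hf0 := hf.ne_zero
  have hD' : -κ f * a 0 ≠ 0 := mul_ne_zero (neg_ne_zero.mpr (κ_ne_zero hf0)) (ha 0)
  choose u s hu hs e using fun i : Fin 3 => exists_squarefree_ratFunc (mul_ne_zero hD' (ha i.succ))
  have key₁ : ∀ (L : Type _) [Field L] (φ : RatFunc E →+* L),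
      IsotropicDiag (Matrix.vecCons (φ (-κ f)) fun i => φ (κ (u i))) ↔
        IsotropicDiag fun i => φ (a i) := by
    intro L _ φ
    refine isotropicDiag_iff_of_eq_mul_sq (D := φ (-κ f * a 0))
      (s := Matrix.vecCons (φ (a 0)) fun i => φ (s i)) ((map_ne_zero φ).mpr hD')
      (fun i => ?_) fun i => ?_
    · refine Fin.cases ?_ (fun i => ?_) i
      · exact (map_ne_zero φ).mpr (ha 0)
      · exact (map_ne_zero φ).mpr (hs i)
    · refine Fin.cases ?_ (fun i => ?_) i
      · simp only [Matrix.cons_val_zero, map_mul]; ring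
      · simp only [Matrix.cons_val_succ]
        rw [← map_pow, ← map_mul, ← e, map_mul]
  have hps : ∏ i, s i ≠ 0 := Finset.prod_ne_zero_iff.mpr fun i _ => hs i
  obtain ⟨t, ht⟩ : ∃ t, -∏ i, u i = t ^ 2 := by
    refine exists_eq_sq_of_κ (x := κ f ^ 2 * a 0 * s₀ / ∏ i, s i) ?_
    rw [div_pow, eq_div_iff (pow_ne_zero 2 hps), ← Finset.prod_pow, map_neg κ, map_prod κ, neg_mul,
      ← Finset.prod_mul_distrib, ← Finset.prod_congr rfl fun i _ => e i]
    rw [Fin.prod_univ_succ] at e₀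
    rw [Finset.prod_mul_distrib, Finset.prod_const, Finset.card_univ, Fintype.card_fin]
    linear_combination κ f ^ 3 * a 0 ^ 2 * e₀
  have hu0 : ∏ i, u i ≠ 0 := Finset.prod_ne_zero_iff.mpr fun i _ => (hu i).ne_zero
  obtain ⟨P₀, hP₀, -, hP₀p⟩ := exists_squarefree_support (mul_ne_zero hu0 hf0)
  obtain ⟨Q, rfl⟩ : f ∣ P₀ :=
    dvd_of_forall_prime_dvd hf fun p hp h => hP₀p p hp (h.mul_left _)
  obtain ⟨c, G, h, hc, hG, hPG, hh, j, hj, hja⟩ := exists_totally_isotropic_of_reflexive h2 hE HR hu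
    (m := 3) rfl (s := t) (by rw [← ht]; ring) hP₀
    (fun p i hp h => hP₀p p hp ((h.trans (Finset.dvd_prod_of_mem u (Finset.mem_univ i))).mul_right _))
    (fun p i hp _ => ternaryMod_of_reflexive h2 hE HR hp)
  rcases isotropicDiag_or_exists_isometry (RatFunc.algebraMap_injective E) j hj hja with h0 | ⟨T, hT⟩
  · refine (key₁ _ (RingHom.id _)).mp (IsotropicDiag.of_comp (Fin.succ_injective 3) ?_)
    exact IsotropicDiag.map κ (RatFunc.algebraMap_injective E) h0
  have hunit : IsUnit (C c) := isUnit_C.mpr hc.isUnit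
  have hfQ : IsCoprime f Q :=
    isCoprime_of_forall_prime hf0 fun p hp h => not_dvd_of_squarefree_mul hp hP₀ h
  have hq : ∀ i, (fun i => -κ (![-(C c * (f * Q)), -G, C c * (f * Q) * G] i)) i ≠ 0 := by
    have hcQ := mul_ne_zero (C_ne_zero.mpr hc) hP₀.ne_zero
    have hG0 := hG.ne_zero
    intro i
    refine neg_ne_zero.mpr (κ_ne_zero ?_)
    fin_cases i
    exacts [neg_ne_zero.mpr hcQ, neg_ne_zero.mpr hG0, mul_ne_zero hcQ hG0]
  have key₂ : ∀ (L : Type _) [Field L] (φ : RatFunc E →+* L),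
      IsotropicDiag (fun i => φ (κ (![-f, f * (C c * Q), G, -(f * (C c * Q) * G)] i))) ↔
        IsotropicDiag fun i => φ (a i) := by
    intro L _ φ
    rw [← key₁ L φ, ← isotropicDiag_cons_iff_of_isometry (T := T.map φ) (φ (-κ f))
      (fun i => (map_ne_zero φ).mpr (hq i))]
    · refine iff_of_eq (congrArg _ (funext fun i => ?_))
      refine Fin.cases (by simp) (fun i => ?_) i
      simp only [Matrix.cons_val_succ]
      refine congrArg φ ?_
      rw [← map_neg κ]
      refine congrArg κ ?_
      fin_cases i
      exacts [show f * (C c * Q) = -(-(C c * (f * Q))) by ring, (neg_neg G).symm,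
        show -(f * (C c * Q) * G) = -(C c * (f * Q) * G) by ring]
    · have := congrArg (fun M => φ.mapMatrix M) hT
      simp only [map_mul, RingHom.mapMatrix_apply, Matrix.transpose_map,
        Matrix.diagonal_map (map_zero φ)] at this
      exact this
  have hfQ' : IsCoprime f (C c * Q) := (isCoprime_mul_unit_left_right hunit f Q).mpr hfQ
  have hQG : IsCoprime (C c * Q) G :=
    (isCoprime_mul_unit_left_left hunit Q G).mpr hPG.of_mul_left_right
  have hQ : Squarefree (C c * Q) := squarefree_C_mul hc (hP₀.squarefree_of_dvd (dvd_mul_left _ _))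
  refine (key₂ _ (RingHom.id _)).mp (IsotropicDiag.map κ (RatFunc.algebraMap_injective E) ?_)
  refine isotropicDiag_of_locIso_quaternary h2 hE HR (h := h) hf hQ hG hfQ' hPG.of_mul_left_left hQG
    (by rwa [mul_left_comm]) fun v hv => ?_
  have h1 := locIso_of_isotropicCompletion v (fun i => κ_ne_zero ?_)
    (isotropicCompletion_congr v (fun L _ φ => (key₂ L φ).mpr) (hloc v hv))
  · refine cast (congrArg _ (funext fun i => ?_)) h1
    fin_cases i <;> simp
  · have hQ0 := hQ.ne_zero
    have hG0 := hG.ne_zero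
    have hfQ0 := mul_ne_zero hf0 hQ0
    fin_cases i
    exacts [neg_ne_zero.mpr hf0, hfQ0, hG0, neg_ne_zero.mpr (mul_ne_zero hfQ0 hG0)]

end Quaternary

end SquareReflexive

namespace SquareReflexive

open WithZero

section LowDimension

theorem isotropicDiag_three_of_four {F : Type*} [Field F] {a b c : F} (ha : a ≠ 0)
    (h : IsotropicDiag ![a, b, c, a * b * c]) : IsotropicDiag ![a, b, c] := by
  obtain ⟨x, hx, h0⟩ := h
  simp only [Fin.sum_univ_four, Matrix.cons_val] at h0
  by_cases hN : x 2 ^ 2 + a * b * x 3 ^ 2 = 0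
  · by_cases hw : x 3 = 0
    · have hz : x 2 = 0 := by simpa [hw] using hN
      refine ⟨![x 0, x 1, 0], fun h => hx (funext fun i => ?_), ?_⟩
      · have e0 : x 0 = 0 := congrFun h 0
        have e1 : x 1 = 0 := congrFun h 1
        fin_cases i <;> assumption
      · simp only [Fin.sum_univ_three, Matrix.cons_val]
        linear_combination h0 - c * hN
    · refine ⟨![x 2, a * x 3, 0], fun h => mul_ne_zero ha hw (congrFun h 1), ?_⟩
      simp only [Fin.sum_univ_three, Matrix.cons_val]
      linear_combination a * hN
  · refine ⟨![x 0 * x 2 + b * x 1 * x 3, x 1 * x 2 - a * x 0 * x 3, x 2 ^ 2 + a * b * x 3 ^ 2],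
      fun h => hN (congrFun h 2), ?_⟩
    simp only [Fin.sum_univ_three, Matrix.cons_val]
    linear_combination (x 2 ^ 2 + a * b * x 3 ^ 2) * h0

variable {E : Type*} [Field E]

local notation "κ" => algebraMap (Polynomial E) (RatFunc E)

theorem isotropicDiag_two_of_locIso {a b : RatFunc E} (ha : a ≠ 0) (hb : b ≠ 0)
    (h : ∀ v, IsZValuationTrivialOnBase E v → LocIso v ![a, b]) : IsotropicDiag ![a, b] := by
  obtain ⟨f, s, hf, hs, e⟩ := exists_squarefree_ratFunc (neg_ne_zero.mpr (mul_ne_zero ha hb))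
  have hl : ∀ v, IsZValuationTrivialOnBase E v → LocSq v (κ f) := fun v hv =>
    LocSq.of_mul_sq (s := s) (by rw [← e]; exact locSq_of_locIso_pair (h v hv))
  have hdeg : f.natDegree = 0 := by
    by_contra hd
    obtain ⟨p, hp, hpf⟩ := exists_prime_dvd (Nat.pos_of_ne_zero hd)
    obtain ⟨v, hz, hv⟩ := exists_placeAt hp
    exact (hv.ev_iff hf).mp (hl v hz).ev hpf
  obtain ⟨v, hz, hv⟩ := exists_infPlace (E := E)
  obtain ⟨d, hd⟩ := (hv.of_locSq (hl v hz)).2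
  rw [eq_C_of_natDegree_eq_zero hdeg, leadingCoeff_C] at hd
  rw [eq_C_of_natDegree_eq_zero hdeg, hd, C_mul, map_mul κ] at e
  refine ⟨![κ (C d) * s, a], fun h => ha (congrFun h 1), ?_⟩
  simp only [Fin.sum_univ_two, Matrix.cons_val]
  linear_combination -a * e

theorem isotropicDiag_of_completion (h2 : (2 : E) ≠ 0) (hE : TernaryIsotropic E)
    (HR : ∀ f : E[X], Squarefree f → Reflexive f) {n : ℕ} (a : Fin n → RatFunc E)
    (ha : ∀ i, a i ≠ 0)
    (hloc : ∀ v, IsZValuationTrivialOnBase E v → IsotropicCompletion v a) : IsotropicDiag a := by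
  match n, a, ha, hloc with
  | 0, a, ha, hloc =>
    obtain ⟨v, hz, -⟩ := exists_infPlace (E := E)
    obtain ⟨_, j, _⟩ := locIso_of_isotropicCompletion v ha (hloc v hz)
    exact j.elim0
  | 1, a, ha, hloc =>
    obtain ⟨v, hz, -⟩ := exists_infPlace (E := E)
    obtain ⟨x, j, hj⟩ := locIso_of_isotropicCompletion v ha (hloc v hz)
    rw [Fin.sum_univ_one, Subsingleton.elim j 0] at hj
    exact (lt_irrefl _ hj).elim
  | 2, a, ha, hloc =>
    have e : a = ![a 0, a 1] := by ext i; fin_cases i <;> rfl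
    rw [e]
    refine isotropicDiag_two_of_locIso (ha 0) (ha 1) fun v hv => ?_
    rw [← e]
    exact locIso_of_isotropicCompletion v ha (hloc v hv)
  | 3, a, ha, hloc =>
    have e : a = ![a 0, a 1, a 2] := by ext i; fin_cases i <;> rfl
    rw [e]
    refine isotropicDiag_three_of_four (ha 0)
      (isotropicDiag_of_completion_four h2 hE HR _ (fun i => ?_) fun v hv => ?_)
    · fin_cases i
      exacts [ha 0, ha 1, ha 2, mul_ne_zero (mul_ne_zero (ha 0) (ha 1)) (ha 2)]
    · refine isotropicCompletion_congr v (fun L _ φ h =>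
        IsotropicDiag.of_comp (Fin.castSucc_injective 3) ?_) (hloc v hv)
      refine cast (congrArg _ (funext fun i => ?_)) h
      fin_cases i <;> rfl
  | 4, a, ha, hloc => exact isotropicDiag_of_completion_four h2 hE HR a ha hloc
  | n + 5, a, ha, hloc =>
    exact IsotropicDiag.of_comp (Fin.castLE_injective (Nat.le_add_left 5 n))
      (isotropicDiag_of_five h2 hE HR _ fun i => ha _)

end LowDimension

end SquareReflexive

/-- `E` is square-reflexive if and only if: every 5-dimensional regular quadratic form
over `E(X)` is isotropic, and quadratic forms over `E(X)` satisfy the local-global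
principle for isotropy with respect to ℤ-valuations trivial on `E`. -/
theorem statement0 (E : Type*) [Field E] (hchar : ringChar E ≠ 2) :
    (∀ f : Polynomial E, Squarefree f → IsSquareReflexive f) ↔
    ((∀ a : Fin 5 → RatFunc E, (∀ i, a i ≠ 0) → IsotropicDiag a) ∧
     (∀ (n : ℕ) (a : Fin n → RatFunc E), (∀ i, a i ≠ 0) → ¬ IsotropicDiag a →
        ∃ v : Valuation (RatFunc E) (WithZero (Multiplicative ℤ)),
          IsZValuationTrivialOnBase E v ∧ ¬ IsotropicCompletion v a)) := by
  have h2 : (2 : E) ≠ 0 := Ring.two_ne_zero hchar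
  refine ⟨fun H => ?_, fun ⟨h5, hlg⟩ f hf =>
    (SquareReflexive.localGlobal_of_isotropic h2 h5 hlg).isSquareReflexive hf⟩
  have HR : ∀ f : Polynomial E, Squarefree f → SquareReflexive.Reflexive f :=
    fun f hf => SquareReflexive.reflexive_of_isSquareReflexive (H f hf)
  have hE := SquareReflexive.ternaryIsotropic_of_reflexive h2 HR
  refine ⟨SquareReflexive.isotropicDiag_of_five h2 hE HR, fun n a ha hani => ?_⟩
  by_contra hcon
  push Not at hcon
  exact hani (SquareReflexive.isotropicDiag_of_completion h2 hE HR a ha hcon)
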